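/- Let S(X) be the number of distinct biquadratic extensions K/ℚ (subfields of a fixed algebraic closure of ℚ, Galois over ℚ with group (ℤ/2ℤ)²) with discriminant Δ_K ≤ X, and let S̃(X) be the number of those that fail the Hasse norm principle. Then S̃(X)/S(X) → 0 as X → ∞; that is, 0% of biquadratic extensions of ℚ, ordered by discriminant, fail the Hasse norm principle. -/

import Mathlib

open scoped Classical TensorProduct

/-- The discriminant of a finite-dimensional intermediate field of `ℚ̄/ℚ`
(junk value `0` in the infinite-dimensional case). -/
noncomputable def biquadDiscr (K : IntermediateField ℚ (AlgebraicClosure ℚ)) : ℤ :=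
  if h : FiniteDimensional ℚ K then
    letI := h
    letI : NumberField K := ⟨⟩
    NumberField.discr K
  else 0

/-- `K` is a biquadratic extension of `ℚ`: a (finite) Galois extension with Galois group
isomorphic to `(ℤ/2ℤ)²`. -/
def IsBiquadratic (K : IntermediateField ℚ (AlgebraicClosure ℚ)) : Prop :=
  FiniteDimensional ℚ K ∧ IsGalois ℚ K ∧
    Nonempty ((K ≃ₐ[ℚ] K) ≃* Multiplicative (ZMod 2 × ZMod 2))

/-- A finite Galois extension `K/ℚ` satisfies the Hasse norm principle if every nonzero
rational that is a local norm everywhere (a norm from `ℚ_p ⊗_ℚ K` for every prime `p`,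
and a norm from `ℝ ⊗_ℚ K`) is a global norm from `K`. -/
def HasseNormPrinciple (K : Type*) [Field K] [Algebra ℚ K] : Prop :=
  ∀ x : ℚ, x ≠ 0 →
    ((∀ (p : ℕ) [Fact p.Prime],
        ∃ y : ℚ_[p] ⊗[ℚ] K, IsUnit y ∧ Algebra.norm ℚ_[p] y = (x : ℚ_[p])) ∧
      (∃ y : ℝ ⊗[ℚ] K, IsUnit y ∧ Algebra.norm ℝ y = (x : ℝ))) →
    ∃ y : K, y ≠ 0 ∧ Algebra.norm ℚ y = x

/-- The number of biquadratic extensions of `ℚ` (inside a fixed algebraic closure)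
with discriminant at most `X` that fail the Hasse norm principle. -/
noncomputable def biquadHNPFailCount (X : ℝ) : ℕ :=
  Set.ncard {K : IntermediateField ℚ (AlgebraicClosure ℚ) |
    IsBiquadratic K ∧ (biquadDiscr K : ℝ) ≤ X ∧ ¬HasseNormPrinciple K}

/-- The number of biquadratic extensions of `ℚ` (inside a fixed algebraic closure)
with discriminant at most `X`. -/
noncomputable def biquadCount (X : ℝ) : ℕ :=
  Set.ncard {K : IntermediateField ℚ (AlgebraicClosure ℚ) |
    IsBiquadratic K ∧ (biquadDiscr K : ℝ) ≤ X}

set_option maxHeartbeats 1000000 in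
lemma legendre_natural {a b c : ℕ} (ha : 0 < a) (hb : 0 < b) (hc : 0 < c)
    (hab : a.Coprime b) (hac : a.Coprime c) (hbc : b.Coprime c)
    (sa : Squarefree a) (sb : Squarefree b) (sc : Squarefree c)
    {r s t : ℤ} (hr : (a : ℤ) ∣ r ^ 2 - b * c) (hs : (b : ℤ) ∣ s ^ 2 - a * c)
    (ht : (c : ℤ) ∣ t ^ 2 + a * b) :
    ∃ x y z : ℤ, (x ≠ 0 ∨ y ≠ 0 ∨ z ≠ 0) ∧ a * x ^ 2 + b * y ^ 2 = c * z ^ 2 := by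
  have : NeZero a := ⟨ha.ne'⟩
  have : NeZero b := ⟨hb.ne'⟩
  have : NeZero c := ⟨hc.ne'⟩
  let box : Finset (ℕ × ℕ × ℕ) := Finset.range (Nat.sqrt (b * c) + 1) ×ˢ
    Finset.range (Nat.sqrt (a * c) + 1) ×ˢ Finset.range (Nat.sqrt (a * b) + 1)
  let f : ℕ × ℕ × ℕ → ZMod a × ZMod b × ZMod c := fun v =>
    (((b * v.2.1 - r * v.2.2 : ℤ) : ZMod a), ((a * v.1 - s * v.2.2 : ℤ) : ZMod b),
      ((a * v.1 - t * v.2.1 : ℤ) : ZMod c))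
  have hcard : (Finset.univ : Finset (ZMod a × ZMod b × ZMod c)).card < box.card := by
    simp only [Finset.card_univ, Fintype.card_prod, ZMod.card, box, Finset.card_product,
      Finset.card_range]
    have h1 := Nat.lt_succ_sqrt (b * c)
    have h2 := Nat.lt_succ_sqrt (a * c)
    have h3 := Nat.lt_succ_sqrt (a * b)
    simp only [Nat.succ_eq_add_one] at h1 h2 h3
    set u := Nat.sqrt (b * c) + 1
    set v := Nat.sqrt (a * c) + 1
    set w := Nat.sqrt (a * b) + 1
    have h4 : (b * c) * ((a * c) * (a * b)) < (u * u) * ((v * v) * (w * w)) := by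
      gcongr
    by_contra hcon
    push Not at hcon
    have h5 := Nat.mul_le_mul hcon hcon
    nlinarith
  obtain ⟨p, hp, q, hq, hpq, hf⟩ := Finset.exists_ne_map_eq_of_card_lt_of_maps_to hcard
    (f := f) (fun _ _ => Finset.mem_univ _)
  obtain ⟨x1, y1, z1⟩ := p
  obtain ⟨x2, y2, z2⟩ := q
  simp only [box, Finset.mem_product, Finset.mem_range, Nat.lt_succ_iff] at hp hq
  simp only [f, Prod.mk.injEq] at hf
  obtain ⟨f1, f2, f3⟩ := hf
  rw [← sub_eq_zero, ← Int.cast_sub, ZMod.intCast_zmod_eq_zero_iff_dvd] at f1 f2 f3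
  have key : ∀ {n m k : ℕ}, n ≤ Nat.sqrt k → m ≤ Nat.sqrt k → ((n : ℤ) - m) ^ 2 ≤ k := by
    intro n m k hn hm
    have hk : ((Nat.sqrt k : ℕ) : ℤ) ^ 2 ≤ k := by exact_mod_cast Nat.sqrt_le' k
    have : |(n : ℤ) - m| ≤ Nat.sqrt k := by
      rw [abs_le]; constructor <;> omega
    calc ((n : ℤ) - m) ^ 2 = |(n : ℤ) - m| ^ 2 := (sq_abs _).symm
      _ ≤ ((Nat.sqrt k : ℕ) : ℤ) ^ 2 := by gcongr
      _ ≤ k := hk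
  have bx := key hp.1 hq.1
  have bY := key hp.2.1 hq.2.1
  have bz := key hp.2.2 hq.2.2
  have hne : (x1 : ℤ) - x2 ≠ 0 ∨ (y1 : ℤ) - y2 ≠ 0 ∨ (z1 : ℤ) - z2 ≠ 0 := by
    by_contra hcon
    push Not at hcon
    apply hpq
    obtain ⟨h1, h2, h3⟩ := hcon
    simp only [Prod.mk.injEq]
    refine ⟨?_, ?_, ?_⟩ <;> omega
  set x : ℤ := (x1 : ℤ) - x2 with hx
  set y : ℤ := (y1 : ℤ) - y2 with hy
  set z : ℤ := (z1 : ℤ) - z2 with hz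
  push_cast at bx bY bz
  replace f1 : (a : ℤ) ∣ b * y - r * z := by
    convert f1 using 1; simp only [hy, hz]; ring
  replace f2 : (b : ℤ) ∣ a * x - s * z := by
    convert f2 using 1; simp only [hx, hz]; ring
  replace f3 : (c : ℤ) ∣ a * x - t * y := by
    convert f3 using 1; simp only [hx, hy]; ring
  have Iab : IsCoprime (a : ℤ) b := Nat.isCoprime_iff_coprime.2 hab
  have Iac : IsCoprime (a : ℤ) c := Nat.isCoprime_iff_coprime.2 hac
  have Ibc : IsCoprime (b : ℤ) c := Nat.isCoprime_iff_coprime.2 hbc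
  set V : ℤ := a * x ^ 2 + b * y ^ 2 - c * z ^ 2 with hV
  have d1 : (a : ℤ) ∣ V := by
    apply Iab.dvd_of_dvd_mul_left
    have : (b : ℤ) * V = a * (b * x ^ 2) + (b * y - r * z) * (b * y + r * z)
        + (r ^ 2 - b * c) * z ^ 2 := by rw [hV]; ring
    rw [this]
    exact dvd_add (dvd_add (dvd_mul_right _ _) (f1.mul_right _)) (hr.mul_right _)
  have d2 : (b : ℤ) ∣ V := by
    apply Iab.symm.dvd_of_dvd_mul_left
    have : (a : ℤ) * V = b * (a * y ^ 2) + (a * x - s * z) * (a * x + s * z)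
        + (s ^ 2 - a * c) * z ^ 2 := by rw [hV]; ring
    rw [this]
    exact dvd_add (dvd_add (dvd_mul_right _ _) (f2.mul_right _)) (hs.mul_right _)
  have d3 : (c : ℤ) ∣ V := by
    apply Iac.symm.dvd_of_dvd_mul_left
    have : (a : ℤ) * V = c * (- a * z ^ 2) + (a * x - t * y) * (a * x + t * y)
        + (t ^ 2 + a * b) * y ^ 2 := by rw [hV]; ring
    rw [this]
    exact dvd_add (dvd_add (dvd_mul_right _ _) (f3.mul_right _)) (ht.mul_right _)
  have hdvd : (a * b * c : ℤ) ∣ V :=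
    (Iac.mul_left Ibc).mul_dvd (Iab.mul_dvd d1 d2) d3
  obtain ⟨k, hk⟩ := hdvd
  have ha' : (0 : ℤ) < a := by exact_mod_cast ha
  have hb' : (0 : ℤ) < b := by exact_mod_cast hb
  have hc' : (0 : ℤ) < c := by exact_mod_cast hc
  have hm : (0 : ℤ) < a * b * c := by positivity
  have e1 : (a : ℤ) * x ^ 2 ≤ a * b * c := by
    linarith [mul_le_mul_of_nonneg_left bx ha'.le]
  have e2 : (b : ℤ) * y ^ 2 ≤ a * b * c := by
    linarith [mul_le_mul_of_nonneg_left bY hb'.le]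
  have e3 : (c : ℤ) * z ^ 2 ≤ a * b * c := by
    linarith [mul_le_mul_of_nonneg_left bz hc'.le]
  have e1' : (0 : ℤ) ≤ a * x ^ 2 := by positivity
  have e2' : (0 : ℤ) ≤ b * y ^ 2 := by positivity
  have e3' : (0 : ℤ) ≤ c * z ^ 2 := by positivity
  have hk1 : -1 ≤ k := by
    by_contra h
    have h2 : k ≤ -2 := by omega
    linarith [mul_le_mul_of_nonneg_left h2 hm.le]
  have hk2 : k ≤ 2 := by
    by_contra h
    have h2 : 3 ≤ k := by omega
    linarith [mul_le_mul_of_nonneg_left h2 hm.le]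
  -- two coprime squarefree numbers whose product is a square are both one
  have sqone : ∀ {m n : ℕ} (_ : m.Coprime n) (_ : Squarefree m) (_ : Squarefree n) (w : ℤ),
      w ^ 2 = m * n → m = 1 ∧ n = 1 := by
    intro m n hmn hm hn w hw
    have hsq : Squarefree (m * n) := (Nat.squarefree_mul_iff).2 ⟨hmn, hm, hn⟩
    have h1 : w.natAbs * w.natAbs = m * n := by
      zify; rw [← hw]; rw [← sq, sq_abs]
    have := hsq w.natAbs ⟨1, by rw [h1]; ring⟩
    rw [Nat.isUnit_iff] at this
    rw [this] at h1
    simpa using h1.symm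
  have hcases : k = -1 ∨ k = 0 ∨ k = 1 ∨ k = 2 := by omega
  rcases hcases with rfl | rfl | rfl | rfl
  · have hzz : z ^ 2 = a * b := mul_left_cancel₀ hc'.ne' (by linarith)
    obtain ⟨rfl, rfl⟩ := sqone hab sa sb z hzz
    have : IsSquare (-1 : ZMod c) := by
      refine ⟨(t : ZMod c), ?_⟩
      have := (ZMod.intCast_zmod_eq_zero_iff_dvd _ c).2 ht
      push_cast at this
      linear_combination -this
    obtain ⟨u, v, huv⟩ := Nat.eq_sq_add_sq_of_isSquare_mod_neg_one this
    refine ⟨u, v, 1, by simp, ?_⟩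
    push_cast
    have : (c : ℤ) = u ^ 2 + v ^ 2 := by exact_mod_cast huv
    rw [this]; ring
  · exact ⟨x, y, z, hne, by linarith⟩
  · refine ⟨x * z + b * y, y * z - a * x, z ^ 2 + a * b, Or.inr (Or.inr (by positivity)), ?_⟩
    have : (a : ℤ) * x ^ 2 + b * y ^ 2 = c * (z ^ 2 + a * b) := by linarith
    linear_combination (z ^ 2 + a * b) * this
  · have hxx : x ^ 2 = b * c := mul_left_cancel₀ ha'.ne' (by linarith)
    have hyy : y ^ 2 = a * c := mul_left_cancel₀ hb'.ne' (by linarith)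
    obtain ⟨rfl, rfl⟩ := sqone hbc sb sc x hxx
    obtain ⟨rfl, -⟩ := sqone hac sa sc y hyy
    exact ⟨1, 0, 1, by simp, by simp⟩

lemma exists_dvd_sq_sub_of_squarefree {m : ℕ} (hm : Squarefree m) (x : ℤ)
    (h : ∀ l : ℕ, l.Prime → l ≠ 2 → l ∣ m → IsSquare (x : ZMod l)) :
    ∃ r : ℤ, (m : ℤ) ∣ r ^ 2 - x := by
  induction m using Nat.recOnMul with
  | zero => exact absurd hm (by simp)
  | one => exact ⟨0, by simp⟩
  | prime p hp =>
    by_cases h2 : p = 2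
    · subst h2
      refine ⟨x, ?_⟩
      have : x ^ 2 - x = (x - 1) * ((x - 1) + 1) := by ring
      rw [this]
      exact (Int.even_mul_succ_self (x - 1)).two_dvd
    · obtain ⟨r, hr⟩ := h p hp h2 dvd_rfl
      obtain ⟨r, rfl⟩ := ZMod.intCast_surjective r
      refine ⟨r, ?_⟩
      rw [← ZMod.intCast_zmod_eq_zero_iff_dvd]
      push_cast
      rw [hr]; ring
  | mul a b iha ihb =>
    obtain ⟨hab, ha, hb⟩ := Nat.squarefree_mul_iff.1 hm
    obtain ⟨r, hr⟩ := iha ha fun l hl h2 hd => h l hl h2 (hd.mul_right _)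
    obtain ⟨s, hs⟩ := ihb hb fun l hl h2 hd => h l hl h2 (hd.mul_left _)
    have I : IsCoprime (a : ℤ) b := Nat.isCoprime_iff_coprime.2 hab
    obtain ⟨u, v, huv⟩ := I
    refine ⟨r * (v * b) + s * (u * a), ?_⟩
    push_cast
    refine IsCoprime.mul_dvd ⟨u, v, huv⟩ ?_ ?_
    · have : (r * (v * b) + s * (u * a)) ^ 2 - x = (r ^ 2 - x) +
          a * (u * (s - r) * (2 * r + u * a * (s - r))) := by
        have : v * b = 1 - u * a := by linarith
        rw [this]; ring
      rw [this]
      exact dvd_add hr (dvd_mul_right _ _)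
    · have : (r * (v * b) + s * (u * a)) ^ 2 - x = (s ^ 2 - x) +
          b * (v * (r - s) * (2 * s + v * b * (r - s))) := by
        have : u * a = 1 - v * b := by linarith
        rw [this]; ring
      rw [this]
      exact dvd_add hs (dvd_mul_right _ _)

lemma squarefree_neg_int {x : ℤ} (hx : Squarefree x) : Squarefree (-x) := by
  rw [← Int.squarefree_natAbs] at hx ⊢
  simpa using hx

/-- The condition at the odd primes dividing `A` in Legendre's theorem on
`A x² + B y² + C z² = 0`. -/
def LegendreCond (A B C : ℤ) : Prop :=
  ∀ l : ℕ, l.Prime → l ≠ 2 → (l : ℤ) ∣ A → IsSquare ((-(B * C) : ℤ) : ZMod l)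

lemma LegendreCond.swap {A B C : ℤ} (h : LegendreCond A B C) : LegendreCond A C B := by
  intro l h1 h2 h3
  rw [mul_comm]
  exact h l h1 h2 h3

lemma LegendreCond.neg {A B C : ℤ} (h : LegendreCond A B C) :
    LegendreCond (-A) (-B) (-C) := by
  intro l h1 h2 h3
  rw [neg_mul_neg]
  exact h l h1 h2 (by simpa using h3)

lemma legendre_of_pos_pos_neg {A B C : ℤ} (hA : 0 < A) (hB : 0 < B) (hC : C < 0)
    (hAB : IsCoprime A B) (hAC : IsCoprime A C) (hBC : IsCoprime B C)
    (sA : Squarefree A) (sB : Squarefree B) (sC : Squarefree C)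
    (cA : LegendreCond A B C) (cB : LegendreCond B A C) (cC : LegendreCond C A B) :
    ∃ x y z : ℤ, (x ≠ 0 ∨ y ≠ 0 ∨ z ≠ 0) ∧ A * x ^ 2 + B * y ^ 2 + C * z ^ 2 = 0 := by
  obtain ⟨a, rfl⟩ := Int.eq_ofNat_of_zero_le hA.le
  obtain ⟨b, rfl⟩ := Int.eq_ofNat_of_zero_le hB.le
  obtain ⟨c, hc⟩ := Int.eq_ofNat_of_zero_le (neg_pos.2 hC).le
  obtain rfl : C = -(c : ℤ) := by linarith
  rw [IsCoprime.neg_right_iff, Nat.isCoprime_iff_coprime] at hAC hBC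
  rw [Nat.isCoprime_iff_coprime] at hAB
  have sC' : Squarefree (c : ℤ) := by
    rw [← Int.squarefree_natAbs] at sC ⊢
    simpa using sC
  rw [Int.squarefree_natCast] at sA sB sC'
  obtain ⟨r, hr⟩ := exists_dvd_sq_sub_of_squarefree sA _ fun l h1 h2 h3 =>
    cA l h1 h2 (by exact_mod_cast h3)
  obtain ⟨s, hs⟩ := exists_dvd_sq_sub_of_squarefree sB _ fun l h1 h2 h3 =>
    cB l h1 h2 (by exact_mod_cast h3)
  obtain ⟨t, ht⟩ := exists_dvd_sq_sub_of_squarefree sC' _ fun l h1 h2 h3 =>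
    cC l h1 h2 (by rw [dvd_neg]; exact_mod_cast h3)
  obtain ⟨x, y, z, h0, h⟩ := legendre_natural (r := r) (s := s) (t := t) (by exact_mod_cast hA)
    (by exact_mod_cast hB) (by
      have : (0 : ℤ) < c := by linarith
      exact_mod_cast this) hAB hAC hBC sA sB sC' (by convert hr using 1; ring)
    (by convert hs using 1; ring) (by convert ht using 1; ring)
  exact ⟨x, y, z, h0, by linarith⟩

/-- Legendre's theorem on ternary quadratic forms. -/
theorem legendre_ternary {A B C : ℤ}
    (hpos : 0 < A ∨ 0 < B ∨ 0 < C) (hneg : A < 0 ∨ B < 0 ∨ C < 0)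
    (hAB : IsCoprime A B) (hAC : IsCoprime A C) (hBC : IsCoprime B C)
    (sA : Squarefree A) (sB : Squarefree B) (sC : Squarefree C)
    (cA : LegendreCond A B C) (cB : LegendreCond B A C) (cC : LegendreCond C A B) :
    ∃ x y z : ℤ, (x ≠ 0 ∨ y ≠ 0 ∨ z ≠ 0) ∧ A * x ^ 2 + B * y ^ 2 + C * z ^ 2 = 0 := by
  rcases lt_or_gt_of_ne sA.ne_zero with a | a <;> rcases lt_or_gt_of_ne sB.ne_zero with b | b <;>
    rcases lt_or_gt_of_ne sC.ne_zero with c | c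
  · omega
  · obtain ⟨x, y, z, h0, h⟩ := legendre_of_pos_pos_neg (A := -A) (B := -B) (C := -C)
      (by omega) (by omega) (by omega) hAB.neg_neg hAC.neg_neg hBC.neg_neg
      (squarefree_neg_int sA) (squarefree_neg_int sB) (squarefree_neg_int sC) cA.neg cB.neg cC.neg
    exact ⟨x, y, z, h0, by linarith⟩
  · obtain ⟨x, y, z, h0, h⟩ := legendre_of_pos_pos_neg (A := -A) (B := -C) (C := -B)
      (by omega) (by omega) (by omega) hAC.neg_neg hAB.neg_neg hBC.symm.neg_neg
      (squarefree_neg_int sA) (squarefree_neg_int sC) (squarefree_neg_int sB)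
        cA.swap.neg cC.neg cB.neg
    exact ⟨x, z, y, by tauto, by linarith⟩
  · obtain ⟨x, y, z, h0, h⟩ := legendre_of_pos_pos_neg (A := B) (B := C) (C := A)
      (by omega) (by omega) (by omega) hBC hAB.symm hAC.symm
      sB sC sA cB.swap cC.swap cA
    exact ⟨z, x, y, by tauto, by linarith⟩
  · obtain ⟨x, y, z, h0, h⟩ := legendre_of_pos_pos_neg (A := -B) (B := -C) (C := -A)
      (by omega) (by omega) (by omega) hBC.neg_neg hAB.symm.neg_neg hAC.symm.neg_neg
      (squarefree_neg_int sB) (squarefree_neg_int sC) (squarefree_neg_int sA)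
        cB.swap.neg cC.swap.neg cA.neg
    exact ⟨z, x, y, by tauto, by linarith⟩
  · obtain ⟨x, y, z, h0, h⟩ := legendre_of_pos_pos_neg (A := A) (B := C) (C := B)
      (by omega) (by omega) (by omega) hAC hAB hBC.symm
      sA sC sB cA.swap cC cB
    exact ⟨x, z, y, by tauto, by linarith⟩
  · exact legendre_of_pos_pos_neg a b c hAB hAC hBC sA sB sC cA cB cC
  · omega

section Reciprocity

open NumberTheorySymbols

/-- `r` is a norm from the quadratic algebra `ℚ(√d)`. -/
def NormSq (d : ℤ) (r : ℚ) : Prop := ∃ x y : ℚ, r = x ^ 2 - d * y ^ 2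

lemma NormSq.mul {d : ℤ} {r s : ℚ} (hr : NormSq d r) (hs : NormSq d s) : NormSq d (r * s) := by
  obtain ⟨x, y, rfl⟩ := hr
  obtain ⟨z, w, rfl⟩ := hs
  exact ⟨x * z + d * y * w, x * w + y * z, by ring⟩

lemma normSq_sq (d : ℤ) (x : ℚ) : NormSq d (x ^ 2) := ⟨x, 0, by ring⟩

lemma normSq_of_isSquare {d : ℤ} (hd : d ≠ 0) {e : ℚ} (he : (d : ℚ) = e ^ 2) (r : ℚ) :
    NormSq d r := by
  have : e ≠ 0 := by
    rintro rfl
    apply hd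
    have : (d : ℚ) = 0 := by rw [he]; ring
    exact_mod_cast this
  refine ⟨(r + 1) / 2, (r - 1) / (2 * e), ?_⟩
  rw [he]; field_simp; ring

theorem normSq_of_legendre {g d n : ℤ} (hg : 0 < g) (hsign : 0 < d ∨ 0 < n)
    (hgd : IsCoprime g d) (hgn : IsCoprime g n) (hdn : IsCoprime d n)
    (sg : Squarefree g) (sd : Squarefree d) (sn : Squarefree n)
    (h1 : ∀ l : ℕ, l.Prime → l ≠ 2 → (l : ℤ) ∣ g → IsSquare ((-(d * n) : ℤ) : ZMod l))
    (h2 : ∀ l : ℕ, l.Prime → l ≠ 2 → (l : ℤ) ∣ d → IsSquare ((g * n : ℤ) : ZMod l))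
    (h3 : ∀ l : ℕ, l.Prime → l ≠ 2 → (l : ℤ) ∣ n → IsSquare ((g * d : ℤ) : ZMod l)) :
    NormSq (g * d) (g * n) := by
  obtain ⟨x, y, z, h0, h⟩ := legendre_ternary (A := g) (B := -d) (C := -n) (Or.inl hg)
    (by omega) hgd.neg_right hgn.neg_right hdn.neg_neg
    sg (squarefree_neg_int sd) (squarefree_neg_int sn)
    (fun l hl hl2 hlg => by rw [neg_mul_neg]; exact h1 l hl hl2 hlg)
    (fun l hl hl2 hlg => by
      rw [mul_neg, neg_neg]; exact h2 l hl hl2 (by simpa using hlg))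
    (fun l hl hl2 hlg => by
      rw [mul_neg, neg_neg]; exact h3 l hl hl2 (by simpa using hlg))
  have hq : (g : ℚ) * x ^ 2 - d * y ^ 2 - n * z ^ 2 = 0 := by
    have : ((g * x ^ 2 + -d * y ^ 2 + -n * z ^ 2 : ℤ) : ℚ) = 0 := by rw [h]; simp
    push_cast at this
    linarith
  by_cases hz : z = 0
  · subst hz
    have hy : (y : ℚ) ≠ 0 := by
      intro hy
      have hy' : y = 0 := by exact_mod_cast hy
      subst hy'
      have : x = 0 := by
        have : g * x ^ 2 = 0 := by linarith
        rcases mul_eq_zero.1 this with h | h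
        · omega
        · exact pow_eq_zero_iff (two_ne_zero) |>.1 h
      simp_all
    refine normSq_of_isSquare (mul_ne_zero hg.ne' sd.ne_zero) (e := g * x / y) ?_ _
    push_cast
    field_simp
    push_cast at hq
    linear_combination -hq
  · have hz' : (z : ℚ) ≠ 0 := by exact_mod_cast hz
    refine ⟨g * x / z, y / z, ?_⟩
    push_cast
    field_simp
    linear_combination -hq

lemma exists_prime_linear_congruences (B : ℕ) {m₁ m₂ m₃ : ℕ} {k₁ k₂ k₃ t₁ t₂ t₃ : ℤ}
    (hm₁ : m₁ ≠ 0) (hm₂ : m₂ ≠ 0) (hm₃ : m₃ ≠ 0)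
    (h₁₂ : IsCoprime (m₁ : ℤ) m₂) (h₁₃ : IsCoprime (m₁ : ℤ) m₃) (h₂₃ : IsCoprime (m₂ : ℤ) m₃)
    (hk₁ : IsCoprime k₁ m₁) (hk₂ : IsCoprime k₂ m₂) (hk₃ : IsCoprime k₃ m₃)
    (ht₁ : IsCoprime t₁ m₁) (ht₂ : IsCoprime t₂ m₂) (ht₃ : IsCoprime t₃ m₃) :
    ∃ l : ℕ, B < l ∧ l.Prime ∧ k₁ * l ≡ t₁ [ZMOD m₁] ∧ k₂ * l ≡ t₂ [ZMOD m₂] ∧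
      k₃ * l ≡ t₃ [ZMOD m₃] := by
  have crt : ∀ {m n : ℕ} {x y : ℤ}, IsCoprime (m : ℤ) n → IsCoprime x m → IsCoprime y n →
      ∃ z : ℤ, IsCoprime z ((m * n : ℕ) : ℤ) ∧ z ≡ x [ZMOD m] ∧ z ≡ y [ZMOD n] := by
    intro m n x y hmn hx hy
    obtain ⟨u, v, huv⟩ := hmn
    have e1 : x * (v * n) + y * (u * m) = x + m * (u * (y - x)) := by
      have : v * n = 1 - u * m := by linarith
      rw [this]; ring
    have e2 : x * (v * n) + y * (u * m) = y + n * (v * (x - y)) := by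
      have : u * m = 1 - v * n := by linarith
      rw [this]; ring
    refine ⟨x * (v * n) + y * (u * m), ?_, ?_, ?_⟩
    · push_cast
      refine IsCoprime.mul_right ?_ ?_
      · rw [e1]; exact IsCoprime.add_mul_right_left hx _ |> fun h => by rwa [mul_comm] at h
      · rw [e2]; exact IsCoprime.add_mul_right_left hy _ |> fun h => by rwa [mul_comm] at h
    · rw [e1]; exact (Int.modEq_iff_dvd.2 ⟨-(u * (y - x)), by ring⟩)
    · rw [e2]; exact (Int.modEq_iff_dvd.2 ⟨-(v * (x - y)), by ring⟩)
  have lin : ∀ {m : ℕ} {k t : ℤ}, IsCoprime k m → IsCoprime t m →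
      ∃ x : ℤ, IsCoprime x m ∧ ∀ y, y ≡ x [ZMOD m] → k * y ≡ t [ZMOD m] := by
    intro m k t hk ht
    obtain ⟨u, v, huv⟩ := hk
    refine ⟨u * t, IsCoprime.mul_left ⟨k, v, by linarith⟩ ht, fun y hy => ?_⟩
    refine (hy.mul_left k).trans ?_
    exact Int.modEq_iff_dvd.2 ⟨v * t, by linear_combination -t * huv⟩
  obtain ⟨x₁, c₁, g₁⟩ := lin hk₁ ht₁
  obtain ⟨x₂, c₂, g₂⟩ := lin hk₂ ht₂
  obtain ⟨x₃, c₃, g₃⟩ := lin hk₃ ht₃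
  obtain ⟨z, cz, z1, z2⟩ := crt h₁₂ c₁ c₂
  obtain ⟨w, cw, w1, w2⟩ := crt (m := m₁ * m₂) (n := m₃)
    (by push_cast; exact IsCoprime.mul_left h₁₃ h₂₃) cz c₃
  obtain ⟨l, hl, hp, hlw⟩ := Nat.forall_exists_prime_gt_and_zmodEq B (q := m₁ * m₂ * m₃)
    (by positivity) cw
  have hlw' : (l : ℤ) ≡ w [ZMOD (m₁ * m₂ : ℕ)] :=
    hlw.of_dvd (by push_cast; exact dvd_mul_right _ _)
  have hlz : (l : ℤ) ≡ z [ZMOD (m₁ * m₂ : ℕ)] := hlw'.trans w1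
  exact ⟨l, hl, hp, g₁ _ ((hlz.of_dvd (by push_cast; exact dvd_mul_right _ _)).trans z1),
    g₂ _ ((hlz.of_dvd (by push_cast; exact dvd_mul_left _ _)).trans z2),
    g₃ _ ((hlw.of_dvd (by push_cast; exact dvd_mul_left _ _)).trans w2)⟩

end Reciprocity

section NormGroup

open NumberTheorySymbols

/-- `r` is a product of norms from the three algebras `ℚ(√(ab))`, `ℚ(√(ac))`, `ℚ(√(bc))`. -/
def NormProd (a b c : ℤ) (r : ℚ) : Prop :=
  ∃ n₁ n₂ n₃ : ℚ, NormSq (a * b) n₁ ∧ NormSq (a * c) n₂ ∧ NormSq (b * c) n₃ ∧ r = n₁ * n₂ * n₃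

namespace NormProd

variable {a b c : ℤ} {r s : ℚ}

lemma swap_left (h : NormProd a b c r) : NormProd b a c r := by
  obtain ⟨n₁, n₂, n₃, h₁, h₂, h₃, rfl⟩ := h
  exact ⟨n₁, n₃, n₂, by rwa [mul_comm], h₃, h₂, by ring⟩

lemma swap_right (h : NormProd a b c r) : NormProd a c b r := by
  obtain ⟨n₁, n₂, n₃, h₁, h₂, h₃, rfl⟩ := h
  exact ⟨n₂, n₁, n₃, h₂, h₁, by rwa [mul_comm], by ring⟩

lemma mul (hr : NormProd a b c r) (hs : NormProd a b c s) : NormProd a b c (r * s) := by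
  obtain ⟨n₁, n₂, n₃, h₁, h₂, h₃, rfl⟩ := hr
  obtain ⟨m₁, m₂, m₃, k₁, k₂, k₃, rfl⟩ := hs
  exact ⟨_, _, _, h₁.mul k₁, h₂.mul k₂, h₃.mul k₃, by ring⟩

lemma of_normSq (h : NormSq (a * b) r) : NormProd a b c r :=
  ⟨r, 1, 1, h, by simpa using normSq_sq (a * c) 1, by simpa using normSq_sq (b * c) 1, by ring⟩

lemma sq (x : ℚ) : NormProd a b c (x ^ 2) := of_normSq (normSq_sq _ _)

lemma of_mul (hs0 : s ≠ 0) (h : NormProd a b c (r * s)) (hs : NormProd a b c s) :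
    NormProd a b c r := by
  have := (h.mul hs).mul (sq (a := a) (b := b) (c := c) s⁻¹)
  convert this using 1
  field_simp

end NormProd

/-- The admissible unit-or-even parts of a coefficient. -/
def IsTwoUnit (u : ℤ) : Prop := u = 1 ∨ u = -1 ∨ u = 2 ∨ u = -2

/-- Coefficients `u₁ a, u₂ b, u₃ c` that are squarefree, pairwise coprime and have odd parts
`a, b, c > 1`. -/
structure Admissible (u₁ u₂ u₃ : ℤ) (a b c : ℕ) : Prop where
  unit₁ : IsTwoUnit u₁
  unit₂ : IsTwoUnit u₂
  unit₃ : IsTwoUnit u₃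
  odd₁ : Odd a
  odd₂ : Odd b
  odd₃ : Odd c
  sq₁ : Squarefree a
  sq₂ : Squarefree b
  sq₃ : Squarefree c
  gt₁ : 1 < a
  gt₂ : 1 < b
  gt₃ : 1 < c
  cop₁₂ : IsCoprime (u₁ * a) (u₂ * b)
  cop₁₃ : IsCoprime (u₁ * a) (u₃ * c)
  cop₂₃ : IsCoprime (u₂ * b) (u₃ * c)

namespace Admissible

variable {u₁ u₂ u₃ : ℤ} {a b c : ℕ}

lemma swap_left (h : Admissible u₁ u₂ u₃ a b c) : Admissible u₂ u₁ u₃ b a c :=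
  ⟨h.unit₂, h.unit₁, h.unit₃, h.odd₂, h.odd₁, h.odd₃, h.sq₂, h.sq₁, h.sq₃, h.gt₂, h.gt₁, h.gt₃,
    h.cop₁₂.symm, h.cop₂₃, h.cop₁₃⟩

lemma swap_right (h : Admissible u₁ u₂ u₃ a b c) : Admissible u₁ u₃ u₂ a c b :=
  ⟨h.unit₁, h.unit₃, h.unit₂, h.odd₁, h.odd₃, h.odd₂, h.sq₁, h.sq₃, h.sq₂, h.gt₁, h.gt₃, h.gt₂,
    h.cop₁₃, h.cop₁₂, h.cop₂₃.symm⟩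

end Admissible

lemma IsTwoUnit.dvd_two {u : ℤ} (h : IsTwoUnit u) : u ∣ 2 := by
  rcases h with rfl | rfl | rfl | rfl <;> decide

lemma IsTwoUnit.isCoprime {u : ℤ} (h : IsTwoUnit u) {n : ℕ} (hn : Odd n) : IsCoprime u n := by
  have : IsCoprime (2 : ℤ) n := by
    have := Nat.isCoprime_iff_coprime.2 (Nat.coprime_two_left.2 hn)
    simpa using this
  exact this.of_isCoprime_of_dvd_left h.dvd_two

lemma IsTwoUnit.squarefree {u : ℤ} (h : IsTwoUnit u) : Squarefree u := by
  have h2 : Squarefree (2 : ℤ) := Int.prime_two.squarefree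
  exact h2.squarefree_of_dvd h.dvd_two

lemma IsTwoUnit.squarefree_mul {u : ℤ} (h : IsTwoUnit u) {n : ℕ} (hn : Odd n)
    (sn : Squarefree n) : Squarefree (u * n) :=
  (squarefree_mul_iff).2 ⟨(h.isCoprime hn).isRelPrime, h.squarefree, Int.squarefree_natCast.2 sn⟩

lemma Nat.Prime.dvd_of_dvd_isTwoUnit_mul {u : ℤ} (h : IsTwoUnit u) {l n : ℕ} (hl : l.Prime)
    (hl2 : l ≠ 2) (hd : (l : ℤ) ∣ u * n) : l ∣ n := by
  rcases (Nat.prime_iff_prime_int.1 hl).dvd_or_dvd hd with hlu | hln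
  · exfalso
    have : (l : ℤ) ∣ (2 : ℕ) := hlu.trans h.dvd_two
    exact hl2 ((Nat.prime_dvd_prime_iff_eq hl Nat.prime_two).1 (Int.natCast_dvd_natCast.1 this))
  · exact Int.natCast_dvd_natCast.1 hln

/-- The sign relating `J(u * a | m)` to `J(m | a)`. -/
def recSign (u : ℤ) (a m : ℕ) : ℤ := J(u | m) * (-1) ^ (a / 2 * (m / 2))

lemma jacobiSym_flip (u : ℤ) {a m : ℕ} (ha : Odd a) (hm : Odd m) :
    J(u * a | m) = recSign u a m * J(m | a) := by
  rw [jacobiSym.mul_left, jacobiSym.quadratic_reciprocity ha hm, recSign]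
  ring

lemma jacobiSym_two_mod {m n : ℕ} (hm : Odd m) (h : m % 8 = n % 8) : J(2 | m) = J(2 | n) := by
  have hn : Odd n := by rw [Nat.odd_iff] at *; omega
  rw [jacobiSym.at_two hm, jacobiSym.at_two hn]
  have : (m : ZMod 8) = n := (ZMod.natCast_eq_natCast_iff' _ _ _).2 h
  rw [this]

lemma jacobiSym_neg_one_mod {m n : ℕ} (hm : Odd m) (h : m % 8 = n % 8) :
    J(-1 | m) = J(-1 | n) := by
  have hn : Odd n := by rw [Nat.odd_iff] at *; omega
  rw [jacobiSym.at_neg_one hm, jacobiSym.at_neg_one hn]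
  have : (m : ZMod 4) = n := (ZMod.natCast_eq_natCast_iff' _ _ _).2 (by omega)
  rw [this]

lemma jacobiSym_isTwoUnit_mod {u : ℤ} (hu : IsTwoUnit u) {m n : ℕ} (hm : Odd m)
    (h : m % 8 = n % 8) : J(u | m) = J(u | n) := by
  rcases hu with rfl | rfl | rfl | rfl
  · simp
  · exact jacobiSym_neg_one_mod hm h
  · exact jacobiSym_two_mod hm h
  · rw [show (-2 : ℤ) = -1 * 2 by norm_num, jacobiSym.mul_left, jacobiSym.mul_left,
      jacobiSym_two_mod hm h, jacobiSym_neg_one_mod hm h]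

lemma recSign_mod {u : ℤ} (hu : IsTwoUnit u) (a : ℕ) {m n : ℕ} (hm : Odd m)
    (h : m % 8 = n % 8) : recSign u a m = recSign u a n := by
  rw [recSign, recSign, jacobiSym_isTwoUnit_mod hu hm h]
  congr 1
  rw [pow_mul', pow_mul']
  congr 1
  rcases Nat.even_or_odd (m / 2) with h' | h'
  · have : Even (n / 2) := by rw [Nat.even_iff] at *; omega
    rw [h'.neg_one_pow, this.neg_one_pow]
  · have : Odd (n / 2) := by rw [Nat.odd_iff] at *; omega
    rw [h'.neg_one_pow, this.neg_one_pow]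

lemma recSign_eq_one {u : ℤ} (hu : IsTwoUnit u) (a : ℕ) {m : ℕ} (h : m % 8 = 1) :
    recSign u a m = 1 := by
  rw [recSign_mod hu a (n := 1) (by rw [Nat.odd_iff]; omega) (by omega)]
  simp [recSign]

lemma recSign_sq {u : ℤ} (hu : IsTwoUnit u) (a : ℕ) {m : ℕ} (hm : Odd m) :
    recSign u a m * recSign u a m = 1 := by
  rw [recSign, mul_mul_mul_comm, ← pow_two, ← pow_two, jacobiSym.sq_one, ← pow_mul, mul_comm _ 2,
    pow_mul]
  · simp
  · exact Int.isCoprime_iff_gcd_eq_one.1 (hu.isCoprime hm)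

lemma jacobiSym_flip_one {u : ℤ} (hu : IsTwoUnit u) {a m : ℕ} (ha : Odd a) (h : m % 8 = 1) :
    J(u * a | m) = J(m | a) := by
  rw [jacobiSym_flip u ha (by rw [Nat.odd_iff]; omega), recSign_eq_one hu a h, one_mul]

lemma jacobiSym_congr {x y : ℤ} {m : ℕ} (h : x ≡ y [ZMOD m]) : J(x | m) = J(y | m) :=
  jacobiSym.mod_left' h

lemma jacobiSym_mul_self {x : ℤ} {m : ℕ} (h : IsCoprime x m) : J(x | m) * J(x | m) = 1 := by
  rw [← pow_two]; exact jacobiSym.sq_one (Int.isCoprime_iff_gcd_eq_one.1 h)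

/-- Legendre's theorem for a norm equation, with splitting conditions as Jacobi symbols. -/
theorem normSq_of_split {g d : ℤ} {n : ℕ} (hg : 0 < g) (hn : n ≠ 0) (hgd : IsCoprime g d)
    (sg : Squarefree g) (sd : Squarefree d) (sn : Squarefree n)
    (h1 : ∀ l : ℕ, l.Prime → l ≠ 2 → (l : ℤ) ∣ g → IsSquare ((-(d * n) : ℤ) : ZMod l))
    (h2 : ∀ l : ℕ, l.Prime → l ≠ 2 → (l : ℤ) ∣ d → IsSquare ((g * n : ℤ) : ZMod l))
    (h3 : ∀ l : ℕ, l.Prime → l ∣ n → J(g * d | l) = 1) :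
    NormSq (g * d) (g * n) := by
  have cop : IsCoprime (g * d) n := by
    rw [Int.isCoprime_iff_gcd_eq_one]
    by_contra hcon
    obtain ⟨l, hl, hld⟩ := Nat.exists_prime_and_dvd hcon
    rw [Int.gcd_eq_natAbs_gcd_natAbs] at hld
    have hln : l ∣ n := by simpa using hld.trans (Nat.gcd_dvd_right _ _)
    have hlg : l ∣ (g * d).natAbs := hld.trans (Nat.gcd_dvd_left _ _)
    have := h3 l hl hln
    have h0 : J(g * d | l) = 0 := by
      have : NeZero l := ⟨hl.ne_zero⟩
      refine jacobiSym.eq_zero_iff_not_coprime.2 fun hco => ?_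
      rw [Int.gcd_eq_natAbs_gcd_natAbs] at hco
      have := Nat.dvd_gcd hlg (by simp : l ∣ (l : ℤ).natAbs)
      rw [hco] at this
      exact hl.one_lt.ne' (Nat.dvd_one.1 this)
    omega
  have := normSq_of_legendre (g := g) (d := d) (n := n) hg (Or.inr (by positivity)) hgd
    cop.of_mul_left_left cop.of_mul_left_right sg sd (Int.squarefree_natCast.2 sn) h1 h2
    (fun l hl _ hln => by
      have : Fact l.Prime := ⟨hl⟩
      exact ZMod.isSquare_of_jacobiSym_eq_one (h3 l hl (Int.natCast_dvd_natCast.1 hln)))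
  simpa using this

lemma exists_jacobiSym_eq {c : ℕ} (hodd : Odd c) (sc : Squarefree c) (hc : 1 < c) {ε : ℤ}
    (hε : ε = 1 ∨ ε = -1) : ∃ y : ℤ, IsCoprime y c ∧ J(y | c) = ε := by
  rcases hε with rfl | rfl
  · exact ⟨1, isCoprime_one_left, jacobiSym.one_left c⟩
  obtain ⟨p, hp, m, rfl⟩ := Nat.exists_prime_and_dvd hc.ne'
  have : Fact p.Prime := ⟨hp⟩
  have hp2 : p ≠ 2 := by
    rintro rfl
    rw [Nat.odd_iff] at hodd; omega
  have cpm : IsCoprime (p : ℤ) m :=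
    Nat.isCoprime_iff_coprime.2 (Nat.coprime_of_squarefree_mul sc)
  obtain ⟨n, hn⟩ := FiniteField.exists_nonsquare (F := ZMod p) (by rwa [ZMod.ringChar_zmod_n])
  have hnp : IsCoprime ((n.val : ℕ) : ℤ) p := by
    rw [Nat.isCoprime_iff_coprime]
    refine Nat.Coprime.symm ((Nat.Prime.coprime_iff_not_dvd hp).2 fun h => hn ?_)
    rw [← ZMod.natCast_eq_zero_iff, ZMod.natCast_zmod_val] at h
    rw [h]; exact IsSquare.zero
  obtain ⟨l, hl, hlp, k₁, k₂, k₃⟩ := exists_prime_linear_congruences (p * m) (m₁ := p) (m₂ := m)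
    (m₃ := 1) (k₁ := 1) (k₂ := 1) (k₃ := 1) (t₁ := (n.val : ℕ)) (t₂ := 1) (t₃ := 1) hp.ne_zero
    (by rintro rfl; simp at hc) one_ne_zero cpm (by simp [isCoprime_one_right])
    (by simp [isCoprime_one_right]) isCoprime_one_left isCoprime_one_left isCoprime_one_left
    hnp isCoprime_one_left isCoprime_one_left
  rw [one_mul] at k₁ k₂
  refine ⟨l, Nat.isCoprime_iff_coprime.2 (Nat.coprime_of_lt_prime ?_ hl hlp), ?_⟩
  · rintro h0; rw [h0] at hc; omega
  have : NeZero p := ⟨hp.ne_zero⟩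
  have : NeZero m := ⟨by rintro rfl; simp at hc⟩
  rw [jacobiSym.mul_right, jacobiSym_congr k₁, jacobiSym_congr k₂, jacobiSym.one_left, mul_one,
    ← jacobiSym.legendreSym.to_jacobiSym, legendreSym.eq_neg_one_iff]
  simpa using hn

end NormGroup

section NormGroupGoodPrimes

open NumberTheorySymbols

lemma isSquare_zmod_of_modEq {x y m : ℤ} {l : ℕ} (h : x ≡ y ^ 2 [ZMOD m]) (hl : (l : ℤ) ∣ m) :
    IsSquare ((x : ℤ) : ZMod l) := by
  have : (x : ZMod l) = (y ^ 2 : ℤ) := (ZMod.intCast_eq_intCast_iff _ _ _).2 (h.of_dvd hl)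
  rw [this]; exact ⟨y, by push_cast; ring⟩

lemma isCoprime_of_jacobiSym_ne_zero {x : ℤ} {m : ℕ} (hm : m ≠ 0) (h : J(x | m) ≠ 0) :
    IsCoprime x m := by
  have : NeZero m := ⟨hm⟩
  rw [Int.isCoprime_iff_gcd_eq_one]
  by_contra hc
  exact h (jacobiSym.eq_zero_iff_not_coprime.2 hc)

lemma Odd.isCoprime_eight {n : ℕ} (h : Odd n) : IsCoprime (8 : ℤ) n := by
  have := Nat.isCoprime_iff_coprime.2 ((Nat.coprime_two_left.2 h).pow_left 3)
  simpa using this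

lemma prime_isCoprime_of_lt {l n : ℕ} (hl : l.Prime) (hn : n ≠ 0) (h : n < l) :
    IsCoprime (l : ℤ) n :=
  Nat.isCoprime_iff_coprime.2 (Nat.coprime_of_lt_prime hn h hl)

lemma jacobiSym_prime_swap {p l : ℕ} (hp : Odd p) (hl : Odd l) (h : p * l % 4 = 1) :
    J(p | l) = J(-l | p) := by
  have hp4 : p % 4 = 1 ∨ p % 4 = 3 := by rw [Nat.odd_iff] at hp; omega
  have hl4 : l % 4 = 1 ∨ l % 4 = 3 := by rw [Nat.odd_iff] at hl; omega
  rw [neg_eq_neg_one_mul, jacobiSym.mul_left, jacobiSym.at_neg_one hp]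
  rcases hp4 with hp4 | hp4
  · rw [ZMod.χ₄_nat_one_mod_four hp4, one_mul]
    exact jacobiSym.quadratic_reciprocity_one_mod_four hp4 hl
  · rcases hl4 with hl4 | hl4
    · rw [Nat.mul_mod, hp4, hl4] at h
      omega
    · rw [ZMod.χ₄_nat_three_mod_four hp4]
      rw [jacobiSym.quadratic_reciprocity_three_mod_four hp4 hl4]
      ring

set_option maxHeartbeats 2000000 in
theorem Admissible.normProd_of_mod_eight {u₁ u₂ u₃ : ℤ} {a b c : ℕ}
    (h : Admissible u₁ u₂ u₃ a b c) {p α q : ℕ} (hα : a = p * α) {ε : ℤ} (hε : ε * ε = 1)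
    (hJ : J(u₂ * b * (u₃ * c) | p) = ε) (hq : q.Prime) (hq8 : q % 8 = 1)
    (hqa : J(q | a) = ε) (hqb : J(q | b) = ε) (hqc : J(q | c) = ε) :
    NormProd (u₁ * a) (u₂ * b) (u₃ * c) q := by
  have hε0 : ε ≠ 0 := by rintro rfl; simp at hε
  have a0 : a ≠ 0 := by have := h.gt₁; omega
  have b0 : b ≠ 0 := by have := h.gt₂; omega
  have c0 : c ≠ 0 := by have := h.gt₃; omega
  have p0 : p ≠ 0 := by rintro rfl; simp at hα; omega
  have α0 : α ≠ 0 := by rintro rfl; simp at hα; omega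
  have := NeZero.mk a0; have := NeZero.mk b0; have := NeZero.mk c0
  have := NeZero.mk p0; have := NeZero.mk α0
  have qa : IsCoprime (q : ℤ) a := isCoprime_of_jacobiSym_ne_zero a0 (hqa ▸ hε0)
  have qb : IsCoprime (q : ℤ) b := isCoprime_of_jacobiSym_ne_zero b0 (hqb ▸ hε0)
  have qc : IsCoprime (q : ℤ) c := isCoprime_of_jacobiSym_ne_zero c0 (hqc ▸ hε0)
  have oddp : Odd p := by have := h.odd₁; rw [hα] at this; exact (Nat.odd_mul.1 this).1
  have oddα : Odd α := by have := h.odd₁; rw [hα] at this; exact (Nat.odd_mul.1 this).2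
  have haZ : (a : ℤ) = p * α := by rw [hα]; push_cast; rfl
  have qp : IsCoprime (q : ℤ) p := by rw [haZ] at qa; exact qa.of_mul_right_left
  have qα : IsCoprime (q : ℤ) α := by rw [haZ] at qa; exact qa.of_mul_right_right
  have pα : IsCoprime (p : ℤ) α :=
    Nat.isCoprime_iff_coprime.2 (Nat.coprime_of_squarefree_mul (hα ▸ h.sq₁))
  have c12 := h.cop₁₂
  have c13 := h.cop₁₃
  have c23 := h.cop₂₃
  rw [haZ] at c12 c13
  simp only [IsCoprime.mul_left_iff, IsCoprime.mul_right_iff] at c12 c13 c23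
  obtain ⟨⟨u12, pu2, αu2⟩, u1b, pb, αb⟩ := c12
  obtain ⟨⟨u13, pu3, αu3⟩, u1c, pc, αc⟩ := c13
  obtain ⟨⟨u23, bu3⟩, u2c, bc⟩ := c23
  have u1p := h.unit₁.isCoprime oddp
  have u1α := h.unit₁.isCoprime oddα
  have e8b := h.odd₂.isCoprime_eight
  have e8c := h.odd₃.isCoprime_eight
  have e8p := oddp.isCoprime_eight
  have e8α := oddα.isCoprime_eight
  have ⟨sp, sα⟩ : Squarefree p ∧ Squarefree α := by
    have := h.sq₁
    rw [hα] at this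
    exact ⟨this.of_mul_left, this.of_mul_right⟩
  obtain ⟨l, hlB, hl, k1, k2, k3⟩ := exists_prime_linear_congruences (a * b * c * q)
    (m₁ := 8 * c) (m₂ := α * b) (m₃ := p) (k₁ := p) (k₂ := p) (k₃ := -(u₁ * α * (u₂ * b) * q))
    (t₁ := 1) (t₂ := q) (t₃ := 1) (by positivity) (by positivity) p0
    (by simp only [Nat.cast_mul, Nat.cast_ofNat, IsCoprime.mul_left_iff, IsCoprime.mul_right_iff,
          e8α, e8b, αc.symm, bc.symm, and_self])
    (by simp only [Nat.cast_mul, Nat.cast_ofNat, IsCoprime.mul_left_iff,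
          e8p, pc.symm, and_self])
    (by simp only [Nat.cast_mul, IsCoprime.mul_left_iff, pα.symm, pb.symm, and_self])
    (by simp only [Nat.cast_mul, Nat.cast_ofNat, IsCoprime.mul_right_iff, e8p.symm, pc, and_self])
    (by simp only [Nat.cast_mul, IsCoprime.mul_right_iff, pα, pb, and_self])
    (by simp only [IsCoprime.neg_left_iff, IsCoprime.mul_left_iff, u1p, pα.symm, pu2.symm, pb.symm,
          qp, and_self])
    isCoprime_one_left
    (by simp only [Nat.cast_mul, IsCoprime.mul_right_iff, qα, qb, and_self])
    isCoprime_one_left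
  have hapos : 0 < a := Nat.pos_of_ne_zero a0
  have hq0 : q ≠ 0 := hq.ne_zero
  have hlpos : ∀ n, n ∣ a * b * c * q → n < l := fun n hn =>
    (Nat.le_of_dvd (by positivity) hn).trans_lt hlB
  have lp : IsCoprime (l : ℤ) p := prime_isCoprime_of_lt hl p0 (hlpos p (by
    rw [hα]; exact ⟨α * b * c * q, by ring⟩))
  have lq : q ≠ l := (hlpos q (dvd_mul_left _ _)).ne
  obtain ⟨l', hlB', hl', j1, j2, j3⟩ := exists_prime_linear_congruences l
    (m₁ := 8 * (b * c)) (m₂ := α) (m₃ := p) (k₁ := 1) (k₂ := 1) (k₃ := -(u₁ * α * (u₃ * c) * l))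
    (t₁ := 1) (t₂ := q) (t₃ := 1) (by positivity) (by positivity) p0
    (by simp only [Nat.cast_mul, Nat.cast_ofNat, IsCoprime.mul_left_iff,
          e8α, αc.symm, αb.symm, and_self])
    (by simp only [Nat.cast_mul, Nat.cast_ofNat, IsCoprime.mul_left_iff,
          e8p, pc.symm, pb.symm, and_self])
    pα.symm isCoprime_one_left isCoprime_one_left
    (by simp only [IsCoprime.neg_left_iff, IsCoprime.mul_left_iff, u1p, pα.symm, pu3.symm, pc.symm,
          lp, and_self])
    isCoprime_one_left qα isCoprime_one_left
  rw [one_mul] at j1 j2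
  push_cast at k1 k2 j1
  -- residues modulo 8
  have pl8 : p * l % 8 = 1 := by
    have : ((p * l : ℕ) : ℤ) ≡ (1 : ℕ) [ZMOD (8 : ℕ)] := by
      push_cast; exact k1.of_dvd (dvd_mul_right _ _)
    exact Int.natCast_modEq_iff.1 this
  have l'8 : l' % 8 = 1 := by
    have : ((l' : ℕ) : ℤ) ≡ (1 : ℕ) [ZMOD (8 : ℕ)] := by
      push_cast; exact j1.of_dvd (dvd_mul_right _ _)
    exact Int.natCast_modEq_iff.1 this
  have oddl : Odd l := by
    have : Odd (p * l) := by rw [Nat.odd_iff]; omega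
    exact (Nat.odd_mul.1 this).2
  have l0 := hl.ne_zero
  have := NeZero.mk l0
  have plα : (p * l : ℤ) ≡ q [ZMOD α] := k2.of_dvd (dvd_mul_right _ _)
  have plb : (p * l : ℤ) ≡ q [ZMOD b] := k2.of_dvd (dvd_mul_left _ _)
  have plc : (p * l : ℤ) ≡ 1 [ZMOD c] := k1.of_dvd (dvd_mul_left _ _)
  have l'b : (l' : ℤ) ≡ 1 [ZMOD b] := j1.of_dvd ⟨8 * c, by ring⟩
  have l'c : (l' : ℤ) ≡ 1 [ZMOD c] := j1.of_dvd ⟨8 * b, by ring⟩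
  -- symbols
  have Jqα : J(q | α) = ε * J(q | p) := by
    have h1 := jacobiSym_mul_self qp
    have h2 : J(q | p) * J(q | α) = ε := by rw [← jacobiSym.mul_right, ← hα, hqa]
    linear_combination J(q | p) * h2 - J(q | α) * h1
  have Jbcpl : J(u₂ * b * (u₃ * c) | p * l) = ε := by
    rw [jacobiSym.mul_left, jacobiSym_flip_one h.unit₂ h.odd₂ pl8,
      jacobiSym_flip_one h.unit₃ h.odd₃ pl8, Nat.cast_mul, jacobiSym_congr plb,
      jacobiSym_congr plc, hqb, jacobiSym.one_left, mul_one]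
  have Jbcl : J(u₂ * b * (u₃ * c) | l) = 1 := by
    rw [jacobiSym.mul_right, hJ] at Jbcpl
    linear_combination ε * Jbcpl + (1 - J(u₂ * b * (u₃ * c) | l)) * hε
  have Jdpl : J(u₁ * α * (u₂ * b) | p * l) = J(q | p) := by
    rw [jacobiSym.mul_left, jacobiSym_flip_one h.unit₁ oddα pl8,
      jacobiSym_flip_one h.unit₂ h.odd₂ pl8, Nat.cast_mul, jacobiSym_congr plα,
      jacobiSym_congr plb, hqb, Jqα]
    linear_combination J(q | p) * hε
  have Jpl : J(p | l) = J(-l | p) := jacobiSym_prime_swap oddp oddl (by omega)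
  have cdp : IsCoprime (u₁ * α * (u₂ * b)) p := by
    simp only [IsCoprime.mul_left_iff, u1p, pα.symm, pu2.symm, pb.symm, and_self]
  have J1 : J(-l | p) * J(u₁ * α * (u₂ * b) | p) * J(q | p) = 1 := by
    rw [← jacobiSym.mul_left, ← jacobiSym.mul_left, ← jacobiSym.one_left p,
      ← jacobiSym_congr k3]
    congr 1; ring
  have Jabl : J(p * (u₁ * α * (u₂ * b)) | l) = 1 := by
    rw [jacobiSym.mul_left, Jpl]
    have h1 := jacobiSym_mul_self cdp
    rw [jacobiSym.mul_right] at Jdpl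
    linear_combination J1 + J(-l | p) * J(u₁ * α * (u₂ * b) | p) * Jdpl -
      J(-l | p) * J(u₁ * α * (u₂ * b) | l) * h1
  have Jabq : J(p * (u₁ * α * (u₂ * b)) | q) = 1 := by
    rw [show (p * (u₁ * α * (u₂ * b)) : ℤ) = (u₁ * a) * (u₂ * b) by rw [haZ]; ring,
      jacobiSym.mul_left, jacobiSym_flip_one h.unit₁ h.odd₁ hq8,
      jacobiSym_flip_one h.unit₂ h.odd₂ hq8, hqa, hqb, hε]
  have Jacl : J(p * (u₁ * α * (u₃ * c)) | l) = 1 := by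
    have h1 : J(p * (u₁ * α * (u₃ * c)) | l) * (J(u₂ * b | l) * J(u₂ * b | l)) = 1 := by
      rw [← jacobiSym.mul_left, ← jacobiSym.mul_left,
        show (p * (u₁ * α * (u₃ * c)) * ((u₂ * b) * (u₂ * b)) : ℤ) =
          (p * (u₁ * α * (u₂ * b))) * (u₂ * b * (u₃ * c)) by ring, jacobiSym.mul_left, Jabl, Jbcl]
      norm_num
    have h2 : J(u₂ * b | l) * J(u₂ * b | l) = 1 := by
      apply jacobiSym_mul_self
      refine isCoprime_of_jacobiSym_ne_zero l0 fun h0 => ?_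
      rw [h0] at h1; simp at h1
    rw [h2, mul_one] at h1
    exact h1
  have Jbcl' : J(1 * (u₂ * b * (u₃ * c)) | l') = 1 := by
    rw [one_mul, jacobiSym.mul_left, jacobiSym_flip_one h.unit₂ h.odd₂ l'8,
      jacobiSym_flip_one h.unit₃ h.odd₃ l'8, jacobiSym_congr l'b, jacobiSym_congr l'c,
      jacobiSym.one_left, jacobiSym.one_left, mul_one]
  have J2 : J(-l | p) * (J(u₁ | p) * J(α | p)) * J(u₃ * c | p) * J(l' | p) = 1 := by
    rw [← jacobiSym.mul_left, ← jacobiSym.mul_left, ← jacobiSym.mul_left, ← jacobiSym.mul_left,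
      ← jacobiSym.one_left p, ← jacobiSym_congr j3]
    congr 1; ring
  have Jacl' : J(p * (u₁ * α * (u₃ * c)) | l') = 1 := by
    rw [show (p * (u₁ * α * (u₃ * c)) : ℤ) = (u₁ * a) * (u₃ * c) by rw [haZ]; ring,
      jacobiSym.mul_left, jacobiSym_flip_one h.unit₁ h.odd₁ l'8,
      jacobiSym_flip_one h.unit₃ h.odd₃ l'8, jacobiSym_congr l'c, jacobiSym.one_left, mul_one,
      hα, jacobiSym.mul_right, jacobiSym_congr j2, Jqα]
    rw [jacobiSym.mul_left, jacobiSym.mul_left u₁] at J1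
    rw [jacobiSym.mul_left] at hJ
    have s1 := jacobiSym_mul_self u1p
    have s2 := jacobiSym_mul_self (pα.symm)
    have s3 := jacobiSym_mul_self qp
    have s4 := jacobiSym_mul_self (lp.neg_left)
    generalize J(-l | p) = L at *
    generalize J(u₁ | p) = U at *
    generalize J(α | p) = A at *
    generalize J(u₃ * c | p) = C at *
    generalize J(u₂ * b | p) = B at *
    generalize J(l' | p) = M at *
    generalize J(q | p) = Q at *
    calc M * (ε * Q) = M * ((B * C) * Q) := by rw [hJ]
      _ = (M * C * Q * B) * 1 * 1 * 1 := by ring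
      _ = (M * C * Q * B) * (U * U) * (A * A) * (L * L) := by rw [s1, s2, s4]
      _ = (L * (U * A) * C * M) * (L * (U * A * B) * Q) := by ring
      _ = 1 := by rw [J1, J2, one_mul]
  -- the three norms
  have sqL : Squarefree (q * l) := (Nat.squarefree_mul
    ((Nat.coprime_primes hq hl).2 lq)).2 ⟨hq.squarefree, hl.squarefree⟩
  have sqL' : Squarefree (l * l') := (Nat.squarefree_mul
    ((Nat.coprime_primes hl hl').2 hlB'.ne)).2 ⟨hl.squarefree, hl'.squarefree⟩
  have sa' := h.unit₁.squarefree_mul oddα sα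
  have sb' := h.unit₂.squarefree_mul h.odd₂ h.sq₂
  have sc' := h.unit₃.squarefree_mul h.odd₃ h.sq₃
  have ab' : IsCoprime (u₁ * α) (u₂ * b) := by
    simp only [IsCoprime.mul_left_iff, IsCoprime.mul_right_iff, u12, αu2, u1b, αb, and_self]
  have ac' : IsCoprime (u₁ * α) (u₃ * c) := by
    simp only [IsCoprime.mul_left_iff, IsCoprime.mul_right_iff, u13, αu3, u1c, αc, and_self]
  have ppos : (0 : ℤ) < p := by positivity
  have N1 : NormSq (u₁ * a * (u₂ * b)) ((q : ℚ) * (p * l)) := by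
    have := normSq_of_split (g := p) (d := u₁ * α * (u₂ * b)) (n := q * l) ppos
      (mul_ne_zero hq0 l0) cdp.symm (Int.squarefree_natCast.2 sp)
      (squarefree_mul_iff.2 ⟨ab'.isRelPrime, sa', sb'⟩) sqL
      (fun r hr hr2 hrp => isSquare_zmod_of_modEq (y := 1) (m := p) (by
        convert k3 using 1
        · push_cast; ring
        · norm_num) hrp)
      (fun r hr hr2 hrd => by
        have : r ∣ α * b := by
          have : (r : ℤ) ∣ (u₁ * α) * (u₂ * b) := hrd
          rcases (Nat.prime_iff_prime_int.1 hr).dvd_or_dvd this with h' | h'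
          · exact (hr.dvd_of_dvd_isTwoUnit_mul h.unit₁ hr2 h').mul_right _
          · exact (hr.dvd_of_dvd_isTwoUnit_mul h.unit₂ hr2 h').mul_left _
        refine isSquare_zmod_of_modEq (y := q) (m := α * b) ?_ (by exact_mod_cast this)
        have := k2.mul_left (q : ℤ)
        convert this using 1
        · push_cast; ring
        · ring)
      (fun r hr hrn => by
        rcases (hr.dvd_mul).1 hrn with h' | h'
        · rw [(Nat.prime_dvd_prime_iff_eq hr hq).1 h']; exact Jabq
        · rw [(Nat.prime_dvd_prime_iff_eq hr hl).1 h']; exact Jabl)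
    convert this using 1
    · rw [haZ]; ring
    · push_cast; ring
  have cdp' : IsCoprime (u₁ * α * (u₃ * c)) p := by
    simp only [IsCoprime.mul_left_iff, u1p, pα.symm, pu3.symm, pc.symm, and_self]
  have N2 : NormSq (u₁ * a * (u₃ * c)) ((p : ℚ) * l * l') := by
    have := normSq_of_split (g := p) (d := u₁ * α * (u₃ * c)) (n := l * l') ppos
      (mul_ne_zero l0 hl'.ne_zero) cdp'.symm (Int.squarefree_natCast.2 sp)
      (squarefree_mul_iff.2 ⟨ac'.isRelPrime, sa', sc'⟩) sqL'
      (fun r hr hr2 hrp => isSquare_zmod_of_modEq (y := 1) (m := p) (by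
        convert j3 using 1
        · push_cast; ring
        · norm_num) hrp)
      (fun r hr hr2 hrd => by
        rcases (Nat.prime_iff_prime_int.1 hr).dvd_or_dvd hrd with h' | h'
        · have := hr.dvd_of_dvd_isTwoUnit_mul h.unit₁ hr2 h'
          refine isSquare_zmod_of_modEq (y := q) (m := α) ?_ (by exact_mod_cast this)
          have := plα.mul j2
          convert this using 1
          · push_cast; ring
          · ring
        · have := hr.dvd_of_dvd_isTwoUnit_mul h.unit₃ hr2 h'
          refine isSquare_zmod_of_modEq (y := 1) (m := c) ?_ (by exact_mod_cast this)
          have := plc.mul l'c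
          convert this using 1
          · push_cast; ring
          · norm_num)
      (fun r hr hrn => by
        rcases (hr.dvd_mul).1 hrn with h' | h'
        · rw [(Nat.prime_dvd_prime_iff_eq hr hl).1 h']; exact Jacl
        · rw [(Nat.prime_dvd_prime_iff_eq hr hl').1 h']; exact Jacl')
    convert this using 1
    · rw [haZ]; ring
    · push_cast; ring
  have N3 : NormSq (u₂ * b * (u₃ * c)) (l' : ℚ) := by
    have := normSq_of_split (g := 1) (d := u₂ * b * (u₃ * c)) (n := l') one_pos
      hl'.ne_zero isCoprime_one_left squarefree_one
      (squarefree_mul_iff.2 ⟨h.cop₂₃.isRelPrime, sb', sc'⟩) hl'.squarefree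
      (fun r hr hr2 hrp => by
        exfalso
        have : r ∣ 1 := by exact_mod_cast hrp
        exact hr.one_lt.ne' (Nat.dvd_one.1 this))
      (fun r hr hr2 hrd => by
        have : r ∣ b * c := by
          rcases (Nat.prime_iff_prime_int.1 hr).dvd_or_dvd hrd with h' | h'
          · exact (hr.dvd_of_dvd_isTwoUnit_mul h.unit₂ hr2 h').mul_right _
          · exact (hr.dvd_of_dvd_isTwoUnit_mul h.unit₃ hr2 h').mul_left _
        refine isSquare_zmod_of_modEq (y := 1) (m := b * c) ?_ (by exact_mod_cast this)
        rw [one_mul, one_pow]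
        exact j1.of_dvd (dvd_mul_left _ _))
      (fun r hr hrn => by
        rw [(Nat.prime_dvd_prime_iff_eq hr hl').1 hrn]; exact Jbcl')
    convert this using 1
    · rw [one_mul]
    · push_cast; ring
  have hlQ : (l : ℚ) ≠ 0 := by exact_mod_cast l0
  have hl'Q : (l' : ℚ) ≠ 0 := by exact_mod_cast hl'.ne_zero
  have hpQ : (p : ℚ) ≠ 0 := by exact_mod_cast p0
  refine NormProd.of_mul (s := ((p * l * l' : ℚ)) ^ 2) (by positivity) ?_ (NormProd.sq _)
  exact ⟨_, _, _, N1, N2, N3, by ring⟩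

lemma Admissible.exists_prime {u₁ u₂ u₃ : ℤ} {a b c : ℕ} (h : Admissible u₁ u₂ u₃ a b c) (B : ℕ)
    {r q : ℕ} (hr : Odd r) (hqa : IsCoprime (q : ℤ) a) (hqb : IsCoprime (q : ℤ) b) {ε : ℤ}
    (hε : ε = 1 ∨ ε = -1) :
    ∃ l : ℕ, B < l ∧ l.Prime ∧ l % 8 = r % 8 ∧ (l : ℤ) ≡ q [ZMOD a] ∧ (l : ℤ) ≡ q [ZMOD b] ∧
      J(l | c) = ε := by
  obtain ⟨y, hyc, hy⟩ := exists_jacobiSym_eq h.odd₃ h.sq₃ h.gt₃ hε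
  have c12 := h.cop₁₂.of_mul_left_right.of_mul_right_right
  have c13 := h.cop₁₃.of_mul_left_right.of_mul_right_right
  have c23 := h.cop₂₃.of_mul_left_right.of_mul_right_right
  have a0 : a ≠ 0 := by have := h.gt₁; omega
  have b0 : b ≠ 0 := by have := h.gt₂; omega
  have c0 : c ≠ 0 := by have := h.gt₃; omega
  obtain ⟨l, hlB, hl, k1, k2, k3⟩ := exists_prime_linear_congruences B
    (m₁ := 8) (m₂ := a * b) (m₃ := c) (k₁ := 1) (k₂ := 1) (k₃ := 1) (t₁ := r) (t₂ := q) (t₃ := y)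
    (by norm_num) (mul_ne_zero a0 b0) c0
    (by push_cast; exact h.odd₁.isCoprime_eight.mul_right h.odd₂.isCoprime_eight)
    (by push_cast; exact h.odd₃.isCoprime_eight)
    (by push_cast; exact c13.mul_left c23)
    isCoprime_one_left isCoprime_one_left isCoprime_one_left
    (by push_cast; exact hr.isCoprime_eight.symm)
    (by push_cast; exact hqa.mul_right hqb) hyc
  rw [one_mul] at k1 k2 k3
  push_cast at k2
  refine ⟨l, hlB, hl, ?_, k2.of_dvd (dvd_mul_right _ _), k2.of_dvd (dvd_mul_left _ _), ?_⟩
  · exact Int.natCast_modEq_iff.1 k1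
  · rw [jacobiSym_congr k3, hy]

/-- Two primes that agree modulo the odd part of `ab`, both split in `ℚ(√(ab))`. -/
lemma Admissible.normSq_mul {u₁ u₂ u₃ : ℤ} {a b c : ℕ} (h : Admissible u₁ u₂ u₃ a b c)
    {q l : ℕ} (hq : q.Prime) (hl : l.Prime) (hne : q ≠ l) (ha : (l : ℤ) ≡ q [ZMOD a])
    (hb : (l : ℤ) ≡ q [ZMOD b]) (Jq : J(u₁ * a * (u₂ * b) | q) = 1)
    (Jl : J(u₁ * a * (u₂ * b) | l) = 1) : NormSq (u₁ * a * (u₂ * b)) ((q : ℚ) * l) := by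
  have := normSq_of_split (g := 1) (d := u₁ * a * (u₂ * b)) (n := q * l) one_pos
    (mul_ne_zero hq.ne_zero hl.ne_zero) isCoprime_one_left squarefree_one
    (squarefree_mul_iff.2 ⟨h.cop₁₂.isRelPrime, h.unit₁.squarefree_mul h.odd₁ h.sq₁,
      h.unit₂.squarefree_mul h.odd₂ h.sq₂⟩)
    ((Nat.squarefree_mul ((Nat.coprime_primes hq hl).2 hne)).2 ⟨hq.squarefree, hl.squarefree⟩)
    (fun r hr hr2 hrp => by
      exfalso
      have : r ∣ 1 := by exact_mod_cast hrp
      exact hr.one_lt.ne' (Nat.dvd_one.1 this))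
    (fun r hr hr2 hrd => by
      rcases (Nat.prime_iff_prime_int.1 hr).dvd_or_dvd hrd with h' | h'
      · refine isSquare_zmod_of_modEq (y := q) (m := a) ?_
          (by exact_mod_cast hr.dvd_of_dvd_isTwoUnit_mul h.unit₁ hr2 h')
        have := ha.mul_left (q : ℤ)
        convert this using 1
        · push_cast; ring
        · ring
      · refine isSquare_zmod_of_modEq (y := q) (m := b) ?_
          (by exact_mod_cast hr.dvd_of_dvd_isTwoUnit_mul h.unit₂ hr2 h')
        have := hb.mul_left (q : ℤ)
        convert this using 1
        · push_cast; ring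
        · ring)
    (fun r hr hrn => by
      rw [one_mul]
      rcases (hr.dvd_mul).1 hrn with h' | h'
      · rw [(Nat.prime_dvd_prime_iff_eq hr hq).1 h']; exact Jq
      · rw [(Nat.prime_dvd_prime_iff_eq hr hl).1 h']; exact Jl)
  convert this using 1
  · rw [one_mul]
  · push_cast; ring

/-- `q` is an odd prime with `J(u₁a|q) = J(u₂b|q) = J(u₃c|q) ≠ 0`. -/
structure SplitPrime (u₁ u₂ u₃ : ℤ) (a b c q : ℕ) : Prop where
  prime : q.Prime
  odd : Odd q
  cop₁ : IsCoprime (q : ℤ) a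
  cop₂ : IsCoprime (q : ℤ) b
  cop₃ : IsCoprime (q : ℤ) c
  eq₁₂ : J(u₁ * a | q) = J(u₂ * b | q)
  eq₂₃ : J(u₂ * b | q) = J(u₃ * c | q)

lemma SplitPrime.swap_left {u₁ u₂ u₃ : ℤ} {a b c q : ℕ} (h : SplitPrime u₁ u₂ u₃ a b c q) :
    SplitPrime u₂ u₁ u₃ b a c q :=
  ⟨h.prime, h.odd, h.cop₂, h.cop₁, h.cop₃, h.eq₁₂.symm, h.eq₁₂.trans h.eq₂₃⟩

lemma SplitPrime.swap_right {u₁ u₂ u₃ : ℤ} {a b c q : ℕ} (h : SplitPrime u₁ u₂ u₃ a b c q) :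
    SplitPrime u₁ u₃ u₂ a c b q :=
  ⟨h.prime, h.odd, h.cop₁, h.cop₃, h.cop₂, h.eq₁₂.trans h.eq₂₃, h.eq₂₃.symm⟩

lemma isCoprime_of_modEq {x y : ℤ} {m : ℤ} (h : x ≡ y [ZMOD m]) (hy : IsCoprime y m) :
    IsCoprime x m := by
  obtain ⟨k, hk⟩ := Int.modEq_iff_dvd.1 h
  have : x = y + m * (-k) := by linear_combination -hk
  rw [this]
  exact hy.add_mul_left_left _

lemma jacobiSym_eq_one_or {x : ℤ} {m : ℕ} (h : IsCoprime x m) : J(x | m) = 1 ∨ J(x | m) = -1 :=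
  jacobiSym.eq_one_or_neg_one (Int.isCoprime_iff_gcd_eq_one.1 h)

lemma recSign_eq_one_or {u : ℤ} (hu : IsTwoUnit u) (a : ℕ) {m : ℕ} (hm : Odd m) :
    recSign u a m = 1 ∨ recSign u a m = -1 := by
  have := recSign_sq hu a hm
  exact mul_self_eq_one_iff.1 this

lemma one_or_neg_one_mul {x y : ℤ} (hx : x = 1 ∨ x = -1) (hy : y = 1 ∨ y = -1) :
    x * y = 1 ∨ x * y = -1 := by
  rcases hx with rfl | rfl <;> rcases hy with rfl | rfl <;> simp

lemma mul_self_eq_one_of_or {x : ℤ} (hx : x = 1 ∨ x = -1) : x * x = 1 := by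
  rcases hx with rfl | rfl <;> simp

/-- The reduction from a prime split in `ℚ(√(ab))` to a totally split prime. -/
lemma Admissible.exists_split {u₁ u₂ u₃ : ℤ} {a b c : ℕ} (h : Admissible u₁ u₂ u₃ a b c)
    {q : ℕ} (hq : q.Prime) (hodd : Odd q) (qa : IsCoprime (q : ℤ) a) (qb : IsCoprime (q : ℤ) b)
    (heq : J(u₁ * a | q) = J(u₂ * b | q)) :
    ∃ l : ℕ, SplitPrime u₁ u₂ u₃ a b c l ∧ NormSq (u₁ * a * (u₂ * b)) ((q : ℚ) * l) := by
  have F1 := jacobiSym_flip u₁ h.odd₁ hodd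
  have F2 := jacobiSym_flip u₂ h.odd₂ hodd
  have Ja := jacobiSym_eq_one_or qa
  have Jb := jacobiSym_eq_one_or qb
  have s1 := recSign_eq_one_or h.unit₁ a hodd
  have s2 := recSign_eq_one_or h.unit₂ b hodd
  have s3 := recSign_eq_one_or h.unit₃ c hodd
  obtain ⟨l, hlB, hl, l8, la, lb, lc⟩ := h.exists_prime (max q c) hodd qa qb
    (one_or_neg_one_mul s3 (one_or_neg_one_mul s2 Jb))
  have oddl : Odd l := by rw [Nat.odd_iff] at *; omega
  have e1 : J(u₁ * a | l) = J(u₁ * a | q) := by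
    rw [F1, jacobiSym_flip u₁ h.odd₁ oddl, recSign_mod h.unit₁ a oddl l8, jacobiSym_congr la]
  have e2 : J(u₂ * b | l) = J(u₂ * b | q) := by
    rw [F2, jacobiSym_flip u₂ h.odd₂ oddl, recSign_mod h.unit₂ b oddl l8, jacobiSym_congr lb]
  have e3 : J(u₃ * c | l) = J(u₂ * b | q) := by
    rw [F2, jacobiSym_flip u₃ h.odd₃ oddl, recSign_mod h.unit₃ c oddl l8, lc, ← mul_assoc,
      mul_self_eq_one_of_or s3, one_mul]
  have hB : J(u₂ * b | q) * J(u₂ * b | q) = 1 := by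
    rw [F2]; exact mul_self_eq_one_of_or (one_or_neg_one_mul s2 Jb)
  refine ⟨l, ⟨hl, oddl, isCoprime_of_modEq la qa, isCoprime_of_modEq lb qb,
    prime_isCoprime_of_lt hl (by have := h.gt₃; omega) ((le_max_right _ _).trans_lt hlB),
    by rw [e1, e2, heq], by rw [e2, e3]⟩,
    h.normSq_mul hq hl ((le_max_left _ _).trans_lt hlB).ne la lb ?_ ?_⟩
  · rw [jacobiSym.mul_left, heq, hB]
  · rw [jacobiSym.mul_left, e1, e2, heq, hB]

/-- The reduction from a totally split prime to one that is `1` modulo `8`. -/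
lemma Admissible.exists_mod_eight {u₁ u₂ u₃ : ℤ} {a b c : ℕ} (h : Admissible u₁ u₂ u₃ a b c)
    {q : ℕ} (hq : SplitPrime u₁ u₂ u₃ a b c q) (hab : J(q | a) = J(q | b)) :
    ∃ l : ℕ, SplitPrime u₁ u₂ u₃ a b c l ∧ l % 8 = 1 ∧
      NormSq (u₁ * a * (u₂ * b)) ((q : ℚ) * l) := by
  have Jb := jacobiSym_eq_one_or hq.cop₂
  obtain ⟨l, hlB, hl, l8, la, lb, lc⟩ := h.exists_prime (r := 1) (max q c) odd_one hq.cop₁ hq.cop₂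
    Jb
  have l8' : l % 8 = 1 := l8
  have oddl : Odd l := by rw [Nat.odd_iff] at *; omega
  have e1 := jacobiSym_flip_one h.unit₁ h.odd₁ l8'
  have e2 := jacobiSym_flip_one h.unit₂ h.odd₂ l8'
  have e3 := jacobiSym_flip_one h.unit₃ h.odd₃ l8'
  rw [jacobiSym_congr la] at e1
  rw [jacobiSym_congr lb] at e2
  have F2 := jacobiSym_flip u₂ h.odd₂ hq.odd
  have s2 := recSign_eq_one_or h.unit₂ b hq.odd
  refine ⟨l, ⟨hl, oddl, isCoprime_of_modEq la hq.cop₁, isCoprime_of_modEq lb hq.cop₂,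
    prime_isCoprime_of_lt hl (by have := h.gt₃; omega) ((le_max_right _ _).trans_lt hlB),
    by rw [e1, e2, hab], by rw [e2, e3, lc]⟩, l8',
    h.normSq_mul hq.prime hl ((le_max_left _ _).trans_lt hlB).ne la lb ?_ ?_⟩
  · rw [jacobiSym.mul_left, hq.eq₁₂, F2]; exact mul_self_eq_one_of_or (one_or_neg_one_mul s2 Jb)
  · rw [jacobiSym.mul_left, e1, e2, hab]; exact mul_self_eq_one_of_or Jb

section GoodPrime

variable {u₁ u₂ u₃ : ℤ} {a b c p q : ℕ}

lemma Admissible.normProd_of_split_mod_eight (h : Admissible u₁ u₂ u₃ a b c) (hp : p ∣ a)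
    (hJ : J(u₂ * b * (u₃ * c) | p) = -1) (hq : SplitPrime u₁ u₂ u₃ a b c q) (hq8 : q % 8 = 1) :
    NormProd (u₁ * a) (u₂ * b) (u₃ * c) q := by
  have e1 := jacobiSym_flip_one h.unit₁ h.odd₁ hq8
  have e2 := jacobiSym_flip_one h.unit₂ h.odd₂ hq8
  have e3 := jacobiSym_flip_one h.unit₃ h.odd₃ hq8
  have E1 := hq.eq₁₂
  have E2 := hq.eq₂₃
  rw [e1, e2] at E1
  rw [e2, e3] at E2
  obtain ⟨α, hα⟩ := hp
  rcases jacobiSym_eq_one_or hq.cop₁ with h1 | h1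
  · exact h.normProd_of_mod_eight (p := 1) (α := a) (one_mul a).symm (ε := 1) (by norm_num)
      (jacobiSym.one_right _) hq.prime hq8 h1 (by rw [← E1, h1]) (by rw [← E2, ← E1, h1])
  · exact h.normProd_of_mod_eight hα (ε := -1) (by norm_num)
      hJ hq.prime hq8 h1 (by rw [← E1, h1]) (by rw [← E2, ← E1, h1])

lemma Admissible.normProd_of_split (h : Admissible u₁ u₂ u₃ a b c) (hp : p ∣ a)
    (hJ : J(u₂ * b * (u₃ * c) | p) = -1) (hq : SplitPrime u₁ u₂ u₃ a b c q) :
    NormProd (u₁ * a) (u₂ * b) (u₃ * c) q := by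
  have pos : ∀ {l : ℕ}, SplitPrime u₁ u₂ u₃ a b c l → (l : ℚ) ≠ 0 := fun hl => by
    exact_mod_cast hl.prime.ne_zero
  have key : J(q | a) = J(q | b) ∨ J(q | a) = J(q | c) ∨ J(q | b) = J(q | c) := by
    rcases jacobiSym_eq_one_or hq.cop₁ with h1 | h1 <;>
    rcases jacobiSym_eq_one_or hq.cop₂ with h2 | h2 <;>
    rcases jacobiSym_eq_one_or hq.cop₃ with h3 | h3 <;> simp [h1, h2, h3]
  rcases key with k | k | k
  · obtain ⟨l, hl, l8, hN⟩ := h.exists_mod_eight hq k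
    exact NormProd.of_mul (pos hl) (NormProd.of_normSq hN)
      (h.normProd_of_split_mod_eight hp hJ hl l8)
  · obtain ⟨l, hl, l8, hN⟩ := h.swap_right.exists_mod_eight hq.swap_right k
    exact NormProd.of_mul (pos hl.swap_right) (NormProd.of_normSq hN).swap_right
      (h.normProd_of_split_mod_eight hp hJ hl.swap_right l8)
  · obtain ⟨l, hl, l8, hN⟩ := h.swap_left.swap_right.exists_mod_eight hq.swap_left.swap_right k
    exact NormProd.of_mul (pos hl.swap_right.swap_left)
      (NormProd.of_normSq hN).swap_right.swap_left
      (h.normProd_of_split_mod_eight hp hJ hl.swap_right.swap_left l8)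

/-- Every prime not dividing `2 * a * b * c` is a product of norms. -/
theorem Admissible.normProd_prime (h : Admissible u₁ u₂ u₃ a b c) (hp : p ∣ a)
    (hJ : J(u₂ * b * (u₃ * c) | p) = -1) (hq : q.Prime) (hodd : Odd q)
    (qa : IsCoprime (q : ℤ) a) (qb : IsCoprime (q : ℤ) b) (qc : IsCoprime (q : ℤ) c) :
    NormProd (u₁ * a) (u₂ * b) (u₃ * c) q := by
  have pos : ∀ {l : ℕ}, SplitPrime u₁ u₂ u₃ a b c l → (l : ℚ) ≠ 0 := fun hl => by
    exact_mod_cast hl.prime.ne_zero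
  have A : J(u₁ * a | q) = 1 ∨ J(u₁ * a | q) = -1 := by
    rw [jacobiSym_flip u₁ h.odd₁ hodd]
    exact one_or_neg_one_mul (recSign_eq_one_or h.unit₁ a hodd) (jacobiSym_eq_one_or qa)
  have B : J(u₂ * b | q) = 1 ∨ J(u₂ * b | q) = -1 := by
    rw [jacobiSym_flip u₂ h.odd₂ hodd]
    exact one_or_neg_one_mul (recSign_eq_one_or h.unit₂ b hodd) (jacobiSym_eq_one_or qb)
  have C : J(u₃ * c | q) = 1 ∨ J(u₃ * c | q) = -1 := by
    rw [jacobiSym_flip u₃ h.odd₃ hodd]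
    exact one_or_neg_one_mul (recSign_eq_one_or h.unit₃ c hodd) (jacobiSym_eq_one_or qc)
  have key : J(u₁ * a | q) = J(u₂ * b | q) ∨ J(u₁ * a | q) = J(u₃ * c | q) ∨
      J(u₂ * b | q) = J(u₃ * c | q) := by
    rcases A with h1 | h1 <;> rcases B with h2 | h2 <;> rcases C with h3 | h3 <;>
      simp [h1, h2, h3]
  rcases key with k | k | k
  · obtain ⟨l, hl, hN⟩ := h.exists_split hq hodd qa qb k
    exact NormProd.of_mul (pos hl) (NormProd.of_normSq hN) (h.normProd_of_split hp hJ hl)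
  · obtain ⟨l, hl, hN⟩ := h.swap_right.exists_split hq hodd qa qc k
    exact NormProd.of_mul (pos hl.swap_right) (NormProd.of_normSq hN).swap_right
      (h.normProd_of_split hp hJ hl.swap_right)
  · obtain ⟨l, hl, hN⟩ := h.swap_left.swap_right.exists_split hq hodd qb qc k
    exact NormProd.of_mul (pos hl.swap_right.swap_left)
      (NormProd.of_normSq hN).swap_right.swap_left
      (h.normProd_of_split hp hJ hl.swap_right.swap_left)

end GoodPrime

end NormGroupGoodPrimes

section NormProdAll

variable {A B C : ℤ}

/-- All positive integers prime to `2 * A * B * C` are products of norms. -/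
def GoodNormProd (A B C : ℤ) : Prop :=
  ∀ n : ℤ, 0 < n → IsCoprime n (2 * (A * B * C)) → NormProd A B C n

lemma GoodNormProd.swap_left (h : GoodNormProd A B C) : GoodNormProd B A C :=
  fun n hn hc => (h n hn (by rwa [mul_comm A B])).swap_left

lemma GoodNormProd.swap_right (h : GoodNormProd A B C) : GoodNormProd A C B :=
  fun n hn hc => (h n hn (by rwa [mul_right_comm A B])).swap_right

lemma NormProd.neg_one_aux (h : GoodNormProd A B C) (hpos : 0 < A * B) (hC : C ≠ 0) :
    NormProd A B C (-1) := by
  have hM : 0 < A * B * (2 * C) ^ 2 := by positivity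
  set n : ℤ := A * B * (2 * C) ^ 2 - 1 with hn
  have hdvd : (2 * (A * B * C)) ∣ A * B * (2 * C) ^ 2 := ⟨2 * C, by ring⟩
  have hcop : IsCoprime n (2 * (A * B * C)) := by
    obtain ⟨k, hk⟩ := hdvd
    exact ⟨-1, k, by rw [hn]; linear_combination -hk⟩
  have h4 : 4 ∣ A * B * (2 * C) ^ 2 := ⟨A * B * C ^ 2, by ring⟩
  have hnpos : 0 < n := by omega
  refine NormProd.of_mul (s := n) (by exact_mod_cast hnpos.ne') ?_ (h n hnpos hcop)
  refine NormProd.of_normSq ⟨1, 2 * C, ?_⟩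
  rw [hn]; push_cast; ring

lemma NormProd.neg_one (h : GoodNormProd A B C) (hA : A ≠ 0) (hB : B ≠ 0) (hC : C ≠ 0) :
    NormProd A B C (-1) := by
  by_cases h1 : 0 < A * B
  · exact NormProd.neg_one_aux h h1 hC
  by_cases h2 : 0 < A * C
  · exact (NormProd.neg_one_aux h.swap_right h2 hB).swap_right
  · have h3 : 0 < B * C := by
      have h1' : A * B < 0 := lt_of_le_of_ne (not_lt.1 h1) (mul_ne_zero hA hB)
      have h2' : A * C < 0 := lt_of_le_of_ne (not_lt.1 h2) (mul_ne_zero hA hC)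
      have : 0 < (A * A) * (B * C) := by
        have := mul_pos_of_neg_of_neg h1' h2'
        linarith [show A * B * (A * C) = (A * A) * (B * C) by ring]
      exact (pos_iff_pos_of_mul_pos this).1 (mul_self_pos.2 hA)
    exact (NormProd.neg_one_aux h.swap_left.swap_right h3 hA).swap_right.swap_left

/-- Integers prime to `2 * A * B * C` are products of norms. -/
lemma NormProd.of_isCoprime (h : GoodNormProd A B C) (hA : A ≠ 0) (hB : B ≠ 0) (hC : C ≠ 0)
    {n : ℤ} (hn : IsCoprime n (2 * (A * B * C))) (hn0 : n ≠ 0) : NormProd A B C n := by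
  rcases lt_or_gt_of_ne hn0 with h0 | h0
  · have := (NormProd.neg_one h hA hB hC).mul (h (-n) (by omega) hn.neg_left)
    convert this using 1
    push_cast; ring
  · exact h n h0 hn

lemma ne_zero_of_isCoprime_two {n m : ℤ} (hn : IsCoprime n (2 * m)) : n ≠ 0 := by
  rintro rfl
  have := isCoprime_zero_left.1 hn
  exact Int.prime_two.not_isUnit (isUnit_of_mul_isUnit_left this)

lemma NormProd.odd_prime_aux (h : GoodNormProd A B C) (sA : Squarefree A) (hB : B ≠ 0)
    (hC : C ≠ 0) (hAB : IsCoprime A B) (hAC : IsCoprime A C) (hBC : IsCoprime B C)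
    {p : ℕ} (hp : p.Prime) (hp2 : p ≠ 2) (hpA : (p : ℤ) ∣ A) : NormProd A B C p := by
  obtain ⟨A', rfl⟩ := hpA
  have oddp : Odd (p : ℤ) := by exact_mod_cast hp.odd_of_ne_two hp2
  have hpA' : IsCoprime (p : ℤ) A' := (IsRelPrime.isCoprime fun d h1 h2 => by
    exact sA d (mul_dvd_mul h1 h2))
  set e := A' * B with he
  have hpe : IsCoprime (p : ℤ) e := hpA'.mul_right hAB.of_mul_left_left
  have hCe : IsCoprime C e := hAC.symm.of_mul_right_right.mul_right hBC.symm
  obtain ⟨k, hke, hkodd⟩ : ∃ k : ℤ, IsCoprime (k * C) e ∧ Odd (p * (k * C) ^ 2 - e) := by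
    rcases Int.even_or_odd e with h0 | h0
    · refine ⟨1, by rwa [one_mul], ?_⟩
      have oddC : Odd C := by
        rw [← Int.isCoprime_two_left]
        exact hCe.symm.of_isCoprime_of_dvd_left h0.two_dvd
      rw [one_mul]
      exact (oddp.mul oddC.pow).sub_even h0
    · refine ⟨2, (Int.isCoprime_two_left.2 h0).mul_left hCe, ?_⟩
      refine Even.sub_odd ?_ h0
      exact ⟨p * (2 * C ^ 2), by ring⟩
  set w : ℤ := p * (k * C) ^ 2 - e with hw
  have w1 : IsCoprime w p := by
    rw [show w = -e + p * ((k * C) ^ 2) by rw [hw]; ring]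
    exact IsCoprime.add_mul_left_left hpe.symm.neg_left _
  have w2 : IsCoprime w e := by
    rw [show w = p * (k * C) ^ 2 + e * (-1) by rw [hw]; ring]
    exact IsCoprime.add_mul_left_left (hpe.mul_left hke.pow_left) _
  have w3 : IsCoprime w C := by
    rw [show w = -e + C * (p * k ^ 2 * C) by rw [hw]; ring]
    exact IsCoprime.add_mul_left_left hCe.symm.neg_left _
  have w4 : IsCoprime w (2 * (p * A' * B * C)) := by
    rw [show 2 * (p * A' * B * C) = 2 * (p * e * C) by rw [he]; ring]
    exact (Int.isCoprime_two_right.2 hkodd).mul_right ((w1.mul_right w2).mul_right w3)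
  have w0 := ne_zero_of_isCoprime_two w4
  have := NormProd.of_isCoprime h (left_ne_zero_of_mul (a := p * A') (b := 1) (by
    simpa using sA.ne_zero)) hB hC w4 w0
  refine NormProd.of_mul (s := w) (by exact_mod_cast w0) ?_ this
  refine NormProd.of_normSq ⟨p * (k * C), 1, ?_⟩
  rw [hw, he]; push_cast; ring

/-- The relation `x² - D y² = 2 s² w` with `w` prime to everything gives that `2` is a product
of norms. -/
lemma NormProd.two_aux (h : GoodNormProd A B C) (hA : A ≠ 0) (hB : B ≠ 0) (hC : C ≠ 0)
    {x y s w : ℤ} (hs : s ≠ 0) (hw : IsCoprime w (2 * (A * B * C)))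
    (heq : x ^ 2 - A * B * y ^ 2 = 2 * s ^ 2 * w) : NormProd A B C 2 := by
  have w0 := ne_zero_of_isCoprime_two hw
  have hwN := NormProd.of_isCoprime h hA hB hC hw w0
  refine NormProd.of_mul (s := s ^ 2 * w) ?_ ?_ ((NormProd.sq _).mul hwN)
  · exact mul_ne_zero (pow_ne_zero _ (by exact_mod_cast hs)) (by exact_mod_cast w0)
  · refine NormProd.of_normSq ⟨x, y, ?_⟩
    have : ((x ^ 2 - A * B * y ^ 2 : ℤ) : ℚ) = (2 * s ^ 2 * w : ℤ) := by rw [heq]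
    push_cast at this ⊢
    rw [this]; ring

lemma isCoprime_of_eq_mul {x D w m z : ℤ} (hx : IsCoprime x m) (hm : m ∣ D)
    (heq : x - D = z * w) : IsCoprime w m := by
  have : IsCoprime (x - D) m := by
    obtain ⟨k, rfl⟩ := hm
    rw [show x - m * k = x + m * (-k) by ring]
    exact hx.add_mul_left_left _
  rw [heq] at this
  exact this.of_mul_left_right

lemma NormProd.two_of_even (h : GoodNormProd A B C) (sC : Squarefree C) (hA : A ≠ 0) (hB : B ≠ 0)
    (hAC : IsCoprime A C) (hBC : IsCoprime B C)
    (hC : Even C) : NormProd A B C 2 := by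
  obtain ⟨E, rfl⟩ := hC.two_dvd
  have oddA : Odd A := Int.isCoprime_two_right.1 hAC.of_mul_right_left
  have oddB : Odd B := Int.isCoprime_two_right.1 hBC.of_mul_right_left
  have oddE : Odd E := by
    rw [← Int.isCoprime_two_left]
    exact IsRelPrime.isCoprime fun d h1 h2 => sC d (mul_dvd_mul h1 h2)
  have oddw : Odd (2 - A * E * B ^ 2) := by
    exact Even.sub_odd even_two ((oddA.mul oddE).mul oddB.pow)
  have hE : E ≠ 0 := by rintro rfl; simp at oddE
  refine (NormProd.two_aux (x := 2) (y := B) (s := 1) (w := 2 - A * E * B ^ 2) h.swap_right hA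
    (mul_ne_zero two_ne_zero hE) hB one_ne_zero ?_ (by ring)).swap_right
  have e : (2 : ℤ) - A * E * B ^ 2 = 1 * (2 - A * E * B ^ 2) := by ring
  have h2 := Int.isCoprime_two_right.2 oddw
  have hA' := isCoprime_of_eq_mul (Int.isCoprime_two_left.2 oddA) ⟨E * B ^ 2, by ring⟩ e
  have hE' := isCoprime_of_eq_mul (Int.isCoprime_two_left.2 oddE) ⟨A * B ^ 2, by ring⟩ e
  have hB' := isCoprime_of_eq_mul (Int.isCoprime_two_left.2 oddB) ⟨A * E * B, by ring⟩ e
  exact h2.mul_right ((hA'.mul_right (h2.mul_right hE')).mul_right hB')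

lemma NormProd.two_of_mod_four (h : GoodNormProd A B C) (hA : A ≠ 0) (hB : B ≠ 0) (hC : Odd C)
    (h4 : A * B % 4 = 3) : NormProd A B C 2 := by
  have hC0 : C ≠ 0 := by rintro rfl; simp at hC
  have hC4 : C ^ 2 % 4 = 1 := Int.sq_mod_four_eq_one_of_odd hC
  have hmod : A * B * C ^ 2 % 4 = 3 := by
    rw [Int.mul_emod, h4, hC4]; norm_num
  obtain ⟨w, hw⟩ : ∃ w, 1 - A * B * C ^ 2 = 2 * w := ⟨(1 - A * B * C ^ 2) / 2, by omega⟩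
  have h2 : IsCoprime w 2 := Int.isCoprime_two_right.2 (by rw [Int.odd_iff]; omega)
  refine NormProd.two_aux (x := 1) (y := C) (s := 1) (w := w) h hA hB hC0 one_ne_zero ?_
    (by linarith)
  exact h2.mul_right (isCoprime_of_eq_mul isCoprime_one_left ⟨C, by ring⟩ hw)

lemma Int.sq_emod_eight_of_odd {n : ℤ} (h : Odd n) : n ^ 2 % 8 = 1 := by
  obtain ⟨k, rfl⟩ := h
  have : (2 * k + 1) ^ 2 = 4 * (k * (k + 1)) + 1 := by ring
  have := Int.even_mul_succ_self k
  obtain ⟨j, hj⟩ := this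
  omega

lemma NormProd.two_of_mod_eight (h : GoodNormProd A B C) (hA : Odd A) (hB : Odd B) (hC : Odd C)
    (h8 : A * B % 8 = 1) : NormProd A B C 2 := by
  have hA0 : A ≠ 0 := by rintro rfl; simp at hA
  have hB0 : B ≠ 0 := by rintro rfl; simp at hB
  have hC0 : C ≠ 0 := by rintro rfl; simp at hC
  have hmod : A * B * C ^ 2 % 8 = 1 := by
    rw [Int.mul_emod, h8, Int.sq_emod_eight_of_odd hC]; norm_num
  have key : ∀ x : ℤ, IsCoprime x (A * B * C) → (x ^ 2 - A * B * C ^ 2) % 16 = 8 →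
      NormProd A B C 2 := by
    intro x hx hx16
    obtain ⟨w, hw⟩ : ∃ w, x ^ 2 - A * B * C ^ 2 = 8 * w := ⟨(x ^ 2 - A * B * C ^ 2) / 8, by omega⟩
    have h2 : IsCoprime w 2 := Int.isCoprime_two_right.2 (by rw [Int.odd_iff]; omega)
    refine NormProd.two_aux (x := x) (y := C) (s := 2) (w := w) h hA0 hB0 hC0 two_ne_zero ?_
      (by linarith)
    exact h2.mul_right (isCoprime_of_eq_mul hx.pow_left ⟨C, by ring⟩ hw)
  by_cases h16 : A * B * C ^ 2 % 16 = 9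
  · exact key 1 isCoprime_one_left (by omega)
  obtain ⟨u, hu, hu4⟩ : ∃ u : ℤ, A * B * C ∣ u ∧ u % 4 = 1 := by
    have : Odd (A * B * C) := (hA.mul hB).mul hC
    rw [Int.odd_iff] at this
    rcases (show A * B * C % 4 = 1 ∨ A * B * C % 4 = 3 by omega) with h0 | h0
    · exact ⟨_, dvd_rfl, h0⟩
    · exact ⟨-(A * B * C), (dvd_neg).2 dvd_rfl, by omega⟩
  refine key (1 + 2 * u) ?_ ?_
  · obtain ⟨k, rfl⟩ := hu
    rw [show 1 + 2 * (A * B * C * k) = 1 + A * B * C * (2 * k) by ring]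
    exact isCoprime_one_left.add_mul_left_left _
  · obtain ⟨k, rfl⟩ : ∃ k, u = 4 * k + 1 := ⟨u / 4, by omega⟩
    have : (1 + 2 * (4 * k + 1)) ^ 2 = 9 + 16 * (4 * k ^ 2 + 3 * k) := by ring
    omega

lemma NormProd.two (h : GoodNormProd A B C) (sA : Squarefree A) (sB : Squarefree B)
    (sC : Squarefree C) (hAB : IsCoprime A B) (hAC : IsCoprime A C) (hBC : IsCoprime B C) :
    NormProd A B C 2 := by
  have hA := sA.ne_zero
  have hB := sB.ne_zero
  have hC := sC.ne_zero
  rcases Int.even_or_odd C with eC | oC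
  · exact NormProd.two_of_even h sC hA hB hAC hBC eC
  rcases Int.even_or_odd B with eB | oB
  · exact (NormProd.two_of_even h.swap_right sB hA hC hAB hBC.symm eB).swap_right
  rcases Int.even_or_odd A with eA | oA
  · exact (NormProd.two_of_even h.swap_left.swap_right sA hB hC hAB.symm hAC.symm
      eA).swap_right.swap_left
  by_cases h1 : A * B % 4 = 3
  · exact NormProd.two_of_mod_four h hA hB oC h1
  by_cases h2 : A * C % 4 = 3
  · exact (NormProd.two_of_mod_four h.swap_right hA hC oB h2).swap_right
  by_cases h3 : B * C % 4 = 3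
  · exact (NormProd.two_of_mod_four h.swap_left.swap_right hB hC oA h3).swap_right.swap_left
  by_cases k1 : A * B % 8 = 1
  · exact NormProd.two_of_mod_eight h oA oB oC k1
  by_cases k2 : A * C % 8 = 1
  · exact (NormProd.two_of_mod_eight h.swap_right oA oC oB k2).swap_right
  have k3 : B * C % 8 = 1 := by
    have o1 := Int.odd_iff.1 (oA.mul oB)
    have o2 := Int.odd_iff.1 (oA.mul oC)
    have e1 : A * B % 8 = 5 := by omega
    have e2 : A * C % 8 = 5 := by omega
    have e3 : A ^ 2 * (B * C) % 8 = 1 := by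
      rw [show A ^ 2 * (B * C) = (A * B) * (A * C) by ring, Int.mul_emod, e1, e2]; norm_num
    rw [Int.mul_emod, Int.sq_emod_eight_of_odd oA, one_mul] at e3
    omega
  exact (NormProd.two_of_mod_eight h.swap_left.swap_right oB oC oA k3).swap_right.swap_left

/-- If all positive integers prime to `2 * A * B * C` are products of norms, then so is every
nonzero rational number. -/
theorem NormProd.of_ne_zero (h : GoodNormProd A B C) (sA : Squarefree A) (sB : Squarefree B)
    (sC : Squarefree C) (hAB : IsCoprime A B) (hAC : IsCoprime A C) (hBC : IsCoprime B C)
    {r : ℚ} (hr : r ≠ 0) : NormProd A B C r := by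
  have hA := sA.ne_zero
  have hB := sB.ne_zero
  have hC := sC.ne_zero
  have hprime : ∀ p : ℕ, p.Prime → NormProd A B C p := by
    intro p hp
    by_cases hp2 : p = 2
    · subst hp2; exact_mod_cast NormProd.two h sA sB sC hAB hAC hBC
    by_cases hpA : (p : ℤ) ∣ A
    · exact NormProd.odd_prime_aux h sA hB hC hAB hAC hBC hp hp2 hpA
    by_cases hpB : (p : ℤ) ∣ B
    · exact (NormProd.odd_prime_aux h.swap_left sB hA hC hAB.symm hBC hAC hp hp2 hpB).swap_left
    by_cases hpC : (p : ℤ) ∣ C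
    · exact (NormProd.odd_prime_aux h.swap_right.swap_left sC hA hB hAC.symm hBC.symm hAB hp hp2
        hpC).swap_left.swap_right
    have pp := Nat.prime_iff_prime_int.1 hp
    have := h p (by exact_mod_cast hp.pos) (((Prime.coprime_iff_not_dvd pp).2 fun h2 => hp2
      ((Nat.prime_dvd_prime_iff_eq hp Nat.prime_two).1 (by exact_mod_cast h2))).mul_right
      ((((Prime.coprime_iff_not_dvd pp).2 hpA).mul_right
        ((Prime.coprime_iff_not_dvd pp).2 hpB)).mul_right
        ((Prime.coprime_iff_not_dvd pp).2 hpC)))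
    exact_mod_cast this
  have hnat : ∀ n : ℕ, n ≠ 0 → NormProd A B C n := by
    intro n
    induction n using Nat.recOnMul with
    | zero => intro h; exact absurd rfl h
    | one => intro _; simpa using NormProd.sq (a := A) (b := B) (c := C) 1
    | prime p hp => intro _; exact hprime p hp
    | mul x y hx hy =>
      intro hxy
      push_cast
      exact (hx (left_ne_zero_of_mul hxy)).mul (hy (right_ne_zero_of_mul hxy))
  have hZ : ∀ n : ℤ, n ≠ 0 → NormProd A B C n := by
    intro n hn
    obtain ⟨m, rfl | rfl⟩ := n.eq_nat_or_neg
    · exact_mod_cast hnat m (by simpa using hn)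
    · convert (NormProd.neg_one h hA hB hC).mul (hnat m (by simpa using hn)) using 1
      push_cast; ring
  have hden : (r.den : ℚ) ≠ 0 := by exact_mod_cast r.den_ne_zero
  refine NormProd.of_mul (s := (r.den : ℚ) ^ 2) (by positivity) ?_ (NormProd.sq _)
  have := hZ (r.num * r.den) (mul_ne_zero (Rat.num_ne_zero.2 hr) (by exact_mod_cast r.den_ne_zero))
  convert this using 1
  push_cast
  have := Rat.mul_den_eq_num r
  rw [← this]; ring

/-- The product of the norm groups of the three quadratic subfields is everything as soon as
one of the coefficients has an odd prime factor at which the other two multiply to a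
nonresidue. -/
theorem Admissible.normProd {u₁ u₂ u₃ : ℤ} {a b c p : ℕ} (h : Admissible u₁ u₂ u₃ a b c)
    (hp : p ∣ a) (hJ : jacobiSym (u₂ * b * (u₃ * c)) p = -1) {r : ℚ} (hr : r ≠ 0) :
    NormProd (u₁ * a) (u₂ * b) (u₃ * c) r := by
  refine NormProd.of_ne_zero ?_ (h.unit₁.squarefree_mul h.odd₁ h.sq₁)
    (h.unit₂.squarefree_mul h.odd₂ h.sq₂) (h.unit₃.squarefree_mul h.odd₃ h.sq₃)
    h.cop₁₂ h.cop₁₃ h.cop₂₃ hr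
  have key : ∀ n : ℕ, IsCoprime (n : ℤ) (2 * (u₁ * a * (u₂ * b) * (u₃ * c))) →
      NormProd (u₁ * a) (u₂ * b) (u₃ * c) n := by
    intro n
    induction n using Nat.recOnMul with
    | zero => intro hn; exact absurd rfl (ne_zero_of_isCoprime_two hn)
    | one => intro _; simpa using NormProd.sq (a := u₁ * a) (b := u₂ * b) (c := u₃ * c) 1
    | prime q hq =>
      intro hn
      refine h.normProd_prime hp hJ hq ?_
        hn.of_mul_right_right.of_mul_right_left.of_mul_right_left.of_mul_right_right
        hn.of_mul_right_right.of_mul_right_left.of_mul_right_right.of_mul_right_right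
        hn.of_mul_right_right.of_mul_right_right.of_mul_right_right
      exact_mod_cast Int.isCoprime_two_right.1 hn.of_mul_right_left
    | mul x y hx hy =>
      intro hn
      push_cast at hn ⊢
      exact (hx hn.of_mul_left_left).mul (hy hn.of_mul_left_right)
  intro n hn hcop
  lift n to ℕ using hn.le
  exact_mod_cast key n hcop

end NormProdAll

section LocalGlobal

/-- A ternary diagonal form that is isotropic over `ℚ_l` satisfies Legendre's condition at `l`. -/
lemma isSquare_of_padic_isotropic {A B C : ℤ} {l : ℕ} [hl : Fact l.Prime] {X Y Z : ℚ_[l]}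
    (h0 : X ≠ 0 ∨ Y ≠ 0 ∨ Z ≠ 0) (h : (A : ℚ_[l]) * X ^ 2 + B * Y ^ 2 + C * Z ^ 2 = 0)
    (hA : (l : ℤ) ∣ A) (sA : Squarefree A) (hB : ¬ (l : ℤ) ∣ B) :
    IsSquare ((-(B * C) : ℤ) : ZMod l) := by
  have prim : ∃ X Y Z : ℤ_[l], (X = 1 ∨ Y = 1 ∨ Z = 1) ∧
      (A : ℤ_[l]) * X ^ 2 + B * Y ^ 2 + C * Z ^ 2 = 0 := by
    have scale : ∀ t : ℚ_[l], t ≠ 0 → ‖X‖ ≤ ‖t‖ → ‖Y‖ ≤ ‖t‖ → ‖Z‖ ≤ ‖t‖ →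
        (X = t ∨ Y = t ∨ Z = t) → ∃ X Y Z : ℤ_[l], (X = 1 ∨ Y = 1 ∨ Z = 1) ∧
          (A : ℤ_[l]) * X ^ 2 + B * Y ^ 2 + C * Z ^ 2 = 0 := by
      intro t ht hX hY hZ ht'
      have le : ∀ s : ℚ_[l], ‖s‖ ≤ ‖t‖ → ‖s / t‖ ≤ 1 := fun s hs => by
        rw [norm_div]; exact div_le_one_of_le₀ hs (norm_nonneg _)
      obtain ⟨X', hX'⟩ : ∃ X' : ℤ_[l], (X' : ℚ_[l]) = X / t := ⟨⟨X / t, le X hX⟩, rfl⟩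
      obtain ⟨Y', hY'⟩ : ∃ Y' : ℤ_[l], (Y' : ℚ_[l]) = Y / t := ⟨⟨Y / t, le Y hY⟩, rfl⟩
      obtain ⟨Z', hZ'⟩ : ∃ Z' : ℤ_[l], (Z' : ℚ_[l]) = Z / t := ⟨⟨Z / t, le Z hZ⟩, rfl⟩
      refine ⟨X', Y', Z', ?_, ?_⟩
      · rcases ht' with h' | h' | h'
        · left; apply Subtype.ext; rw [hX', h', div_self ht]; rfl
        · right; left; apply Subtype.ext; rw [hY', h', div_self ht]; rfl
        · right; right; apply Subtype.ext; rw [hZ', h', div_self ht]; rfl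
      · apply Subtype.ext
        push_cast
        rw [hX', hY', hZ']
        have : (A : ℚ_[l]) * (X / t) ^ 2 + B * (Y / t) ^ 2 + C * (Z / t) ^ 2 = 0 := by
          field_simp
          linear_combination h
        exact this
    have nz : ∀ s t : ℚ_[l], ‖s‖ ≤ ‖t‖ → s ≠ 0 → t ≠ 0 := fun s t hst hs ht => by
      rw [ht, norm_zero] at hst
      exact hs (norm_le_zero_iff.1 hst)
    rcases le_total ‖X‖ ‖Y‖ with hXY | hXY
    · rcases le_total ‖Y‖ ‖Z‖ with hYZ | hYZ
      · refine scale Z ?_ (hXY.trans hYZ) hYZ le_rfl (by tauto)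
        rcases h0 with h' | h' | h'
        · exact nz _ _ (hXY.trans hYZ) h'
        · exact nz _ _ hYZ h'
        · exact h'
      · refine scale Y ?_ hXY le_rfl hYZ (by tauto)
        rcases h0 with h' | h' | h'
        · exact nz _ _ hXY h'
        · exact h'
        · exact nz _ _ hYZ h'
    · rcases le_total ‖X‖ ‖Z‖ with hXZ | hXZ
      · refine scale Z ?_ hXZ (hXY.trans hXZ) le_rfl (by tauto)
        rcases h0 with h' | h' | h'
        · exact nz _ _ hXZ h'
        · exact nz _ _ (hXY.trans hXZ) h'
        · exact h'
      · refine scale X ?_ le_rfl hXY hXZ (by tauto)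
        rcases h0 with h' | h' | h'
        · exact h'
        · exact nz _ _ hXY h'
        · exact nz _ _ hXZ h'
  clear h h0
  obtain ⟨X, Y, Z, h1, h⟩ := prim
  have ker : ∀ W : ℤ_[l], PadicInt.toZMod W = 0 → (l : ℤ_[l]) ∣ W := fun W hW => by
    have : W ∈ RingHom.ker (PadicInt.toZMod (p := l)) := hW
    rwa [PadicInt.ker_toZMod, PadicInt.maximalIdeal_eq_span_p, Ideal.mem_span_singleton] at this
  have hA0 : (A : ZMod l) = 0 := (ZMod.intCast_zmod_eq_zero_iff_dvd _ _).2 hA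
  have hB0 : (B : ZMod l) ≠ 0 := fun h' => hB ((ZMod.intCast_zmod_eq_zero_iff_dvd _ _).1 h')
  have hred := congrArg (PadicInt.toZMod (p := l)) h
  simp only [map_add, map_mul, map_pow, map_intCast, map_zero, hA0, zero_mul, zero_add] at hred
  set y := PadicInt.toZMod Y with hy
  set z := PadicInt.toZMod Z with hz
  by_cases hz0 : z = 0
  · exfalso
    rw [hz0] at hred
    have hy0 : y = 0 := by
      have : (B : ZMod l) * y ^ 2 = 0 := by linear_combination hred
      exact pow_eq_zero_iff two_ne_zero |>.1 ((mul_eq_zero.1 this).resolve_left hB0)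
    have hX : X = 1 := by
      rcases h1 with h' | h' | h'
      · exact h'
      · rw [hy, h', map_one] at hy0; exact absurd hy0 one_ne_zero
      · rw [hz, h', map_one] at hz0; exact absurd hz0 one_ne_zero
    obtain ⟨Y', hY'⟩ := ker Y hy0
    obtain ⟨Z', hZ'⟩ := ker Z hz0
    have hdvd : ((l : ℤ_[l]) ^ 2) ∣ (A : ℤ_[l]) := by
      refine ⟨-(B * Y' ^ 2 + C * Z' ^ 2), ?_⟩
      rw [hX, hY', hZ'] at h
      linear_combination h
    have : ((l : ℤ) ^ 2) ∣ A := by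
      rw [← PadicInt.pow_p_dvd_int_iff]; exact hdvd
    have := sA l (by rwa [← pow_two])
    exact (Nat.prime_iff_prime_int.1 hl.out).not_isUnit this
  · refine ⟨B * y / z, ?_⟩
    field_simp
    push_cast
    linear_combination -B * hred

/-- Every nonzero rational is a squarefree integer up to squares. -/
lemma exists_squarefree_eq_mul_sq {x : ℚ} (hx : x ≠ 0) :
    ∃ (n : ℤ) (t : ℚ), Squarefree n ∧ t ≠ 0 ∧ (n : ℚ) = x * t ^ 2 := by
  have hden : (x.den : ℚ) ≠ 0 := by exact_mod_cast x.den_ne_zero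
  have hN : x.num * x.den ≠ 0 :=
    mul_ne_zero (Rat.num_ne_zero.2 hx) (by exact_mod_cast x.den_ne_zero)
  obtain ⟨a, b, hab, sa⟩ := Nat.sq_mul_squarefree (x.num * x.den).natAbs
  have hb : b ≠ 0 := by
    rintro rfl
    apply hN
    rw [← Int.natAbs_eq_zero, ← hab]; ring
  have hbQ : (b : ℚ) ≠ 0 := by exact_mod_cast hb
  have e0 : x * x.den ^ 2 = ((x.num * x.den : ℤ) : ℚ) := by
    push_cast
    rw [← Rat.mul_den_eq_num x]; ring
  rcases Int.natAbs_eq (x.num * x.den) with h' | h'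
  · refine ⟨a, x.den / b, Int.squarefree_natCast.2 sa, div_ne_zero hden hbQ, ?_⟩
    rw [div_pow, ← mul_div_assoc, e0, h', ← hab]
    push_cast
    field_simp
  · refine ⟨-a, x.den / b, squarefree_neg_int (Int.squarefree_natCast.2 sa),
      div_ne_zero hden hbQ, ?_⟩
    rw [div_pow, ← mul_div_assoc, e0, h', ← hab]
    push_cast
    field_simp

/-- The Hasse principle for norms from quadratic fields. -/
theorem normSq_of_local {d : ℤ} (sd : Squarefree d) {x : ℚ} (hx : x ≠ 0)
    (hloc : ∀ (l : ℕ) [Fact l.Prime], ∃ u v : ℚ_[l], (x : ℚ_[l]) = u ^ 2 - d * v ^ 2)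
    (hreal : ∃ u v : ℝ, (x : ℝ) = u ^ 2 - d * v ^ 2) : NormSq d x := by
  obtain ⟨n, t, sn, ht, hxt⟩ := exists_squarefree_eq_mul_sq hx
  suffices hn : NormSq d n by
    have := hn.mul (normSq_sq d t⁻¹)
    rw [hxt] at this
    convert this using 1
    field_simp
  have hn0 := sn.ne_zero
  have hd0 := sd.ne_zero
  obtain ⟨g, d', n', hg, cop, rfl, rfl⟩ : ∃ g d' n' : ℤ, 0 < g ∧ IsCoprime d' n' ∧
      d = g * d' ∧ n = g * n' := by
    have hg : 0 < Int.gcd d n := Int.gcd_pos_of_ne_zero_left _ hd0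
    obtain ⟨d', n', h1, h2, h3⟩ := Int.exists_gcd_one (m := d) (n := n) hg
    exact ⟨Int.gcd d n, d', n', by exact_mod_cast hg, Int.isCoprime_iff_gcd_eq_one.2 h1,
      by rw [mul_comm]; exact h2, by rw [mul_comm]; exact h3⟩
  have cgd : IsCoprime g d' := IsRelPrime.isCoprime fun k h1 h2 => sd k (mul_dvd_mul h1 h2)
  have cgn : IsCoprime g n' := IsRelPrime.isCoprime fun k h1 h2 => sn k (mul_dvd_mul h1 h2)
  have sg : Squarefree g := sd.of_mul_left
  have sd' : Squarefree d' := sd.of_mul_right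
  have sn' : Squarefree n' := sn.of_mul_right
  have iso : ∀ (l : ℕ) [Fact l.Prime], ∃ X Y Z : ℚ_[l], Z ≠ 0 ∧
      (g : ℚ_[l]) * X ^ 2 + (-d' : ℤ) * Y ^ 2 + (-n' : ℤ) * Z ^ 2 = 0 := by
    intro l hl
    obtain ⟨u, v, huv⟩ := hloc l
    have hgl : (g : ℚ_[l]) ≠ 0 := by exact_mod_cast hg.ne'
    refine ⟨u * t / g, v * t, 1, one_ne_zero, ?_⟩
    have e1 : ((g * n' : ℤ) : ℚ_[l]) = x * t ^ 2 := by
      exact_mod_cast congrArg (Rat.cast : ℚ → ℚ_[l]) hxt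
    push_cast at e1 huv ⊢
    rw [huv] at e1
    field_simp
    linear_combination -e1
  have ndvd : ∀ {a b : ℤ} {l : ℕ}, l.Prime → IsCoprime a b → (l : ℤ) ∣ a → ¬ (l : ℤ) ∣ b :=
    fun {a b l} hl hab ha hb =>
      (Nat.prime_iff_prime_int.1 hl).not_isUnit (hab.isUnit_of_dvd' ha hb)
  push_cast
  refine normSq_of_legendre hg ?_ cgd cgn cop sg sd' sn' ?_ ?_ ?_
  · by_contra hcon
    push Not at hcon
    obtain ⟨u, v, huv⟩ := hreal
    have e1 : ((g * n' : ℤ) : ℝ) = x * t ^ 2 := by exact_mod_cast congrArg (Rat.cast : ℚ → ℝ) hxt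
    have hd' : (d' : ℝ) < 0 := by
      exact_mod_cast lt_of_le_of_ne hcon.1 sd'.ne_zero
    have hn' : (n' : ℝ) < 0 := by
      exact_mod_cast lt_of_le_of_ne hcon.2 sn'.ne_zero
    have hg' : (0 : ℝ) < g := by exact_mod_cast hg
    rw [huv] at e1
    push_cast at e1
    have p1 : (g : ℝ) * n' < 0 := mul_neg_of_pos_of_neg hg' hn'
    have p2 : (g : ℝ) * d' * v ^ 2 ≤ 0 :=
      mul_nonpos_of_nonpos_of_nonneg (mul_neg_of_pos_of_neg hg' hd').le (sq_nonneg v)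
    have p3 : 0 ≤ (u ^ 2 - g * d' * v ^ 2) * (t : ℝ) ^ 2 :=
      mul_nonneg (by linarith [sq_nonneg u]) (sq_nonneg _)
    linarith
  · intro l hl _ hlg
    have : Fact l.Prime := ⟨hl⟩
    obtain ⟨X, Y, Z, hZ, h⟩ := iso l
    have := isSquare_of_padic_isotropic (Or.inr (Or.inr hZ)) h hlg sg
      (by rw [dvd_neg]; exact ndvd hl cgd hlg)
    rwa [neg_mul_neg] at this
  · intro l hl _ hlg
    have : Fact l.Prime := ⟨hl⟩
    obtain ⟨X, Y, Z, hZ, h⟩ := iso l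
    have := isSquare_of_padic_isotropic (A := -d') (B := g) (C := -n') (X := Y) (Y := X) (Z := Z)
      (Or.inr (Or.inr hZ)) (by rw [← h]; ring) (by rwa [dvd_neg]) (squarefree_neg_int sd')
      (ndvd hl cgd.symm hlg)
    rwa [mul_neg, neg_neg] at this
  · intro l hl _ hlg
    have : Fact l.Prime := ⟨hl⟩
    obtain ⟨X, Y, Z, hZ, h⟩ := iso l
    have := isSquare_of_padic_isotropic (A := -n') (B := g) (C := -d') (X := Z) (Y := X) (Z := Y)
      (Or.inl hZ) (by rw [← h]; ring) (by rwa [dvd_neg]) (squarefree_neg_int sn')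
      (ndvd hl cgn.symm hlg)
    rwa [mul_neg, neg_neg] at this

end LocalGlobal

section NormForm

open Module

/-- Multiplication matrices of `R[√d₁, √d₂]`. -/
lemma leftMulMatrix_of_basis {R A : Type*} [CommRing R] [CommRing A] [Algebra R A]
    (e : Basis (Fin 4) R A) {i j : A} {d₁ d₂ : R} (e0 : e 0 = 1) (e1 : e 1 = i) (e2 : e 2 = j)
    (e3 : e 3 = i * j) (hi : i ^ 2 = algebraMap R A d₁) (hj : j ^ 2 = algebraMap R A d₂)
    (x : Fin 4 → R) :
    Algebra.leftMulMatrix e (∑ k, x k • e k) =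
      !![x 0, d₁ * x 1, d₂ * x 2, d₁ * d₂ * x 3; x 1, x 0, d₂ * x 3, d₂ * x 2;
        x 2, d₁ * x 3, x 0, d₁ * x 1; x 3, x 2, x 1, x 0] := by
  ext k l
  rw [Algebra.leftMulMatrix_eq_repr_mul]
  set M := !![x 0, d₁ * x 1, d₂ * x 2, d₁ * d₂ * x 3; x 1, x 0, d₂ * x 3, d₂ * x 2;
      x 2, d₁ * x 3, x 0, d₁ * x 1; x 3, x 2, x 1, x 0] with hM
  have : (∑ k, x k • e k) * e l = ∑ k, M k l • e k := by
    fin_cases l <;>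
    simp [hM, Fin.sum_univ_four, e0, e1, e2, e3, Algebra.smul_def, ← hi, ← hj] <;>
    ring
  rw [this, e.repr_sum_self]

/-- The norm form of `R[√d₁, √d₂]` in terms of coordinates, as a norm from `R[√d₁]`. -/
lemma norm_eq_of_basis {R A : Type*} [CommRing R] [CommRing A] [Algebra R A]
    (e : Basis (Fin 4) R A) {i j : A} {d₁ d₂ : R} (e0 : e 0 = 1) (e1 : e 1 = i) (e2 : e 2 = j)
    (e3 : e 3 = i * j) (hi : i ^ 2 = algebraMap R A d₁) (hj : j ^ 2 = algebraMap R A d₂)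
    (x : Fin 4 → R) :
    Algebra.norm R (∑ k, x k • e k) =
      (x 0 ^ 2 + d₁ * x 1 ^ 2 - d₂ * x 2 ^ 2 - d₁ * d₂ * x 3 ^ 2) ^ 2 -
        d₁ * (2 * x 0 * x 1 - 2 * d₂ * x 2 * x 3) ^ 2 := by
  rw [Algebra.norm_eq_matrix_det e, leftMulMatrix_of_basis e e0 e1 e2 e3 hi hj]
  simp [Matrix.det_succ_row_zero, Fin.sum_univ_succ, Fin.succAbove]
  ring

lemma exists_norm_eq_of_baseChange {F K : Type*} [Field F] [Algebra ℚ F] [Field K] [Algebra ℚ K]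
    (e : Basis (Fin 4) ℚ K) {i j : K} {d₁ d₂ : ℚ} (e0 : e 0 = 1) (e1 : e 1 = i) (e2 : e 2 = j)
    (e3 : e 3 = i * j) (hi : i ^ 2 = algebraMap ℚ K d₁) (hj : j ^ 2 = algebraMap ℚ K d₂)
    (y : F ⊗[ℚ] K) :
    (∃ u v : F, Algebra.norm F y = u ^ 2 - (d₁ : F) * v ^ 2) ∧
      ∃ u v : F, Algebra.norm F y = u ^ 2 - (d₂ : F) * v ^ 2 := by
  set E := Algebra.TensorProduct.basis F e with hE
  have hEk : ∀ k, E k = 1 ⊗ₜ e k := fun k => Algebra.TensorProduct.basis_apply e k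
  have alg : ∀ d : ℚ, (1 : F) ⊗ₜ[ℚ] (algebraMap ℚ K d) = algebraMap F (F ⊗[ℚ] K) (d : F) := by
    intro d
    rw [Algebra.TensorProduct.algebraMap_apply, Algebra.algebraMap_eq_smul_one,
      TensorProduct.tmul_smul, TensorProduct.smul_tmul', Algebra.smul_def]
    simp
  have hn := norm_eq_of_basis E (i := 1 ⊗ₜ i) (j := 1 ⊗ₜ j) (d₁ := (d₁ : F)) (d₂ := (d₂ : F))
    (by rw [hEk, e0]; rfl) (by rw [hEk, e1]) (by rw [hEk, e2]) (by rw [hEk, e3]; simp)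
    (by rw [← alg, ← hi]; simp) (by rw [← alg, ← hj]; simp) (E.repr y)
  rw [E.sum_repr] at hn
  refine ⟨⟨_, _, hn⟩, (E.repr y) 0 ^ 2 - d₁ * (E.repr y) 1 ^ 2 + d₂ * (E.repr y) 2 ^ 2 -
    d₁ * d₂ * (E.repr y) 3 ^ 2, 2 * (E.repr y) 0 * (E.repr y) 2 - 2 * d₁ * (E.repr y) 1 *
    (E.repr y) 3, ?_⟩
  rw [hn]
  ring

/-- If every nonzero rational is a product of norms from the three quadratic subfields, then the
Hasse norm principle holds for a biquadratic field. -/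
theorem hasseNormPrinciple_of_normProd {K : Type*} [Field K] [Algebra ℚ K]
    (e : Basis (Fin 4) ℚ K) {i j : K} {a b c : ℤ} (e0 : e 0 = 1) (e1 : e 1 = i) (e2 : e 2 = j)
    (e3 : e 3 = i * j) (hi : i ^ 2 = (a * b : ℤ)) (hj : j ^ 2 = (a * c : ℤ))
    (s₁ : Squarefree (a * b)) (s₂ : Squarefree (a * c))
    (h : ∀ r : ℚ, r ≠ 0 → NormProd a b c r) : HasseNormPrinciple K := by
  have hi' : i ^ 2 = algebraMap ℚ K ((a * b : ℤ) : ℚ) := by rw [hi, map_intCast]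
  have hj' : j ^ 2 = algebraMap ℚ K ((a * c : ℤ) : ℚ) := by rw [hj, map_intCast]
  have ha : (a : ℚ) ≠ 0 := by
    have := s₁.ne_zero
    exact_mod_cast left_ne_zero_of_mul this
  rintro x hx ⟨hloc, y, -, hy⟩
  have n₁ : NormSq (a * b) x := by
    refine normSq_of_local s₁ hx ?_ ?_
    · intro l hl
      obtain ⟨y, -, hy⟩ := hloc l
      have := (exists_norm_eq_of_baseChange e e0 e1 e2 e3 hi' hj' y).1
      rw [hy] at this
      simpa using this
    · have := (exists_norm_eq_of_baseChange e e0 e1 e2 e3 hi' hj' y).1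
      rw [hy] at this
      simpa using this
  have n₂ : NormSq (a * c) x := by
    refine normSq_of_local s₂ hx ?_ ?_
    · intro l hl
      obtain ⟨y, -, hy⟩ := hloc l
      have := (exists_norm_eq_of_baseChange e e0 e1 e2 e3 hi' hj' y).2
      rw [hy] at this
      simpa using this
    · have := (exists_norm_eq_of_baseChange e e0 e1 e2 e3 hi' hj' y).2
      rw [hy] at this
      simpa using this
  have norm : ∀ x : Fin 4 → ℚ, Algebra.norm ℚ (∑ k, x k • e k) = _ :=
    norm_eq_of_basis e e0 e1 e2 e3 hi' hj'
  have norm' : ∀ α β γ δ : ℚ, ∃ w : K, Algebra.norm ℚ w =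
      (α ^ 2 + a * b * β ^ 2 - a * c * γ ^ 2 - a * b * (a * c) * δ ^ 2) ^ 2 -
        a * b * (2 * α * β - 2 * (a * c) * γ * δ) ^ 2 := by
    intro α β γ δ
    refine ⟨_, (norm ![α, β, γ, δ]).trans ?_⟩
    simp
  obtain ⟨s, t, u, v, hst, huv, hsu⟩ : ∃ s t u v : ℚ, x = s ^ 2 - (a * b : ℤ) * t ^ 2 ∧
      x = u ^ 2 - (a * c : ℤ) * v ^ 2 ∧ s + u ≠ 0 := by
    obtain ⟨s, t, hst⟩ := n₁
    obtain ⟨u, v, huv⟩ := n₂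
    by_cases hsu : s + u = 0
    · refine ⟨s, t, -u, v, hst, by rw [neg_sq]; exact huv, fun h2 => ?_⟩
      have hs : s = 0 := by linarith
      have hu : u = 0 := by linarith
      rw [hs] at hst
      rw [hu] at huv
      have e' : (t • e 1 - v • e 2) * (t • e 1 + v • e 2) = 0 := by
        have : (t • e 1 - v • e 2) * (t • e 1 + v • e 2) =
            algebraMap ℚ K (t ^ 2 * (a * b : ℤ) - v ^ 2 * (a * c : ℤ)) := by
          rw [map_sub, map_mul, map_mul, ← hi', ← hj', e1, e2, Algebra.smul_def, Algebra.smul_def,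
            map_pow, map_pow]
          ring
        rw [this, show t ^ 2 * (a * b : ℤ) - v ^ 2 * (a * c : ℤ) = (0 : ℚ) by linarith, map_zero]
      have ht : t = 0 := by
        rcases mul_eq_zero.1 e' with h' | h'
        · simpa using congrArg (fun z => e.repr z 1) h'
        · simpa using congrArg (fun z => e.repr z 1) h'
      apply hx
      rw [hst, ht]; ring
    · exact ⟨s, t, u, v, hst, huv, hsu⟩
  push_cast at hst huv
  obtain ⟨w, hw⟩ := norm' (s + u) t v 0
  have hw' : Algebra.norm ℚ w = (2 * (s + u)) ^ 2 * x := by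
    rw [hw]
    have E1 : (a : ℚ) * b * t ^ 2 = s ^ 2 - x := by linarith
    have E2 : (a : ℚ) * c * v ^ 2 = u ^ 2 - x := by linarith
    rw [E1, E2]
    linear_combination (-4 * (s + u) ^ 2) * E1
  obtain ⟨m₁, m₂, m₃, ⟨p₁, q₁, h₁⟩, ⟨p₂, q₂, h₂⟩, ⟨p₃, q₃, h₃⟩, hr⟩ :=
    h (2 * (s + u)) (mul_ne_zero two_ne_zero hsu)
  push_cast at h₁ h₂ h₃
  obtain ⟨w₁, hw₁⟩ := norm' p₁ q₁ 0 0
  obtain ⟨w₂, hw₂⟩ := norm' p₂ 0 q₂ 0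
  obtain ⟨w₃, hw₃⟩ := norm' p₃ 0 0 (q₃ / a)
  have hw₁' : Algebra.norm ℚ w₁ = m₁ ^ 2 := by rw [hw₁, h₁]; ring
  have hw₂' : Algebra.norm ℚ w₂ = m₂ ^ 2 := by rw [hw₂, h₂]; ring
  have hw₃' : Algebra.norm ℚ w₃ = m₃ ^ 2 := by rw [hw₃, h₃]; field_simp; ring
  have hm : m₁ * m₂ * m₃ ≠ 0 := by rw [← hr]; exact mul_ne_zero two_ne_zero hsu
  have fin : Algebra.norm ℚ (w * (w₁ * w₂ * w₃)⁻¹) = x := by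
    have : FiniteDimensional ℚ K := e.finiteDimensional_of_finite
    have hden : Algebra.norm ℚ (w₁ * w₂ * w₃) = (m₁ * m₂ * m₃) ^ 2 := by
      rw [map_mul, map_mul, hw₁', hw₂', hw₃']; ring
    have hw0 : w₁ * w₂ * w₃ ≠ 0 := fun h0 => by
      rw [h0, Algebra.norm_zero] at hden
      exact pow_ne_zero 2 hm hden.symm
    apply mul_right_cancel₀ (pow_ne_zero 2 hm)
    rw [← hden, ← map_mul, inv_mul_cancel_right₀ hw0, hw', hden, hr]
    ring
  refine ⟨_, fun h0 => hx ?_, fin⟩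
  rw [← fin, h0]
  have : FiniteDimensional ℚ K := e.finiteDimensional_of_finite
  exact Algebra.norm_zero

end NormForm

section Klein

open Module

/-- `σ` and `τ` are generators of the Galois group of a biquadratic extension `K/ℚ`. -/
structure IsKleinPair {K : Type*} [Field K] [Algebra ℚ K] (σ τ : K ≃ₐ[ℚ] K) : Prop where
  invol₁ : ∀ x, σ (σ x) = x
  invol₂ : ∀ x, τ (τ x) = x
  comm : ∀ x, σ (τ x) = τ (σ x)
  fixed : ∀ x, σ x = x → τ x = x → ∃ q : ℚ, algebraMap ℚ K q = x
  eigen₁ : ∃ i, i ≠ 0 ∧ σ i = i ∧ τ i = -i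
  eigen₂ : ∃ j, j ≠ 0 ∧ σ j = -j ∧ τ j = j

variable {K : Type*} [Field K] [Algebra ℚ K]

theorem exists_isKleinPair [FiniteDimensional ℚ K] [IsGalois ℚ K]
    (f : (K ≃ₐ[ℚ] K) ≃* Multiplicative (ZMod 2 × ZMod 2)) :
    ∃ σ τ : K ≃ₐ[ℚ] K, IsKleinPair σ τ := by
  set σ := f.symm (Multiplicative.ofAdd (1, 0)) with hσ
  set τ := f.symm (Multiplicative.ofAdd (0, 1)) with hτ
  have sq₁ : σ * σ = 1 := by rw [hσ, ← map_mul, ← map_one f.symm]; rfl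
  have sq₂ : τ * τ = 1 := by rw [hτ, ← map_mul, ← map_one f.symm]; rfl
  have comm : σ * τ = τ * σ := by
    rw [hσ, hτ, ← map_mul f.symm, ← map_mul f.symm, mul_comm]
  have all : ∀ g : K ≃ₐ[ℚ] K, g = 1 ∨ g = σ ∨ g = τ ∨ g = σ * τ := by
    intro g
    have : ∀ m : Multiplicative (ZMod 2 × ZMod 2), m = 1 ∨ m = Multiplicative.ofAdd (1, 0) ∨
      m = Multiplicative.ofAdd (0, 1) ∨
        m = Multiplicative.ofAdd (1, 0) * Multiplicative.ofAdd (0, 1) := by decide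
    rw [hσ, hτ, ← map_mul, ← map_one f.symm]
    simp only [MulEquiv.eq_symm_apply]
    exact this (f g)
  have inv₁ : ∀ x, σ (σ x) = x := fun x => by
    rw [← AlgEquiv.mul_apply, sq₁, AlgEquiv.one_apply]
  have inv₂ : ∀ x, τ (τ x) = x := fun x => by
    rw [← AlgEquiv.mul_apply, sq₂, AlgEquiv.one_apply]
  have com : ∀ x, σ (τ x) = τ (σ x) := fun x => by
    rw [← AlgEquiv.mul_apply, comm, AlgEquiv.mul_apply]
  have indep : ∀ α β γ δ : K, (∀ x, α * x + β * σ x + γ * τ x + δ * σ (τ x) = 0) → α = 0 := by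
    intro α β γ δ h
    set φ : Fin 4 → (K →ₐ[ℚ] K) := ![(1 : K ≃ₐ[ℚ] K), σ, τ, (σ * τ : K ≃ₐ[ℚ] K)] with hφ
    have hinj : Function.Injective φ := by
      set v : Fin 4 → Multiplicative (ZMod 2 × ZMod 2) := ![1, Multiplicative.ofAdd (1, 0),
        Multiplicative.ofAdd (0, 1), Multiplicative.ofAdd (1, 0) * Multiplicative.ofAdd (0, 1)]
        with hv
      have h1 : Function.Injective v := by decide
      have h2 : ∀ k, φ k = ((f.symm (v k) : K ≃ₐ[ℚ] K) : K →ₐ[ℚ] K) := by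
        intro k
        fin_cases k
        · simp [hφ, hv]
        · simp [hφ, hv, hσ]
        · simp [hφ, hv, hτ]
        · simp only [hφ, hv, hσ, hτ, ← map_mul]; rfl
      intro k l hkl
      rw [h2, h2] at hkl
      exact h1 (f.symm.injective (AlgEquiv.coe_toAlgHom_injective hkl))
    have li := (linearIndependent_toLinearMap ℚ K K).comp φ hinj
    rw [Fintype.linearIndependent_iff] at li
    have := li ![α, β, γ, δ] (by
      ext x
      simp only [Fin.sum_univ_four, Function.comp, hφ]
      simpa using h x) 0
    simpa using this
  refine ⟨σ, τ, inv₁, inv₂, com, ?_, ?_, ?_⟩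
  · intro x h1 h2
    have := (IsGalois.mem_bot_iff_fixed (F := ℚ) x).2 (by
      intro g
      rcases all g with rfl | rfl | rfl | rfl
      · rfl
      · exact h1
      · exact h2
      · rw [AlgEquiv.mul_apply, h2, h1])
    exact IntermediateField.mem_bot.1 this
  · by_contra! hcon
    refine one_ne_zero (indep 1 1 (-1) (-1) fun x => ?_)
    by_contra hne
    refine hcon _ hne ?_ ?_
    · simp only [map_add, map_mul, map_one, map_neg, inv₁, com]; ring
    · simp only [map_add, map_mul, map_one, map_neg, inv₂, com]; ring
  · by_contra! hcon
    refine one_ne_zero (indep 1 (-1) 1 (-1) fun x => ?_)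
    by_contra hne
    refine hcon _ hne ?_ ?_
    · simp only [map_add, map_mul, map_one, map_neg, inv₁, com]; ring
    · simp only [map_add, map_mul, map_one, map_neg, inv₂, com]; ring

/-- An eigenvector of the Galois group can be scaled to a square root of a squarefree integer. -/
lemma exists_squarefree_eigen {σ τ : K ≃ₐ[ℚ] K} (h : IsKleinPair σ τ) {i : K} (hi : i ≠ 0)
    (h1 : σ i = i ∨ σ i = -i) (h2 : τ i = i ∨ τ i = -i) :
    ∃ (t : ℚ) (d : ℤ), t ≠ 0 ∧ Squarefree d ∧ (algebraMap ℚ K t * i) ^ 2 = d := by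
  obtain ⟨q, hq⟩ := h.fixed (i ^ 2) (by rcases h1 with h1 | h1 <;> simp [h1])
    (by rcases h2 with h2 | h2 <;> simp [h2])
  have hq0 : q ≠ 0 := by
    rintro rfl
    rw [map_zero] at hq
    exact pow_ne_zero 2 hi hq.symm
  obtain ⟨n, t, sn, ht, hn⟩ := exists_squarefree_eq_mul_sq hq0
  refine ⟨t, n, ht, sn, ?_⟩
  rw [mul_pow, ← hq, ← map_pow, ← map_mul, mul_comm, ← hn, map_intCast]

/-- A biquadratic field is `ℚ(√(ab), √(ac))` with `a, b, c` squarefree and pairwise coprime. -/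
theorem IsKleinPair.exists_sqrt {σ τ : K ≃ₐ[ℚ] K} (h : IsKleinPair σ τ) :
    ∃ (a b c : ℤ) (i j : K), 0 < a ∧ Squarefree a ∧ Squarefree b ∧ Squarefree c ∧
      IsCoprime a b ∧ IsCoprime a c ∧ IsCoprime b c ∧ i ≠ 0 ∧ j ≠ 0 ∧
      i ^ 2 = (a * b : ℤ) ∧ j ^ 2 = (a * c : ℤ) ∧ σ i = i ∧ τ i = -i ∧ σ j = -j ∧ τ j = j := by
  obtain ⟨i, hi, si, ti⟩ := h.eigen₁
  obtain ⟨j, hj, sj, tj⟩ := h.eigen₂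
  obtain ⟨t, d, ht, sd, hd⟩ := exists_squarefree_eigen h hi (Or.inl si) (Or.inr ti)
  obtain ⟨u, n, hu, sn, hn⟩ := exists_squarefree_eigen h hj (Or.inr sj) (Or.inl tj)
  obtain ⟨g, d', n', hg, cop, rfl, rfl⟩ : ∃ g d' n' : ℤ, 0 < g ∧ IsCoprime d' n' ∧
      d = g * d' ∧ n = g * n' := by
    have hg : 0 < Int.gcd d n := Int.gcd_pos_of_ne_zero_left _ sd.ne_zero
    obtain ⟨d', n', h1, h2, h3⟩ := Int.exists_gcd_one (m := d) (n := n) hg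
    exact ⟨Int.gcd d n, d', n', by exact_mod_cast hg, Int.isCoprime_iff_gcd_eq_one.2 h1,
      by rw [mul_comm]; exact h2, by rw [mul_comm]; exact h3⟩
  have ne : ∀ {t : ℚ}, t ≠ 0 → algebraMap ℚ K t ≠ 0 := fun ht => by
    rwa [Ne, map_eq_zero]
  refine ⟨g, d', n', algebraMap ℚ K t * i, algebraMap ℚ K u * j, hg, sd.of_mul_left,
    sd.of_mul_right, sn.of_mul_right,
    IsRelPrime.isCoprime fun k h1 h2 => sd k (mul_dvd_mul h1 h2),
    IsRelPrime.isCoprime fun k h1 h2 => sn k (mul_dvd_mul h1 h2), cop,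
    mul_ne_zero (ne ht) hi, mul_ne_zero (ne hu) hj, hd, hn, ?_, ?_, ?_, ?_⟩ <;>
  simp [si, ti, sj, tj]

/-- The basis `1, i, j, ij` of a biquadratic field attached to two eigenvectors. -/
theorem IsKleinPair.exists_basis {σ τ : K ≃ₐ[ℚ] K} (h : IsKleinPair σ τ) {i j : K} (hi : i ≠ 0)
    (hj : j ≠ 0) (si : σ i = i) (ti : τ i = -i) (sj : σ j = -j) (tj : τ j = j) :
    ∃ e : Basis (Fin 4) ℚ K, e 0 = 1 ∧ e 1 = i ∧ e 2 = j ∧ e 3 = i * j := by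
  have : CharZero K := charZero_of_injective_algebraMap (algebraMap ℚ K).injective
  set v : Fin 4 → K := ![1, i, j, i * j] with hv
  have li : LinearIndependent ℚ v := by
    rw [Fintype.linearIndependent_iff]
    intro g hg
    have e1 : algebraMap ℚ K (g 0) + algebraMap ℚ K (g 1) * i + algebraMap ℚ K (g 2) * j +
        algebraMap ℚ K (g 3) * (i * j) = 0 := by
      rw [← hg]
      simp [hv, Fin.sum_univ_four, Algebra.smul_def]
    have e2 := congrArg σ e1
    have e3 := congrArg τ e1
    have e4 := congrArg τ e2
    simp only [map_add, map_mul, AlgEquiv.commutes, si, sj, ti, tj, map_zero, map_neg]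
      at e2 e3 e4
    have z : ∀ {q : ℚ} {w : K}, w ≠ 0 → 4 * (algebraMap ℚ K q * w) = 0 → q = 0 := by
      intro q w hw h0
      have h4 : (4 : K) ≠ 0 := by norm_num
      have := (mul_eq_zero.1 ((mul_eq_zero.1 h0).resolve_left h4)).resolve_right hw
      rwa [map_eq_zero] at this
    intro k
    fin_cases k
    · exact z (q := g 0) one_ne_zero (by linear_combination e1 + e2 + e3 + e4)
    · exact z (q := g 1) hi (by linear_combination e1 + e2 - e3 - e4)
    · exact z (q := g 2) hj (by linear_combination e1 - e2 + e3 - e4)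
    · exact z (q := g 3) (mul_ne_zero hi hj) (by linear_combination e1 - e2 - e3 + e4)
  have sp : ⊤ ≤ Submodule.span ℚ (Set.range v) := by
    intro x _
    have comp : ∀ w : K, w ≠ 0 → ∀ y : K, w ∈ Set.range v → σ (y / w) = y / w →
        τ (y / w) = y / w → y ∈ Submodule.span ℚ (Set.range v) := by
      intro w hw y hmem h1 h2
      obtain ⟨q, hq⟩ := h.fixed _ h1 h2
      have : y = q • w := by rw [Algebra.smul_def, hq, div_mul_cancel₀ _ hw]
      rw [this]
      exact Submodule.smul_mem _ _ (Submodule.subset_span hmem)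
    have dec : x = (4 : ℚ)⁻¹ • ((x + σ x + τ x + σ (τ x)) + (x + σ x - τ x - σ (τ x)) +
        (x - σ x + τ x - σ (τ x)) + (x - σ x - τ x + σ (τ x))) := by
      rw [Algebra.smul_def, map_inv₀, map_ofNat]
      ring
    rw [dec]
    refine Submodule.smul_mem _ _ (Submodule.add_mem _ (Submodule.add_mem _
      (Submodule.add_mem _ ?_ ?_) ?_) ?_)
    · refine comp 1 one_ne_zero _ ⟨0, rfl⟩ ?_ ?_ <;>
      simp only [map_div₀, map_add, map_one, h.invol₁, h.invol₂, h.comm] <;> ring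
    · refine comp i hi _ ⟨1, rfl⟩ ?_ ?_ <;>
      simp only [map_div₀, map_add, map_sub, h.invol₁, h.invol₂, h.comm, si, ti] <;> ring
    · refine comp j hj _ ⟨2, rfl⟩ ?_ ?_ <;>
      simp only [map_div₀, map_add, map_sub, h.invol₁, h.invol₂, h.comm, sj, tj] <;> ring
    · refine comp (i * j) (mul_ne_zero hi hj) _ ⟨3, rfl⟩ ?_ ?_ <;>
      simp only [map_div₀, map_add, map_sub, map_mul, h.invol₁, h.invol₂, h.comm, si, ti, sj,
        tj] <;> ring
  refine ⟨Basis.mk li sp, ?_, ?_, ?_, ?_⟩ <;> rw [Basis.mk_apply] <;> rfl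

end Klein

section Discriminant

open Module

/-- A rational number whose square times a squarefree integer is an integer is an integer. -/
lemma exists_int_of_sq_mul {q : ℚ} {d z : ℤ} (sd : Squarefree d) (h : q ^ 2 * d = z) :
    ∃ m : ℤ, q = m := by
  have hden : (q.den : ℚ) ≠ 0 := by exact_mod_cast q.den_ne_zero
  have e1 : q.num ^ 2 * d = z * (q.den : ℤ) ^ 2 := by
    have : (q.num : ℚ) ^ 2 * d = z * (q.den : ℚ) ^ 2 := by
      rw [← h, ← Rat.mul_den_eq_num q]; ring
    exact_mod_cast this
  have cop : IsCoprime ((q.den : ℤ) ^ 2) (q.num ^ 2) := by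
    apply IsCoprime.pow
    have := q.reduced
    rw [Int.isCoprime_iff_gcd_eq_one, Int.gcd_comm]
    simpa [Int.gcd] using this
  have hd : (q.den : ℤ) ^ 2 ∣ d := cop.dvd_of_dvd_mul_left (e1 ▸ dvd_mul_left _ _)
  have := sd _ (by rwa [← pow_two])
  have h1 : q.den = 1 := by
    rcases Int.isUnit_iff.1 this with h' | h' <;> omega
  exact ⟨q.num, by rw [← Rat.mul_den_eq_num q, h1]; simp⟩

lemma exists_int_of_isIntegral {K : Type*} [Field K] [Algebra ℚ K] {q : ℚ}
    (h : IsIntegral ℤ (algebraMap ℚ K q)) : ∃ z : ℤ, q = z := by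
  have h' : IsIntegral ℤ q :=
    (isIntegral_algebraMap_iff (A := ℚ) (B := K) (algebraMap ℚ K).injective).1 h
  obtain ⟨z, hz⟩ := IsIntegrallyClosed.isIntegral_iff.1 h'
  exact ⟨z, by rw [← hz]; rfl⟩

/-- The trace form of a biquadratic field. -/
lemma trace_eq_of_basis {K : Type*} [Field K] [Algebra ℚ K]
    (e : Basis (Fin 4) ℚ K) {i j : K} {d₁ d₂ : ℚ} (e0 : e 0 = 1) (e1 : e 1 = i) (e2 : e 2 = j)
    (e3 : e 3 = i * j) (hi : i ^ 2 = algebraMap ℚ K d₁) (hj : j ^ 2 = algebraMap ℚ K d₂)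
    (x : Fin 4 → ℚ) : Algebra.trace ℚ K (∑ k, x k • e k) = 4 * x 0 := by
  rw [Algebra.trace_eq_matrix_trace e, leftMulMatrix_of_basis e e0 e1 e2 e3 hi hj]
  simp [Matrix.trace, Fin.sum_univ_succ]
  ring

/-- The discriminant of `ℤ[√(ab), √(ac), √(bc)]` with respect to the obvious basis. -/
lemma discr_eq_of_basis {K : Type*} [Field K] [Algebra ℚ K] (e : Basis (Fin 4) ℚ K) {i j : K}
    {a b c : ℤ} (e0 : e 0 = 1) (e1 : e 1 = i) (e2 : e 2 = j) (e3 : e 3 = i * j)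
    (hi : i ^ 2 = (a * b : ℤ)) (hj : j ^ 2 = (a * c : ℤ)) (ha : a ≠ 0) :
    Algebra.discr ℚ ![1, i, j, algebraMap ℚ K (a : ℚ)⁻¹ * (i * j)] =
      256 * ((a * b * c : ℤ) : ℚ) ^ 2 := by
  have hi' : i ^ 2 = algebraMap ℚ K ((a * b : ℤ) : ℚ) := by rw [hi, map_intCast]
  have hj' : j ^ 2 = algebraMap ℚ K ((a * c : ℤ) : ℚ) := by rw [hj, map_intCast]
  have ha' : (a : ℚ) ≠ 0 := by exact_mod_cast ha
  have : CharZero K := charZero_of_injective_algebraMap (algebraMap ℚ K).injective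
  have haK : (a : K) ≠ 0 := by exact_mod_cast ha
  have tr : ∀ (y : K) (p q r s : ℚ), y = algebraMap ℚ K p + algebraMap ℚ K q * i +
      algebraMap ℚ K r * j + algebraMap ℚ K s * (i * j) → Algebra.trace ℚ K y = 4 * p := by
    intro y p q r s hy
    have := trace_eq_of_basis e e0 e1 e2 e3 hi' hj' ![p, q, r, s]
    rw [hy]
    simpa [Fin.sum_univ_four, e0, e1, e2, e3, Algebra.smul_def, add_assoc] using this
  have key : Algebra.traceMatrix ℚ ![1, i, j, algebraMap ℚ K (a : ℚ)⁻¹ * (i * j)] =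
      Matrix.diagonal ![4, 4 * ((a : ℚ) * b), 4 * ((a : ℚ) * c), 4 * ((b : ℚ) * c)] := by
    ext m n
    rw [Algebra.traceMatrix_apply, Algebra.traceForm_apply]
    push_cast at hi hj
    fin_cases m <;> fin_cases n <;> simp <;>
    first
    | (refine (tr _ 1 0 0 0 ?_).trans ?_ <;> (simp; done))
    | (refine (tr _ 0 1 0 0 ?_).trans ?_ <;> (simp; done))
    | (refine (tr _ 0 0 1 0 ?_).trans ?_ <;> (simp; done))
    | (refine (tr _ 0 0 0 (a : ℚ)⁻¹ ?_).trans ?_ <;> (simp; done))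
    | (refine (tr _ 0 0 0 1 ?_).trans ?_ <;> simp <;> ring1)
    | (refine (tr _ (a * b) 0 0 0 ?_).trans ?_ <;> simp <;> linear_combination hi)
    | (refine (tr _ (a * c) 0 0 0 ?_).trans ?_ <;> simp <;> linear_combination hj)
    | (refine (tr _ 0 0 b 0 ?_).trans ?_ <;> simp <;> field_simp <;> linear_combination j * hi)
    | (refine (tr _ 0 c 0 0 ?_).trans ?_ <;> simp <;> field_simp <;> linear_combination i * hj)
    | (refine (tr _ (b * c) 0 0 0 ?_).trans ?_ <;> simp <;> field_simp <;>
        linear_combination j ^ 2 * hi + a * b * hj)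
  rw [Algebra.discr_def, key, Matrix.det_diagonal]
  simp [Fin.prod_univ_four]
  ring

section

variable {K : Type*} [Field K] [NumberField K]

/-- An integral basis indexed by `Fin 4`. -/
lemma exists_integralBasis_fin (e : Basis (Fin 4) ℚ K) :
    ∃ W : Basis (Fin 4) ℚ K, (∀ k, IsIntegral ℤ (W k)) ∧
      Algebra.discr ℚ W = NumberField.discr K ∧
      ∀ v : K, IsIntegral ℤ v → ∃ z : Fin 4 → ℤ, v = ∑ k, (z k : ℚ) • W k := by
  set E := (NumberField.integralBasis K).indexEquiv e with hE
  refine ⟨(NumberField.integralBasis K).reindex E, fun k => ?_, ?_, fun v hv => ?_⟩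
  · rw [Basis.reindex_apply, NumberField.integralBasis_apply]
    exact NumberField.RingOfIntegers.isIntegral_coe _
  · rw [Basis.coe_reindex, Algebra.discr_reindex, NumberField.coe_discr]
  · obtain ⟨v, rfl⟩ : ∃ w : NumberField.RingOfIntegers K,
      algebraMap (NumberField.RingOfIntegers K) K w = v := ⟨⟨v, hv⟩, rfl⟩
    set B := (NumberField.RingOfIntegers.basis K).reindex E with hB
    have hk : ∀ k, (NumberField.integralBasis K).reindex E k =
        algebraMap (NumberField.RingOfIntegers K) K (B k) := fun k => by
      rw [hB, Basis.reindex_apply, NumberField.integralBasis_apply, Basis.reindex_apply]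
    refine ⟨fun k => B.repr v k, ?_⟩
    have := congrArg (algebraMap (NumberField.RingOfIntegers K) K) (B.sum_repr v)
    rw [map_sum] at this
    refine Eq.trans this.symm (Finset.sum_congr rfl fun k _ => ?_)
    rw [hk, zsmul_eq_mul, map_mul, Algebra.smul_def]
    simp

lemma exists_discr_eq_sq_mul (e : Basis (Fin 4) ℚ K) {v : Fin 4 → K}
    (hv : ∀ k, IsIntegral ℤ (v k)) :
    ∃ m : ℤ, Algebra.discr ℚ v = m ^ 2 * NumberField.discr K := by
  obtain ⟨W, -, hW, hInt⟩ := exists_integralBasis_fin e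
  choose z hz using fun k => hInt (v k) (hv k)
  set P : Matrix (Fin 4) (Fin 4) ℤ := Matrix.of fun m n => z n m with hP
  refine ⟨P.det, ?_⟩
  have : v = Matrix.vecMul W ((P.map (Int.cast : ℤ → ℚ)).map (algebraMap ℚ K)) := by
    ext n
    rw [hz n]
    simp [Matrix.vecMul, dotProduct, hP, Algebra.smul_def, mul_comm]
  rw [this, Algebra.discr_of_matrix_vecMul, hW]
  congr 2
  exact (Int.cast_det P).symm

/-- Bounding the discriminant of a number field below via an order of controlled denominator. -/
lemma exists_mul_discr_eq_sq_mul (e : Basis (Fin 4) ℚ K) {v : Fin 4 → K} {N : ℕ}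
    (hv : ∀ x : K, IsIntegral ℤ x → ∃ z : Fin 4 → ℤ, (N : K) * x = ∑ k, (z k : K) * v k) :
    ∃ m : ℤ, ((N : ℚ) ^ 4) ^ 2 * NumberField.discr K = m ^ 2 * Algebra.discr ℚ v := by
  obtain ⟨W, hWi, hW, -⟩ := exists_integralBasis_fin e
  choose z hz using fun k => hv (W k) (hWi k)
  set P : Matrix (Fin 4) (Fin 4) ℤ := Matrix.of fun m n => z n m with hP
  refine ⟨P.det, ?_⟩
  have h1 : Matrix.vecMul W ((Matrix.diagonal fun _ : Fin 4 => (N : ℚ)).map (algebraMap ℚ K)) =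
      Matrix.vecMul v ((P.map (Int.cast : ℤ → ℚ)).map (algebraMap ℚ K)) := by
    ext n
    have e1 : Matrix.vecMul W ((Matrix.diagonal fun _ : Fin 4 => (N : ℚ)).map (algebraMap ℚ K)) n =
        N * W n := by
      rw [Matrix.diagonal_map (map_zero _), Matrix.vecMul_diagonal]
      simp [mul_comm]
    rw [e1, hz n]
    simp [Matrix.vecMul, dotProduct, hP, mul_comm]
  have h2 := congrArg (Algebra.discr ℚ) h1
  rw [Algebra.discr_of_matrix_vecMul, Algebra.discr_of_matrix_vecMul, hW, Matrix.det_diagonal,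
    Finset.prod_const, Finset.card_univ, Fintype.card_fin] at h2
  rw [h2]
  congr 2
  exact (Int.cast_det P).symm

/-- Upper bound for the discriminant of a biquadratic field. -/
theorem discr_le_of_basis (e : Basis (Fin 4) ℚ K) {i j : K}
    {a b c : ℤ} (e0 : e 0 = 1) (e1 : e 1 = i) (e2 : e 2 = j) (e3 : e 3 = i * j)
    (hi : i ^ 2 = (a * b : ℤ)) (hj : j ^ 2 = (a * c : ℤ)) (ha : a ≠ 0) (hb : b ≠ 0) (hc : c ≠ 0) :
    NumberField.discr K ≤ 256 * (a * b * c) ^ 2 ∧ 0 < NumberField.discr K := by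
  have haK : (a : K) ≠ 0 := by exact_mod_cast ha
  have int : ∀ (y : K) (z : ℤ), y ^ 2 = z → IsIntegral ℤ y := fun y z hy => by
    refine IsIntegral.of_pow two_pos ?_
    rw [hy]
    exact isIntegral_algebraMap (R := ℤ)
  obtain ⟨m, hm⟩ := exists_discr_eq_sq_mul e
    (v := ![1, i, j, algebraMap ℚ K (a : ℚ)⁻¹ * (i * j)]) (by
      intro k
      fin_cases k
      · exact isIntegral_one
      · exact int _ _ hi
      · exact int _ _ hj
      · refine int _ (b * c) ?_
        push_cast at hi hj ⊢
        simp
        field_simp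
        linear_combination j ^ 2 * hi + a * b * hj)
  rw [discr_eq_of_basis e e0 e1 e2 e3 hi hj ha] at hm
  have hm' : 256 * (a * b * c) ^ 2 = m ^ 2 * NumberField.discr K := by exact_mod_cast hm
  have hpos : 0 < m ^ 2 * NumberField.discr K := by
    rw [← hm']
    positivity
  have hm0 : m ≠ 0 := by rintro rfl; simp at hpos
  have hm2 : 0 < m ^ 2 := by positivity
  have hd := pos_of_mul_pos_right hpos hm2.le
  refine ⟨?_, hd⟩
  rw [hm']
  exact le_mul_of_one_le_left hd.le hm2

/-- Lower bound for the discriminant of a biquadratic field. -/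
theorem IsKleinPair.le_discr {σ τ : K ≃ₐ[ℚ] K} (h : IsKleinPair σ τ) {i j : K} {a b c : ℤ}
    (hi0 : i ≠ 0) (hj0 : j ≠ 0) (si : σ i = i) (ti : τ i = -i) (sj : σ j = -j) (tj : τ j = j)
    (hi : i ^ 2 = (a * b : ℤ)) (hj : j ^ 2 = (a * c : ℤ)) (s₁ : Squarefree (a * b))
    (s₂ : Squarefree (a * c)) (s₃ : Squarefree (b * c)) :
    (a * b * c) ^ 2 ≤ 256 * NumberField.discr K := by
  obtain ⟨e, e0, e1, e2, e3⟩ := h.exists_basis hi0 hj0 si ti sj tj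
  have ha : a ≠ 0 := left_ne_zero_of_mul s₁.ne_zero
  have haK : (a : K) ≠ 0 := by exact_mod_cast ha
  set k : K := algebraMap ℚ K (a : ℚ)⁻¹ * (i * j) with hk
  have hk0 : k ≠ 0 := mul_ne_zero (by simpa using ha) (mul_ne_zero hi0 hj0)
  have sk : σ k = -k := by simp [hk, si, sj]
  have tk : τ k = -k := by simp [hk, ti, tj]
  have hk2 : k ^ 2 = (b * c : ℤ) := by
    push_cast at hi hj ⊢
    simp [hk]
    field_simp
    linear_combination j ^ 2 * hi + a * b * hj
  have comp : ∀ {w y : K} {d : ℤ}, w ≠ 0 → w ^ 2 = d → Squarefree d → IsIntegral ℤ y →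
      σ (y / w) = y / w → τ (y / w) = y / w → ∃ z : ℤ, y = z * w := by
    intro w y d hw hd sd hy h1 h2
    obtain ⟨q, hq⟩ := h.fixed _ h1 h2
    have hyq : y = algebraMap ℚ K q * w := by rw [hq, div_mul_cancel₀ _ hw]
    have : IsIntegral ℤ (algebraMap ℚ K (q ^ 2 * d)) := by
      have : algebraMap ℚ K (q ^ 2 * d) = y ^ 2 := by
        rw [hyq, mul_pow, hd]; simp
      rw [this]
      exact hy.pow 2
    obtain ⟨z, hz⟩ := exists_int_of_isIntegral this
    obtain ⟨m, rfl⟩ := exists_int_of_sq_mul sd hz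
    exact ⟨m, by rw [hyq]; simp⟩
  obtain ⟨m, hm⟩ := exists_mul_discr_eq_sq_mul e (v := ![1, i, j, k]) (N := 4) (by
    intro x hx
    have hs : IsIntegral ℤ (σ x) := hx.map (σ.toAlgHom.restrictScalars ℤ)
    have ht : IsIntegral ℤ (τ x) := hx.map (τ.toAlgHom.restrictScalars ℤ)
    have hst : IsIntegral ℤ (σ (τ x)) := ht.map (σ.toAlgHom.restrictScalars ℤ)
    obtain ⟨z0, h0⟩ := comp (w := 1) (d := 1) one_ne_zero (by simp) squarefree_one
      (((hx.add hs).add ht).add hst)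
      (by simp only [map_div₀, map_add, map_one, h.invol₁, h.comm]; ring)
      (by simp only [map_div₀, map_add, map_one, h.invol₂, h.comm]; ring)
    obtain ⟨z1, h1⟩ := comp hi0 hi s₁ (((hx.add hs).sub ht).sub hst)
      (by simp only [map_div₀, map_add, map_sub, h.invol₁, h.comm, si]; ring)
      (by simp only [map_div₀, map_add, map_sub, h.invol₂, h.comm, ti]; ring)
    obtain ⟨z2, h2⟩ := comp hj0 hj s₂ (((hx.sub hs).add ht).sub hst)
      (by simp only [map_div₀, map_add, map_sub, h.invol₁, h.comm, sj]; ring)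
      (by simp only [map_div₀, map_add, map_sub, h.invol₂, h.comm, tj]; ring)
    obtain ⟨z3, h3⟩ := comp hk0 hk2 s₃ (((hx.sub hs).sub ht).add hst)
      (by simp only [map_div₀, map_add, map_sub, h.invol₁, h.comm, sk]; ring)
      (by simp only [map_div₀, map_add, map_sub, h.invol₂, h.comm, tk]; ring)
    refine ⟨![z0, z1, z2, z3], ?_⟩
    simp only [Fin.sum_univ_four]
    simp
    linear_combination h0 + h1 + h2 + h3)
  rw [discr_eq_of_basis e e0 e1 e2 e3 hi hj ha] at hm
  have hm' : (4 ^ 4) ^ 2 * NumberField.discr K = m ^ 2 * (256 * (a * b * c) ^ 2) := by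
    exact_mod_cast hm
  have hb : b ≠ 0 := left_ne_zero_of_mul s₃.ne_zero
  have hc : c ≠ 0 := right_ne_zero_of_mul s₃.ne_zero
  have hpos := (discr_le_of_basis e e0 e1 e2 e3 hi hj ha hb hc).2
  have hm0 : m ≠ 0 := by
    rintro rfl
    rw [zero_pow two_ne_zero, zero_mul] at hm'
    have : (0 : ℤ) < (4 ^ 4) ^ 2 * NumberField.discr K := by positivity
    omega
  have hm2 : 0 < m ^ 2 := by positivity
  have : 256 * (a * b * c) ^ 2 ≤ m ^ 2 * (256 * (a * b * c) ^ 2) :=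
    le_mul_of_one_le_left (by positivity) hm2
  rw [← hm'] at this
  omega

end

end Discriminant

section Fields

open Module IntermediateField

lemma Squarefree.exists_isTwoUnit {z : ℤ} (sz : Squarefree z) (hz : 2 < z.natAbs) :
    ∃ (u : ℤ) (m : ℕ), IsTwoUnit u ∧ Odd m ∧ Squarefree m ∧ 1 < m ∧ z = u * m := by
  have sn : Squarefree z.natAbs := Int.squarefree_natAbs.2 sz
  rcases Nat.even_or_odd z.natAbs with he | ho
  · obtain ⟨m, hm⟩ := he.two_dvd
    have sm : Squarefree m := by rw [hm] at sn; exact sn.of_mul_right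
    have om : Odd m := by
      rw [← Nat.not_even_iff_odd]
      intro hme
      obtain ⟨k, hk⟩ := hme.two_dvd
      have := sn 2 ⟨k, by rw [hm, hk]; ring⟩
      rw [Nat.isUnit_iff] at this
      omega
    rcases Int.natAbs_eq z with h | h
    · exact ⟨2, m, by unfold IsTwoUnit; tauto, om, sm, by omega, by omega⟩
    · exact ⟨-2, m, by unfold IsTwoUnit; tauto, om, sm, by omega, by omega⟩
  · rcases Int.natAbs_eq z with h | h
    · exact ⟨1, z.natAbs, by unfold IsTwoUnit; tauto, ho, sn, by omega, by omega⟩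
    · exact ⟨-1, z.natAbs, by unfold IsTwoUnit; tauto, ho, sn, by omega, by omega⟩

/-- Every rational is a product of norms from the three quadratic subfields as soon as a single
odd prime has a non-cyclic decomposition group. -/
theorem normProd_of_jacobiSym {a b c : ℤ} {p : ℕ} (sa : Squarefree a) (sb : Squarefree b)
    (sc : Squarefree c) (hab : IsCoprime a b) (hac : IsCoprime a c) (hbc : IsCoprime b c)
    (ha : 2 < a.natAbs) (hb : 2 < b.natAbs) (hc : 2 < c.natAbs) (hp : p.Prime) (hp2 : p ≠ 2)
    (hpa : (p : ℤ) ∣ a) (hJ : jacobiSym (b * c) p = -1) {r : ℚ} (hr : r ≠ 0) :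
    NormProd a b c r := by
  obtain ⟨u₁, a, hu₁, oa, sqa, ga, rfl⟩ := sa.exists_isTwoUnit ha
  obtain ⟨u₂, b, hu₂, ob, sqb, gb, rfl⟩ := sb.exists_isTwoUnit hb
  obtain ⟨u₃, c, hu₃, oc, sqc, gc, rfl⟩ := sc.exists_isTwoUnit hc
  have h : Admissible u₁ u₂ u₃ a b c := ⟨hu₁, hu₂, hu₃, oa, ob, oc, sqa, sqb, sqc, ga, gb, gc,
    hab, hac, hbc⟩
  refine h.normProd ?_ hJ hr
  have hpZ := Nat.prime_iff_prime_int.1 hp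
  rcases hpZ.dvd_mul.1 hpa with h' | hpa
  · exfalso
    have h2 : (p : ℤ) ∣ 2 := by
      rcases hu₁ with rfl | rfl | rfl | rfl
      · exact h'.trans (one_dvd _)
      · exact h'.trans ⟨-2, rfl⟩
      · exact h'
      · exact h'.trans ⟨-1, rfl⟩
    have : p ∣ 2 := by exact_mod_cast h2
    exact hp2 ((Nat.prime_dvd_prime_iff_eq hp Nat.prime_two).1 this)
  · exact_mod_cast hpa

/-- The field `ℚ(√d₁, √d₂)` inside a fixed algebraic closure. -/
noncomputable def biquadField (d₁ d₂ : ℤ) : IntermediateField ℚ (AlgebraicClosure ℚ) :=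
  adjoin ℚ {x | x ^ 2 = d₁ ∨ x ^ 2 = d₂}

lemma biquadDiscr_eq (K : IntermediateField ℚ (AlgebraicClosure ℚ)) [h : NumberField K] :
    biquadDiscr K = NumberField.discr K := by
  unfold biquadDiscr
  rw [dif_pos h.to_finiteDimensional]

lemma Squarefree.int_mul {a b : ℤ} (h : IsCoprime a b) (ha : Squarefree a) (hb : Squarefree b) :
    Squarefree (a * b) := (squarefree_mul_iff).2 ⟨h.isRelPrime, ha, hb⟩

/-- Parametrization of the biquadratic fields, with a sufficient condition for the Hasse norm
principle. -/
theorem IsBiquadratic.exists_eq_biquadField {K : IntermediateField ℚ (AlgebraicClosure ℚ)}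
    (hK : IsBiquadratic K) :
    ∃ (a b c : ℕ) (β γ : ℤ), (β = 1 ∨ β = -1) ∧ (γ = 1 ∨ γ = -1) ∧ 0 < a ∧ 0 < b ∧ 0 < c ∧
      K = biquadField (a * (β * b)) (a * (γ * c)) ∧
      ((a * b * c : ℕ) : ℤ) ^ 2 ≤ 256 * biquadDiscr K ∧
      (2 < a → 2 < b → 2 < c → ∀ (p : ℕ) [Fact p.Prime], p ≠ 2 → (a : ZMod p) = 0 →
        quadraticChar (ZMod p) (((β * γ : ℤ) : ZMod p) * b * c) = -1 →
        HasseNormPrinciple K) := by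
  obtain ⟨fd, gal, ⟨f⟩⟩ := hK
  have : NumberField K := ⟨⟩
  obtain ⟨σ, τ, h⟩ := exists_isKleinPair f
  obtain ⟨a, b, c, i, j, ha, sa, sb, sc, hab, hac, hbc, hi0, hj0, hi, hj, si, ti, sj, tj⟩ :=
    h.exists_sqrt
  obtain ⟨e, e0, e1, e2, e3⟩ := h.exists_basis hi0 hj0 si ti sj tj
  have sab := Squarefree.int_mul hab sa sb
  have sac := Squarefree.int_mul hac sa sc
  have sbc := Squarefree.int_mul hbc sb sc
  have sgn : ∀ z : ℤ, ∃ β : ℤ, (β = 1 ∨ β = -1) ∧ z = β * (z.natAbs : ℤ) := by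
    intro z
    rcases Int.natAbs_eq z with h | h
    · exact ⟨1, Or.inl rfl, by omega⟩
    · exact ⟨-1, Or.inr rfl, by omega⟩
  obtain ⟨β, hβ, hbβ⟩ := sgn b
  obtain ⟨γ, hγ, hcγ⟩ := sgn c
  have haa : (a.natAbs : ℤ) = a := Int.natAbs_of_nonneg ha.le
  refine ⟨a.natAbs, b.natAbs, c.natAbs, β, γ, hβ, hγ, Int.natAbs_pos.2 ha.ne',
    Int.natAbs_pos.2 sb.ne_zero, Int.natAbs_pos.2 sc.ne_zero, ?_, ?_, ?_⟩
  · rw [← hbβ, ← hcγ, haa]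
    have ci : (i : AlgebraicClosure ℚ) ^ 2 = (a * b : ℤ) := by
      have := congrArg (algebraMap K (AlgebraicClosure ℚ)) hi
      rwa [map_pow, map_intCast] at this
    have cj : (j : AlgebraicClosure ℚ) ^ 2 = (a * c : ℤ) := by
      have := congrArg (algebraMap K (AlgebraicClosure ℚ)) hj
      rwa [map_pow, map_intCast] at this
    apply le_antisymm
    · intro x hx
      have hii : (i : AlgebraicClosure ℚ) ∈ biquadField (a * b) (a * c) :=
        subset_adjoin _ _ (Or.inl ci)
      have hjj : (j : AlgebraicClosure ℚ) ∈ biquadField (a * b) (a * c) :=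
        subset_adjoin _ _ (Or.inr cj)
      have hs := congrArg (algebraMap K (AlgebraicClosure ℚ)) (e.sum_repr ⟨x, hx⟩)
      simp only [Fin.sum_univ_four, e0, e1, e2, e3, Algebra.smul_def, map_add, map_mul,
        map_one] at hs
      have hx' : x = algebraMap K (AlgebraicClosure ℚ) ⟨x, hx⟩ := rfl
      rw [hx', ← hs]
      have hq : ∀ q : ℚ, algebraMap K (AlgebraicClosure ℚ) (algebraMap ℚ K q) ∈
          biquadField (a * b) (a * c) := fun q => by
        rw [← IsScalarTower.algebraMap_apply ℚ K (AlgebraicClosure ℚ)]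
        exact IntermediateField.algebraMap_mem _ _
      exact add_mem (add_mem (add_mem (mul_mem (hq _) (one_mem _)) (mul_mem (hq _) hii))
        (mul_mem (hq _) hjj)) (mul_mem (hq _) (mul_mem hii hjj))
    · refine adjoin_le_iff.2 ?_
      rintro x (hx | hx)
      · rw [← ci] at hx
        rcases sq_eq_sq_iff_eq_or_eq_neg.1 hx with rfl | rfl
        · exact i.2
        · exact neg_mem i.2
      · rw [← cj] at hx
        rcases sq_eq_sq_iff_eq_or_eq_neg.1 hx with rfl | rfl
        · exact j.2
        · exact neg_mem j.2
  · rw [biquadDiscr_eq]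
    refine le_trans (le_of_eq ?_) (h.le_discr hi0 hj0 si ti sj tj hi hj sab sac sbc)
    rw [← Int.natAbs_mul, ← Int.natAbs_mul, Int.natAbs_sq]
  · intro ga gb gc p hp hp2 hpa hJ
    refine hasseNormPrinciple_of_normProd e e0 e1 e2 e3 hi hj sab sac fun r hr => ?_
    refine normProd_of_jacobiSym sa sb sc hab hac hbc ga gb gc hp.out hp2 ?_ ?_ hr
    · rw [← haa]
      exact_mod_cast (ZMod.natCast_eq_zero_iff _ _).1 hpa
    · rw [← jacobiSym.legendreSym.to_jacobiSym, legendreSym, ← hJ]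
      congr 1
      rw [hbβ, hcγ]
      push_cast [Int.natAbs_mul]
      rcases hβ with rfl | rfl <;> rcases hγ with rfl | rfl <;> simp

end Fields

section GoodTriples

open Module IntermediateField

/-- Triples of pairwise coprime squarefree natural numbers. -/
structure IsGoodTriple (a b c : ℕ) : Prop where
  sq₁ : Squarefree a
  sq₂ : Squarefree b
  sq₃ : Squarefree c
  cop₁₂ : a.Coprime b
  cop₁₃ : a.Coprime c
  cop₂₃ : b.Coprime c

lemma Squarefree.sq_ne_natCast {d : ℕ} (sd : Squarefree d) (h1 : d ≠ 1) (q : ℚ) : q ^ 2 ≠ d := by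
  intro h
  have : IsSquare (d : ℚ) := ⟨q, by rw [← h, sq]⟩
  rw [Rat.isSquare_natCast_iff] at this
  obtain ⟨m, rfl⟩ := this
  have := Nat.isUnit_iff.1 (sd m dvd_rfl)
  subst this
  exact h1 rfl

lemma linearIndependent_sqrt_aux {K : Type*} [Field K] [Algebra ℚ K] {i : K} {D : ℚ}
    (hi : i ^ 2 = algebraMap ℚ K D) (hD : ∀ q : ℚ, q ^ 2 ≠ D) {x y : ℚ}
    (h : algebraMap ℚ K x + algebraMap ℚ K y * i = 0) : x = 0 ∧ y = 0 := by
  have inj := (algebraMap ℚ K).injective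
  have hy : y = 0 := by
    by_contra hy
    have : x ^ 2 = y ^ 2 * D := by
      apply inj
      rw [map_mul, map_pow, map_pow, ← hi]
      linear_combination (algebraMap ℚ K x - algebraMap ℚ K y * i) * h
    refine hD (x / y) ?_
    field_simp
    linear_combination this
  subst hy
  rw [map_zero, zero_mul, add_zero, map_eq_zero] at h
  exact ⟨h, rfl⟩

lemma linearIndependent_sqrt {K : Type*} [Field K] [Algebra ℚ K] {i j : K} {D E : ℚ}
    (hi : i ^ 2 = algebraMap ℚ K D) (hj : j ^ 2 = algebraMap ℚ K E)
    (hD : ∀ q : ℚ, q ^ 2 ≠ D) (hE : ∀ q : ℚ, q ^ 2 ≠ E) (hDE : ∀ q : ℚ, q ^ 2 ≠ D * E) :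
    LinearIndependent ℚ ![1, i, j, i * j] := by
  rw [Fintype.linearIndependent_iff]
  intro g hg
  obtain ⟨w, hw⟩ : ∃ w, w = g 0 := ⟨_, rfl⟩
  obtain ⟨x, hx⟩ : ∃ w, w = g 1 := ⟨_, rfl⟩
  obtain ⟨y, hy⟩ : ∃ w, w = g 2 := ⟨_, rfl⟩
  obtain ⟨z, hz⟩ : ∃ w, w = g 3 := ⟨_, rfl⟩
  have e : algebraMap ℚ K w + algebraMap ℚ K x * i + algebraMap ℚ K y * j +
      algebraMap ℚ K z * (i * j) = 0 := by
    rw [← hg, hw, hx, hy, hz]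
    simp [Fin.sum_univ_four, Algebra.smul_def]
  have yz : y = 0 ∧ z = 0 := by
    by_contra hne
    have n0 : y ^ 2 - D * z ^ 2 ≠ 0 := by
      intro h
      refine hne (linearIndependent_sqrt_aux hi hD (x := y) (y := z) ?_)
      by_contra hp
      have hz0 : z = 0 := by
        by_contra hz0
        refine hD (y / z) ?_
        field_simp
        linear_combination h
      rw [hz0] at h
      have : y = 0 := by simpa using h
      exact hne ⟨this, hz0⟩
    have h2 := linearIndependent_sqrt_aux hi hD
      (x := (w * y - D * x * z) ^ 2 + (x * y - w * z) ^ 2 * D - E * (y ^ 2 - D * z ^ 2) ^ 2)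
      (y := 2 * ((w * y - D * x * z) * (x * y - w * z))) (by
        simp only [map_add, map_sub, map_mul, map_pow, map_ofNat, ← hi, ← hj]
        linear_combination (algebraMap ℚ K y - algebraMap ℚ K z * i) ^ 2 *
          (algebraMap ℚ K w + algebraMap ℚ K x * i - algebraMap ℚ K y * j -
            algebraMap ℚ K z * (i * j)) * e)
    obtain ⟨h3, h4⟩ := h2
    have h5 : w * y - D * x * z = 0 ∨ x * y - w * z = 0 := by
      rcases mul_eq_zero.1 h4 with h | h
      · norm_num at h
      · exact mul_eq_zero.1 h
    rcases h5 with h5 | h5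
    · refine hDE (D * (x * y - w * z) / (y ^ 2 - D * z ^ 2)) ?_
      rw [h5] at h3
      rw [div_pow, div_eq_iff (pow_ne_zero 2 n0)]
      linear_combination D * h3
    · refine hE ((w * y - D * x * z) / (y ^ 2 - D * z ^ 2)) ?_
      rw [h5] at h3
      rw [div_pow, div_eq_iff (pow_ne_zero 2 n0)]
      linear_combination h3
  obtain ⟨y0, z0⟩ := yz
  rw [y0, z0, map_zero, zero_mul, zero_mul, add_zero, add_zero] at e
  obtain ⟨w0, x0⟩ := linearIndependent_sqrt_aux hi hD e
  intro k
  fin_cases k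
  · exact hw.symm.trans w0
  · exact hx.symm.trans x0
  · exact hy.symm.trans y0
  · exact hz.symm.trans z0

/-- The algebra structure of `ℚ̄` over `ℚ` coming from characteristic zero is algebraic. -/
instance isAlgebraic_algebraicClosure_rat : Algebra.IsAlgebraic ℚ (AlgebraicClosure ℚ) := by
  have h : (DivisionRing.toRatAlgebra : Algebra ℚ (AlgebraicClosure ℚ)) =
      AlgebraicClosure.instAlgebra ℚ := Subsingleton.elim _ _
  rw [h]
  exact AlgebraicClosure.isAlgebraic ℚ

instance isAlgClosure_algebraicClosure_rat : IsAlgClosure ℚ (AlgebraicClosure ℚ) where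
  isAlgClosed := inferInstance
  isAlgebraic := inferInstance

lemma biquadField_map_le (d₁ d₂ : ℤ)
    (σ : AlgebraicClosure ℚ →ₐ[ℚ] AlgebraicClosure ℚ) :
    (biquadField d₁ d₂).map σ ≤ biquadField d₁ d₂ := by
  unfold biquadField
  rw [adjoin_map]
  apply adjoin.mono
  rintro _ ⟨x, hx, rfl⟩
  rcases hx with hx | hx
  · left
    rw [← map_pow, hx, map_intCast]
  · right
    rw [← map_pow, hx, map_intCast]

lemma finiteDimensional_biquadField (d₁ d₂ : ℤ) :
    FiniteDimensional ℚ (biquadField d₁ d₂) := by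
  have fin : ∀ d : ℤ, {x : AlgebraicClosure ℚ | x ^ 2 = d}.Finite := by
    intro d
    obtain ⟨i, hi⟩ := IsAlgClosed.exists_pow_nat_eq (d : AlgebraicClosure ℚ) two_pos
    refine (Set.toFinite {i, -i}).subset fun x hx => ?_
    exact sq_eq_sq_iff_eq_or_eq_neg.1 (hx.trans hi.symm)
  have : Finite {x : AlgebraicClosure ℚ | x ^ 2 = d₁ ∨ x ^ 2 = d₂} :=
    ((fin d₁).union (fin d₂)).to_subtype
  exact finiteDimensional_adjoin fun x _ => Algebra.IsIntegral.isIntegral x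

lemma isGalois_biquadField (d₁ d₂ : ℤ) : IsGalois ℚ (biquadField d₁ d₂) := by
  have : Normal ℚ (AlgebraicClosure ℚ) := IsAlgClosure.normal ℚ _
  have : Normal ℚ (biquadField d₁ d₂) :=
    normal_iff_forall_map_le.2 (biquadField_map_le d₁ d₂)
  exact ⟨⟩

lemma biquadField_algEquiv_ext {d₁ d₂ : ℤ} {i j : biquadField d₁ d₂} (hi : i ^ 2 = d₁)
    (hj : j ^ 2 = d₂) {σ τ : biquadField d₁ d₂ ≃ₐ[ℚ] biquadField d₁ d₂} (h1 : σ i = τ i)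
    (h2 : σ j = τ j) : σ = τ := by
  have key : (σ : biquadField d₁ d₂ →ₐ[ℚ] biquadField d₁ d₂) = τ := by
    refine algHom_ext_of_eq_adjoin ℚ (S := biquadField d₁ d₂)
      (s := {x | x ^ 2 = (d₁ : AlgebraicClosure ℚ) ∨ x ^ 2 = d₂}) rfl ?_
    intro x hxS
    have hx : x ∈ biquadField d₁ d₂ := subset_adjoin _ _ hxS
    have e : ∀ {d : ℤ} {k : biquadField d₁ d₂}, k ^ 2 = d → x ^ 2 = (d : AlgebraicClosure ℚ) →
        (⟨x, hx⟩ : biquadField d₁ d₂) = k ∨ (⟨x, hx⟩ : biquadField d₁ d₂) = -k := by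
      intro d k hk hxd
      refine sq_eq_sq_iff_eq_or_eq_neg.1 ?_
      rw [hk]
      apply Subtype.ext
      rw [SubmonoidClass.mk_pow]
      exact hxd.trans (by simp)
    rcases hxS with hxS | hxS
    · rcases e hi hxS with h | h
      · simp only [h]; exact h1
      · simp only [h]
        exact (map_neg σ i).trans ((congrArg Neg.neg h1).trans (map_neg τ i).symm)
    · rcases e hj hxS with h | h
      · simp only [h]; exact h2
      · simp only [h]
        exact (map_neg σ j).trans ((congrArg Neg.neg h2).trans (map_neg τ j).symm)
  exact AlgEquiv.coe_toAlgHom_injective key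

theorem IsGoodTriple.isBiquadratic {a b c : ℕ} (h : IsGoodTriple a b c) (hab : a * b ≠ 1)
    (hac : a * c ≠ 1) (hbc : b * c ≠ 1) :
    IsBiquadratic (biquadField (a * b : ℕ) (a * c : ℕ)) ∧
      biquadDiscr (biquadField (a * b : ℕ) (a * c : ℕ)) ≤ 256 * ((a * b * c : ℕ) : ℤ) ^ 2 := by
  have fd := finiteDimensional_biquadField (a * b : ℕ) (a * c : ℕ)
  have gal := isGalois_biquadField (a * b : ℕ) (a * c : ℕ)
  obtain ⟨i', hi'⟩ := IsAlgClosed.exists_pow_nat_eq ((a * b : ℕ) : AlgebraicClosure ℚ) two_pos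
  obtain ⟨j', hj'⟩ := IsAlgClosed.exists_pow_nat_eq ((a * c : ℕ) : AlgebraicClosure ℚ) two_pos
  obtain ⟨i, hi⟩ : ∃ i : biquadField (a * b : ℕ) (a * c : ℕ), i ^ 2 = ((a * b : ℕ) : ℤ) :=
    ⟨⟨i', subset_adjoin _ _ (Or.inl (by simpa using hi'))⟩, by
      apply Subtype.ext; simpa using hi'⟩
  obtain ⟨j, hj⟩ : ∃ i : biquadField (a * b : ℕ) (a * c : ℕ), i ^ 2 = ((a * c : ℕ) : ℤ) :=
    ⟨⟨j', subset_adjoin _ _ (Or.inr (by simpa using hj'))⟩, by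
      apply Subtype.ext; simpa using hj'⟩
  generalize hL : biquadField (a * b : ℕ) (a * c : ℕ) = L at *
  have sab : Squarefree (a * b) := (Nat.squarefree_mul h.cop₁₂).2 ⟨h.sq₁, h.sq₂⟩
  have sac : Squarefree (a * c) := (Nat.squarefree_mul h.cop₁₃).2 ⟨h.sq₁, h.sq₃⟩
  have sbc : Squarefree (b * c) := (Nat.squarefree_mul h.cop₂₃).2 ⟨h.sq₂, h.sq₃⟩
  have a0 : a ≠ 0 := h.sq₁.ne_zero
  have li : LinearIndependent ℚ ![1, i, j, i * j] := by
    refine linearIndependent_sqrt (D := ((a * b : ℕ) : ℚ)) (E := ((a * c : ℕ) : ℚ)) ?_ ?_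
      (sab.sq_ne_natCast hab) (sac.sq_ne_natCast hac) ?_
    · rw [hi, map_natCast, Int.cast_natCast]
    · rw [hj, map_natCast, Int.cast_natCast]
    · intro q hq
      refine sbc.sq_ne_natCast hbc (q / a) ?_
      have : (a : ℚ) ≠ 0 := by exact_mod_cast a0
      rw [div_pow, hq]
      push_cast
      field_simp
  have inv : ∀ (k : L) (d : ℤ), k ^ 2 = d → ∀ σ : L ≃ₐ[ℚ] L, σ k = k ∨ σ k = -k := by
    intro k d hk σ
    refine sq_eq_sq_iff_eq_or_eq_neg.1 ?_
    rw [← map_pow, hk, map_intCast]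
  have ext : ∀ σ τ : L ≃ₐ[ℚ] L, σ i = τ i → σ j = τ j → σ = τ := by
    subst hL
    intro σ τ h1 h2
    exact biquadField_algEquiv_ext hi hj h1 h2
  have le4 : Nat.card (L ≃ₐ[ℚ] L) ≤ 4 := by
    have inj : Function.Injective fun σ : L ≃ₐ[ℚ] L => (decide (σ i = i), decide (σ j = j)) := by
      intro σ τ hst
      simp only [Prod.mk.injEq, decide_eq_decide] at hst
      refine ext σ τ ?_ ?_
      · rcases inv i _ hi σ with h1 | h1
        · rw [h1, hst.1.1 h1]
        · rcases inv i _ hi τ with h2 | h2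
          · rw [h2, hst.1.2 h2]
          · rw [h1, h2]
      · rcases inv j _ hj σ with h1 | h1
        · rw [h1, hst.2.1 h1]
        · rcases inv j _ hj τ with h2 | h2
          · rw [h2, hst.2.2 h2]
          · rw [h1, h2]
    have := Nat.card_le_card_of_injective _ inj
    simpa using this
  have cardeq : Nat.card (L ≃ₐ[ℚ] L) = finrank ℚ L := IsGalois.card_aut_eq_finrank ℚ L
  have ge4 : 4 ≤ finrank ℚ L := by
    have := li.fintype_card_le_finrank
    simpa using this
  have fr : finrank ℚ L = 4 := by omega
  refine ⟨⟨fd, gal, ?_⟩, ?_⟩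
  · have : IsKleinFour (L ≃ₐ[ℚ] L) := by
      refine ⟨by omega, ?_⟩
      have h2 : Monoid.exponent (L ≃ₐ[ℚ] L) ∣ 2 := by
        refine Monoid.exponent_dvd_of_forall_pow_eq_one fun σ => ?_
        refine ext _ _ ?_ ?_
        · rw [sq, AlgEquiv.mul_apply, AlgEquiv.one_apply]
          rcases inv i _ hi σ with h1 | h1 <;> simp [h1]
        · rw [sq, AlgEquiv.mul_apply, AlgEquiv.one_apply]
          rcases inv j _ hj σ with h1 | h1 <;> simp [h1]
      rcases (Nat.dvd_prime Nat.prime_two).1 h2 with h1 | h1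
      · rw [Monoid.exp_eq_one_iff] at h1
        have := Nat.card_of_subsingleton (1 : L ≃ₐ[ℚ] L)
        omega
      · exact h1
    exact IsKleinFour.nonempty_mulEquiv
  · have : NumberField L := ⟨⟩
    rw [biquadDiscr_eq]
    set e := basisOfLinearIndependentOfCardEqFinrank li (by simp [fr]) with he
    have hv : ⇑e = ![1, i, j, i * j] := coe_basisOfLinearIndependentOfCardEqFinrank li _
    refine le_trans (discr_le_of_basis (a := a) (b := b) (c := c) e (i := i) (j := j)
      (by rw [hv]; rfl) (by rw [hv]; rfl) (by rw [hv]; rfl) (by rw [hv]; rfl)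
      (by rw [hi]; push_cast; rfl) (by rw [hj]; push_cast; rfl) (by exact_mod_cast a0)
      (by exact_mod_cast h.sq₂.ne_zero) (by exact_mod_cast h.sq₃.ne_zero)).1 ?_
    push_cast
    exact le_rfl

/-- Squarefree natural numbers with square roots in a biquadratic field are separated by the signs
of the Galois action. -/
lemma IsKleinPair.eq_of_sign {K : Type*} [Field K] [Algebra ℚ K] {σ τ : K ≃ₐ[ℚ] K}
    (h : IsKleinPair σ τ) {d d' : ℕ} (sd : Squarefree d) (sd' : Squarefree d') {y y' : K}
    (hy : y ^ 2 = d) (hy' : y' ^ 2 = d')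
    (h1 : (∃ z : K, z ^ 2 = d ∧ σ z = z) ↔ ∃ z : K, z ^ 2 = d' ∧ σ z = z)
    (h2 : (∃ z : K, z ^ 2 = d ∧ τ z = z) ↔ ∃ z : K, z ^ 2 = d' ∧ τ z = z) : d = d' := by
  have : CharZero K := charZero_of_injective_algebraMap (algebraMap ℚ K).injective
  have key : ∀ ρ : K ≃ₐ[ℚ] K,
      ((∃ z : K, z ^ 2 = d ∧ ρ z = z) ↔ ∃ z : K, z ^ 2 = d' ∧ ρ z = z) →
      ρ (y / y') = y / y' := by
    intro ρ hρ
    have iff : ∀ {d : ℕ} {y : K}, y ^ 2 = d → ((∃ z : K, z ^ 2 = d ∧ ρ z = z) ↔ ρ y = y) := by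
      intro d y hy
      refine ⟨?_, fun hr => ⟨y, hy, hr⟩⟩
      rintro ⟨z, hz, hr⟩
      rcases sq_eq_sq_iff_eq_or_eq_neg.1 (hz.trans hy.symm) with rfl | rfl
      · exact hr
      · simpa using hr
    have sg : ∀ {d : ℕ} {y : K}, y ^ 2 = d → ρ y = y ∨ ρ y = -y := by
      intro d y hy
      refine sq_eq_sq_iff_eq_or_eq_neg.1 ?_
      rw [← map_pow, hy, map_natCast]
    rw [iff hy, iff hy'] at hρ
    rw [map_div₀]
    by_cases hc : ρ y = y
    · rw [hc, hρ.1 hc]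
    · rw [(sg hy).resolve_left hc, (sg hy').resolve_left fun h => hc (hρ.2 h), neg_div_neg_eq]
  obtain ⟨q, hq⟩ := h.fixed _ (key σ h1) (key τ h2)
  have d0 : (d' : K) ≠ 0 := by exact_mod_cast sd'.ne_zero
  have y0 : y' ≠ 0 := by
    rintro rfl
    exact d0 (by rw [← hy']; ring)
  have e : q ^ 2 * (d' : ℚ) = d := by
    apply (algebraMap ℚ K).injective
    rw [map_mul, map_pow, hq, map_natCast, map_natCast, ← hy, ← hy']
    field_simp
  obtain ⟨m, rfl⟩ := exists_int_of_sq_mul (d := d') (z := d)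
    (Int.squarefree_natCast.2 sd') (by exact_mod_cast e)
  have e' : m ^ 2 * (d' : ℤ) = d := by exact_mod_cast e
  have hu := (Int.squarefree_natCast.2 sd) m ⟨d', by rw [← e']; ring⟩
  have : m ^ 2 = 1 := by
    rcases Int.isUnit_iff.1 hu with rfl | rfl <;> rfl
  rw [this, one_mul] at e'
  exact_mod_cast e'.symm

end GoodTriples

section FieldCounting

open Finset

/-- Triples of positive integers with product at most `Y`. -/
def triples (Y : ℕ) : Finset (ℕ × ℕ × ℕ) :=
  {t ∈ Icc 1 Y ×ˢ Icc 1 Y ×ˢ Icc 1 Y | t.1 * t.2.1 * t.2.2 ≤ Y}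

lemma mem_triples {Y a b c : ℕ} :
    (a, b, c) ∈ triples Y ↔ 0 < a ∧ 0 < b ∧ 0 < c ∧ a * b * c ≤ Y := by
  simp only [triples, mem_filter, mem_product, mem_Icc]
  refine ⟨fun h => ⟨h.1.1.1, h.1.2.1.1, h.1.2.2.1, h.2⟩, ?_⟩
  rintro ⟨ha, hb, hc, h⟩
  have h1 : a ≤ a * b * c := by
    rw [mul_assoc]; exact Nat.le_mul_of_pos_right _ (Nat.mul_pos hb hc)
  have h2 : b ≤ a * b * c := by
    rw [mul_comm a, mul_assoc]; exact Nat.le_mul_of_pos_right _ (Nat.mul_pos ha hc)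
  have h3 : c ≤ a * b * c := Nat.le_mul_of_pos_left _ (Nat.mul_pos ha hb)
  exact ⟨⟨⟨ha, by omega⟩, ⟨hb, by omega⟩, hc, by omega⟩, h⟩

/-- No odd prime forces the Hasse norm principle for the triple `(a, b, c)`, where `e` is the sign
of the product of the last two entries. -/
def IsUnobstructed (e : ℤ) (t : ℕ × ℕ × ℕ) : Prop :=
  2 < t.1 → 2 < t.2.1 → 2 < t.2.2 → ∀ (p : ℕ) [Fact p.Prime], p ≠ 2 → (t.1 : ZMod p) = 0 →
    quadraticChar (ZMod p) ((e : ZMod p) * t.2.1 * t.2.2) ≠ -1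

lemma exists_mem_triples {K : IntermediateField ℚ (AlgebraicClosure ℚ)} {X : ℝ}
    (hK : IsBiquadratic K) (hX : (biquadDiscr K : ℝ) ≤ X) :
    ∃ s ∈ ({1, -1} ×ˢ {1, -1} : Finset (ℤ × ℤ)), ∃ t ∈ triples ⌊16 * √X⌋₊,
      K = biquadField (t.1 * (s.1 * t.2.1)) (t.1 * (s.2 * t.2.2)) ∧
      (¬ HasseNormPrinciple K → IsUnobstructed (s.1 * s.2) t) := by
  obtain ⟨a, b, c, β, γ, hβ, hγ, ha, hb, hc, rfl, hD, hH⟩ := hK.exists_eq_biquadField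
  refine ⟨(β, γ), by simp [hβ, hγ], (a, b, c), mem_triples.2 ⟨ha, hb, hc, ?_⟩, rfl, ?_⟩
  · refine Nat.le_floor ?_
    refine le_of_sq_le_sq ?_ (by positivity)
    have h1 : ((a * b * c : ℕ) : ℝ) ^ 2 ≤ 256 * X := by
      refine le_trans ?_ (mul_le_mul_of_nonneg_left hX (by norm_num))
      exact_mod_cast hD
    have hX0 : 0 ≤ X := by
      have := sq_nonneg ((a * b * c : ℕ) : ℝ)
      linarith
    rw [mul_pow, Real.sq_sqrt hX0]
    linarith
  · intro hn h1 h2 h3 p hp hp2 h4 h5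
    exact hn (hH h1 h2 h3 p hp2 h4 (by simpa using h5))

lemma finite_biquadratic (X : ℝ) :
    {K : IntermediateField ℚ (AlgebraicClosure ℚ) |
      IsBiquadratic K ∧ (biquadDiscr K : ℝ) ≤ X}.Finite := by
  refine (({1, -1} ×ˢ {1, -1} : Finset (ℤ × ℤ)).biUnion fun s => (triples ⌊16 * √X⌋₊).image
    fun t => biquadField (t.1 * (s.1 * t.2.1)) (t.1 * (s.2 * t.2.2))).finite_toSet.subset ?_
  rintro K ⟨hK, hX⟩
  obtain ⟨s, hs, t, ht, rfl, -⟩ := exists_mem_triples hK hX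
  exact mem_coe.2 (mem_biUnion.2 ⟨s, hs, mem_image_of_mem _ ht⟩)

theorem biquadHNPFailCount_le (X : ℝ) :
    biquadHNPFailCount X ≤
      2 * (#{t ∈ triples ⌊16 * √X⌋₊ | IsUnobstructed 1 t} +
        #{t ∈ triples ⌊16 * √X⌋₊ | IsUnobstructed (-1) t}) := by
  have sub : {K : IntermediateField ℚ (AlgebraicClosure ℚ) |
      IsBiquadratic K ∧ (biquadDiscr K : ℝ) ≤ X ∧ ¬HasseNormPrinciple K} ⊆
      ((({1, -1} ×ˢ {1, -1} : Finset (ℤ × ℤ)).biUnion fun s =>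
        ({t ∈ triples ⌊16 * √X⌋₊ | IsUnobstructed (s.1 * s.2) t}).image
        fun t => biquadField (t.1 * (s.1 * t.2.1)) (t.1 * (s.2 * t.2.2)) : Finset _) :
        Set (IntermediateField ℚ (AlgebraicClosure ℚ))) := by
    rintro K ⟨hK, hX, hn⟩
    obtain ⟨s, hs, t, ht, rfl, h⟩ := exists_mem_triples hK hX
    exact mem_coe.2 (mem_biUnion.2 ⟨s, hs, mem_image_of_mem _ (mem_filter.2 ⟨ht, h hn⟩)⟩)
  refine (Set.ncard_le_ncard sub (finite_toSet _)).trans ?_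
  rw [Set.ncard_coe_finset]
  refine card_biUnion_le.trans ((sum_le_sum fun s _ => card_image_le).trans (le_of_eq ?_))
  rw [sum_product]
  simp only [sum_insert (show (1 : ℤ) ∉ ({-1} : Finset ℤ) by decide), sum_singleton]
  norm_num
  ring

lemma card_filter_mul_eq_one_le (Z : ℕ) :
    #{t ∈ triples Z | t.1 * t.2.1 = 1 ∨ t.1 * t.2.2 = 1 ∨ t.2.1 * t.2.2 = 1} ≤ 3 * Z := by
  have sub : {t ∈ triples Z | t.1 * t.2.1 = 1 ∨ t.1 * t.2.2 = 1 ∨ t.2.1 * t.2.2 = 1} ⊆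
      (Icc 1 Z).image (fun n => (1, 1, n)) ∪ (Icc 1 Z).image (fun n => (1, n, 1)) ∪
        (Icc 1 Z).image (fun n => (n, 1, 1)) := by
    rintro ⟨a, b, c⟩ h
    rw [mem_filter, mem_triples] at h
    obtain ⟨⟨ha, hb, hc, h⟩, h'⟩ := h
    simp only [mul_eq_one] at h'
    simp only [mem_union, mem_image, mem_Icc, Prod.mk.injEq]
    rcases h' with ⟨rfl, rfl⟩ | ⟨rfl, rfl⟩ | ⟨rfl, rfl⟩
    · exact Or.inl (Or.inl ⟨c, ⟨hc, by simpa using h⟩, rfl, rfl, rfl⟩)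
    · exact Or.inl (Or.inr ⟨b, ⟨hb, by simpa using h⟩, rfl, rfl, rfl⟩)
    · exact Or.inr ⟨a, ⟨ha, by simpa using h⟩, rfl, rfl, rfl⟩
  have h0 := (card_le_card sub).trans (card_union_le _ _)
  have h0' := card_union_le ((Icc 1 Z).image fun n => ((1, 1, n) : ℕ × ℕ × ℕ))
    ((Icc 1 Z).image fun n => (1, n, 1))
  have hc : ∀ f : ℕ → ℕ × ℕ × ℕ, #((Icc 1 Z).image f) ≤ Z := fun f =>
    card_image_le.trans (by simp)
  have h1 := hc fun n => (1, 1, n)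
  have h2 := hc fun n => (1, n, 1)
  have h3 := hc fun n => (n, 1, 1)
  omega

/-- A biquadratic field arises from at most sixteen good triples. -/
lemma card_fiber_le {K : IntermediateField ℚ (AlgebraicClosure ℚ)} (hK : IsBiquadratic K)
    (s : Finset (ℕ × ℕ × ℕ)) (hs : ∀ t ∈ s, IsGoodTriple t.1 t.2.1 t.2.2 ∧
      biquadField (t.1 * t.2.1 : ℕ) (t.1 * t.2.2 : ℕ) = K) : #s ≤ 16 := by
  obtain ⟨fd, gal, ⟨f⟩⟩ := hK
  obtain ⟨σ, τ, h⟩ := exists_isKleinPair f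
  obtain ⟨sg, hsg⟩ : ∃ sg : ℕ → Bool × Bool, ∀ d, sg d =
    (decide (∃ z : K, z ^ 2 = d ∧ σ z = z), decide (∃ z : K, z ^ 2 = d ∧ τ z = z)) :=
    ⟨_, fun _ => rfl⟩
  have sqrt : ∀ (d : ℕ) (d₁ d₂ : ℤ), (d = d₁ ∨ d = d₂) → biquadField d₁ d₂ = K →
      ∃ y : K, y ^ 2 = d := by
    intro d d₁ d₂ hd hE
    obtain ⟨y, hy⟩ := IsAlgClosed.exists_pow_nat_eq (d : AlgebraicClosure ℚ) two_pos
    have hy' : y ^ 2 = ((d : ℤ) : AlgebraicClosure ℚ) := by rw [hy, Int.cast_natCast]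
    refine ⟨⟨y, ?_⟩, Subtype.ext (by simpa using hy)⟩
    rw [← hE]
    refine IntermediateField.subset_adjoin _ _ ?_
    rcases hd with hd | hd
    · left; rw [← hd]; exact hy'
    · right; rw [← hd]; exact hy'
  have inj : ∀ t ∈ s, ∀ t' ∈ s, (sg (t.1 * t.2.1), sg (t.1 * t.2.2)) =
      (sg (t'.1 * t'.2.1), sg (t'.1 * t'.2.2)) → t = t' := by
    rintro ⟨a, b, c⟩ ht ⟨a', b', c'⟩ ht' he
    obtain ⟨g, hE⟩ := hs _ ht
    obtain ⟨g', hE'⟩ := hs _ ht'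
    simp only at g g' hE hE' he
    simp only [hsg, Prod.mk.injEq, decide_eq_decide] at he
    obtain ⟨⟨p1, p2⟩, p3, p4⟩ := he
    obtain ⟨y, hy⟩ := sqrt _ _ _ (Or.inl rfl) hE
    obtain ⟨y', hy'⟩ := sqrt _ _ _ (Or.inl rfl) hE'
    obtain ⟨w, hw⟩ := sqrt _ _ _ (Or.inr rfl) hE
    obtain ⟨w', hw'⟩ := sqrt _ _ _ (Or.inr rfl) hE'
    have e1 : a * b = a' * b' := h.eq_of_sign ((Nat.squarefree_mul g.cop₁₂).2 ⟨g.sq₁, g.sq₂⟩)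
      ((Nat.squarefree_mul g'.cop₁₂).2 ⟨g'.sq₁, g'.sq₂⟩) hy hy' p1 p2
    have e2 : a * c = a' * c' := h.eq_of_sign ((Nat.squarefree_mul g.cop₁₃).2 ⟨g.sq₁, g.sq₃⟩)
      ((Nat.squarefree_mul g'.cop₁₃).2 ⟨g'.sq₁, g'.sq₃⟩) hw hw' p3 p4
    have e3 : a = a' := by
      have k1 : Nat.gcd (a * b) (a * c) = a := by
        rw [Nat.gcd_mul_left, g.cop₂₃.gcd_eq_one, mul_one]
      have k2 : Nat.gcd (a' * b') (a' * c') = a' := by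
        rw [Nat.gcd_mul_left, g'.cop₂₃.gcd_eq_one, mul_one]
      rw [← k1, ← k2, e1, e2]
    subst e3
    have a0 : 0 < a := Nat.pos_of_ne_zero g.sq₁.ne_zero
    rw [Nat.eq_of_mul_eq_mul_left a0 e1, Nat.eq_of_mul_eq_mul_left a0 e2]
  have := card_le_card_of_injOn (t := univ) (fun t => (sg (t.1 * t.2.1), sg (t.1 * t.2.2)))
    (fun _ _ => mem_univ _) (fun t ht t' ht' => inj t ht t' ht')
  simpa using this

theorem card_goodTriples_le {X : ℝ} {Z : ℕ} (hZ : 256 * (Z : ℝ) ^ 2 ≤ X) :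
    #{t ∈ triples Z | IsGoodTriple t.1 t.2.1 t.2.2} ≤ 16 * biquadCount X + 3 * Z := by
  obtain ⟨G, hG⟩ : ∃ G : Finset (ℕ × ℕ × ℕ), G =
    {t ∈ triples Z | IsGoodTriple t.1 t.2.1 t.2.2 ∧
      ¬ (t.1 * t.2.1 = 1 ∨ t.1 * t.2.2 = 1 ∨ t.2.1 * t.2.2 = 1)} := ⟨_, rfl⟩
  have hsub : {t ∈ triples Z | IsGoodTriple t.1 t.2.1 t.2.2} ⊆
      G ∪ {t ∈ triples Z | t.1 * t.2.1 = 1 ∨ t.1 * t.2.2 = 1 ∨ t.2.1 * t.2.2 = 1} := by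
    intro t ht
    rw [hG, mem_union, mem_filter, mem_filter]
    rw [mem_filter] at ht
    tauto
  have hbi : ∀ t ∈ G, IsBiquadratic (biquadField (t.1 * t.2.1 : ℕ) (t.1 * t.2.2 : ℕ)) ∧
      (biquadDiscr (biquadField (t.1 * t.2.1 : ℕ) (t.1 * t.2.2 : ℕ)) : ℝ) ≤ X := by
    rintro ⟨a, b, c⟩ ht
    rw [hG, mem_filter, mem_triples] at ht
    obtain ⟨⟨-, -, -, hle⟩, g, hne⟩ := ht
    push Not at hne
    obtain ⟨h1, h2⟩ := g.isBiquadratic hne.1 hne.2.1 hne.2.2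
    refine ⟨h1, le_trans ?_ hZ⟩
    have h3 : (((a * b * c : ℕ) : ℤ) : ℝ) ≤ Z := by exact_mod_cast hle
    have h4 : (0 : ℝ) ≤ (((a * b * c : ℕ) : ℤ) : ℝ) := by positivity
    have h5 : ((biquadDiscr (biquadField (a * b : ℕ) (a * c : ℕ)) : ℤ) : ℝ) ≤
        256 * (((a * b * c : ℕ) : ℤ) : ℝ) ^ 2 := by exact_mod_cast h2
    refine h5.trans ?_
    have := pow_le_pow_left₀ h4 h3 2
    linarith
  have him : #(G.image fun t => biquadField (t.1 * t.2.1 : ℕ) (t.1 * t.2.2 : ℕ)) ≤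
      biquadCount X := by
    rw [← Set.ncard_coe_finset]
    refine Set.ncard_le_ncard ?_ (finite_biquadratic X)
    intro K hK
    obtain ⟨t, ht, rfl⟩ := mem_image.1 (mem_coe.1 hK)
    exact hbi t ht
  have hfib := card_le_mul_card_image
    (f := fun t : ℕ × ℕ × ℕ => biquadField (t.1 * t.2.1 : ℕ) (t.1 * t.2.2 : ℕ)) G 16 (by
    intro K hK
    obtain ⟨t, ht, rfl⟩ := mem_image.1 hK
    refine card_fiber_le (hbi t ht).1 _ fun t' ht' => ?_
    rw [mem_filter, hG, mem_filter] at ht'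
    exact ⟨ht'.1.2.1, ht'.2⟩)
  have h1 := card_filter_mul_eq_one_le Z
  have h2 := (card_le_card hsub).trans (card_union_le _ _)
  omega

end FieldCounting

section TripleCounting

open Finset

lemma card_filter_product_eq (A : Finset ℕ) (hA : ∀ a ∈ A, 0 < a) (Y : ℕ) :
    #{t ∈ A ×ˢ Icc 1 Y ×ˢ Icc 1 Y | t.1 * t.2.1 * t.2.2 ≤ Y} =
      ∑ a ∈ A, ∑ b ∈ Icc 1 Y, Y / (a * b) := by
  rw [card_filter, sum_product]
  refine sum_congr rfl fun a ha => ?_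
  rw [sum_product]
  refine sum_congr rfl fun b hb => ?_
  have h0 : 0 < a * b := Nat.mul_pos (hA a ha) (mem_Icc.1 hb).1
  rw [← card_filter]
  have : {c ∈ Icc 1 Y | a * b * c ≤ Y} = Icc 1 (Y / (a * b)) := by
    ext c
    simp only [mem_filter, mem_Icc, Nat.le_div_iff_mul_le h0, mul_comm c]
    refine ⟨fun h => ⟨h.1.1, h.2⟩, fun h => ⟨⟨h.1, ?_⟩, h.2⟩⟩
    exact (Nat.le_mul_of_pos_left c h0).trans h.2
  rw [this, Nat.card_Icc, Nat.add_sub_cancel]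

lemma sum_Icc_inv_le (Y : ℕ) : ∑ a ∈ Icc 1 Y, ((a : ℝ))⁻¹ ≤ 1 + Real.log Y := by
  have h := harmonic_le_one_add_log Y
  rw [harmonic_eq_sum_Icc] at h
  push_cast at h
  exact h

lemma log_le_sum_Icc_inv (Y : ℕ) : Real.log (Y + 1 : ℕ) ≤ ∑ a ∈ Icc 1 Y, ((a : ℝ))⁻¹ := by
  have h := log_add_one_le_harmonic Y
  rw [harmonic_eq_sum_Icc] at h
  push_cast at h ⊢
  exact h

lemma card_triples_le (Y : ℕ) : (#(triples Y) : ℝ) ≤ Y * (1 + Real.log Y) ^ 2 := by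
  unfold triples
  rw [card_filter_product_eq _ (fun a ha => (mem_Icc.1 ha).1)]
  push_cast
  calc ∑ a ∈ Icc 1 Y, ∑ b ∈ Icc 1 Y, ((Y / (a * b) : ℕ) : ℝ)
      ≤ ∑ a ∈ Icc 1 Y, ∑ b ∈ Icc 1 Y, (Y : ℝ) * ((a : ℝ)⁻¹ * (b : ℝ)⁻¹) := by
        refine sum_le_sum fun a _ => sum_le_sum fun b _ => ?_
        refine Nat.cast_div_le.trans (le_of_eq ?_)
        push_cast
        rw [div_eq_mul_inv, mul_inv]
    _ = Y * (∑ a ∈ Icc 1 Y, (a : ℝ)⁻¹) ^ 2 := by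
        rw [sq, sum_mul_sum, mul_sum]
        simp only [mul_sum]
    _ ≤ _ := by
        refine mul_le_mul_of_nonneg_left (pow_le_pow_left₀ ?_ (sum_Icc_inv_le Y) 2)
          (Nat.cast_nonneg _)
        exact sum_nonneg fun _ _ => by positivity

lemma card_triples_fst_lt_le (Y P : ℕ) :
    (#{t ∈ triples Y | t.1 < P} : ℝ) ≤ P * Y * (1 + Real.log Y) := by
  have hsub : {t ∈ triples Y | t.1 < P} ⊆
      {t ∈ Icc 1 P ×ˢ Icc 1 Y ×ˢ Icc 1 Y | t.1 * t.2.1 * t.2.2 ≤ Y} := by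
    intro t ht
    simp only [triples, mem_filter, mem_product, mem_Icc] at ht ⊢
    exact ⟨⟨⟨ht.1.1.1.1, ht.2.le⟩, ht.1.1.2⟩, ht.1.2⟩
  refine (Nat.cast_le.2 (card_le_card hsub)).trans ?_
  rw [card_filter_product_eq _ (fun a ha => (mem_Icc.1 ha).1)]
  push_cast
  calc ∑ a ∈ Icc 1 P, ∑ b ∈ Icc 1 Y, ((Y / (a * b) : ℕ) : ℝ)
      ≤ ∑ a ∈ Icc 1 P, ∑ b ∈ Icc 1 Y, (Y : ℝ) * (b : ℝ)⁻¹ := by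
        refine sum_le_sum fun a ha => sum_le_sum fun b hb => ?_
        rw [← div_eq_mul_inv]
        refine le_trans (Nat.cast_le.2 (Nat.div_le_div_left ?_ (mem_Icc.1 hb).1)) Nat.cast_div_le
        exact Nat.le_mul_of_pos_left b (mem_Icc.1 ha).1
    _ = P * Y * ∑ b ∈ Icc 1 Y, (b : ℝ)⁻¹ := by
        rw [sum_const, ← mul_sum, Nat.card_Icc, Nat.add_sub_cancel, nsmul_eq_mul, mul_assoc]
    _ ≤ _ := mul_le_mul_of_nonneg_left (sum_Icc_inv_le Y) (by positivity)

lemma card_triples_exists_lt_le (Y P : ℕ) :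
    (#{t ∈ triples Y | t.1 < P ∨ t.2.1 < P ∨ t.2.2 < P} : ℝ) ≤
      3 * P * Y * (1 + Real.log Y) := by
  have h2 : #{t ∈ triples Y | t.2.1 < P} ≤ #{t ∈ triples Y | t.1 < P} := by
    refine card_le_card_of_injOn (fun t => (t.2.1, t.1, t.2.2)) ?_ ?_
    · rintro ⟨a, b, c⟩ ht
      simp only [coe_filter, Set.mem_ofPred_eq, mem_triples] at ht ⊢
      exact ⟨⟨ht.1.2.1, ht.1.1, ht.1.2.2.1, by rw [mul_comm b]; exact ht.1.2.2.2⟩, ht.2⟩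
    · rintro ⟨a, b, c⟩ _ ⟨a', b', c'⟩ _ h
      simp only [Prod.mk.injEq] at h ⊢
      tauto
  have h3 : #{t ∈ triples Y | t.2.2 < P} ≤ #{t ∈ triples Y | t.1 < P} := by
    refine card_le_card_of_injOn (fun t => (t.2.2, t.2.1, t.1)) ?_ ?_
    · rintro ⟨a, b, c⟩ ht
      simp only [coe_filter, Set.mem_ofPred_eq, mem_triples] at ht ⊢
      refine ⟨⟨ht.1.2.2.1, ht.1.2.1, ht.1.1, ?_⟩, ht.2⟩
      have : c * b * a = a * b * c := by ring
      rw [this]; exact ht.1.2.2.2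
    · rintro ⟨a, b, c⟩ _ ⟨a', b', c'⟩ _ h
      simp only [Prod.mk.injEq] at h ⊢
      tauto
  have hle : #{t ∈ triples Y | t.1 < P ∨ t.2.1 < P ∨ t.2.2 < P} ≤
      3 * #{t ∈ triples Y | t.1 < P} := by
    rw [filter_or, filter_or]
    have k1 := card_union_le {t ∈ triples Y | t.1 < P}
      ({t ∈ triples Y | t.2.1 < P} ∪ {t ∈ triples Y | t.2.2 < P})
    have k2 := card_union_le {t ∈ triples Y | t.2.1 < P} {t ∈ triples Y | t.2.2 < P}
    omega
  have h1 := card_triples_fst_lt_le Y P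
  have hle' : (#{t ∈ triples Y | t.1 < P ∨ t.2.1 < P ∨ t.2.2 < P} : ℝ) ≤
      3 * #{t ∈ triples Y | t.1 < P} := by exact_mod_cast hle
  linarith

/-- The triples satisfying `P` have positive proportion among all triples. -/
def HasManyTriples (P : ℕ × ℕ × ℕ → Prop) : Prop :=
  ∃ κ > (0 : ℝ), ∃ Y₀ : ℕ, ∀ Y ≥ Y₀, κ * (Y * Real.log Y ^ 2) ≤ #{t ∈ triples Y | P t}

lemma hasManyTriples_true : HasManyTriples fun _ => True := by
  refine ⟨1 / 8, by norm_num, 1, fun Y hY => ?_⟩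
  obtain ⟨s, hs⟩ : ∃ s, s = Nat.sqrt Y := ⟨_, rfl⟩
  have hsY : s ≤ Y := hs ▸ Nat.sqrt_le_self Y
  have hss : s * s ≤ Y := hs ▸ Nat.sqrt_le Y
  have hlog : Real.log Y / 2 ≤ ∑ a ∈ Icc 1 s, (a : ℝ)⁻¹ := by
    refine le_trans ?_ (log_le_sum_Icc_inv s)
    have h1 : (Y : ℝ) ≤ ((s + 1 : ℕ) : ℝ) ^ 2 := by
      have := Nat.lt_succ_sqrt Y
      rw [← hs] at this
      rw [sq]
      exact_mod_cast this.le
    have h2 := Real.log_le_log (by exact_mod_cast hY) h1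
    rw [Real.log_pow] at h2
    push_cast at h2 ⊢
    linarith
  have hlog0 : 0 ≤ Real.log Y := Real.log_natCast_nonneg Y
  rw [filter_true]
  unfold triples
  rw [card_filter_product_eq _ (fun a ha => (mem_Icc.1 ha).1)]
  push_cast
  calc (1 / 8 : ℝ) * (Y * Real.log Y ^ 2) = Y / 2 * (Real.log Y / 2) ^ 2 := by ring
    _ ≤ Y / 2 * (∑ a ∈ Icc 1 s, (a : ℝ)⁻¹) ^ 2 :=
        mul_le_mul_of_nonneg_left (pow_le_pow_left₀ (by positivity) hlog 2) (by positivity)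
    _ = ∑ a ∈ Icc 1 s, ∑ b ∈ Icc 1 s, (Y : ℝ) / 2 * ((a : ℝ)⁻¹ * (b : ℝ)⁻¹) := by
        rw [sq, sum_mul_sum, mul_sum]
        simp only [mul_sum]
    _ ≤ ∑ a ∈ Icc 1 s, ∑ b ∈ Icc 1 s, ((Y / (a * b) : ℕ) : ℝ) := by
        refine sum_le_sum fun a ha => sum_le_sum fun b hb => ?_
        rw [mem_Icc] at ha hb
        have h0 : 0 < a * b := Nat.mul_pos ha.1 hb.1
        have h1 : a * b ≤ Y := (Nat.mul_le_mul ha.2 hb.2).trans hss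
        have h2 : Y ≤ 2 * (Y / (a * b)) * (a * b) := by
          have h3 := Nat.div_add_mod Y (a * b)
          have h4 := Nat.mod_lt Y h0
          have h5 : 1 ≤ Y / (a * b) := (Nat.one_le_div_iff h0).2 h1
          have h6 := Nat.mul_le_mul_left (a * b) h5
          have h7 : 2 * (Y / (a * b)) * (a * b) =
            a * b * (Y / (a * b)) + a * b * (Y / (a * b)) := by ring
          omega
        have h3 : (Y : ℝ) ≤ 2 * ((Y / (a * b) : ℕ) : ℝ) * (a * b) := by exact_mod_cast h2
        have ha' : (0 : ℝ) < a := by exact_mod_cast ha.1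
        have hb' : (0 : ℝ) < b := by exact_mod_cast hb.1
        rw [← mul_inv, ← div_eq_mul_inv, div_le_iff₀ (by positivity)]
        linarith
    _ ≤ ∑ a ∈ Icc 1 Y, ∑ b ∈ Icc 1 Y, ((Y / (a * b) : ℕ) : ℝ) := by
        have hsub : Icc 1 s ⊆ Icc 1 Y := Icc_subset_Icc_right hsY
        refine le_trans (sum_le_sum fun a _ => sum_le_sum_of_subset_of_nonneg hsub
          fun _ _ _ => Nat.cast_nonneg _) ?_
        exact sum_le_sum_of_subset_of_nonneg hsub
          fun _ _ _ => sum_nonneg fun _ _ => Nat.cast_nonneg _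

/-- Removing square factors preserves positive proportion. -/
theorem HasManyTriples.of_sq_mul {Q P : ℕ × ℕ × ℕ → Prop} (hQ : HasManyTriples Q)
    (φ : ℕ → ℕ × ℕ × ℕ → ℕ × ℕ × ℕ)
    (h : ∀ a b c : ℕ, 0 < a → 0 < b → 0 < c → Q (a, b, c) → ∃ m a' b' c' : ℕ,
      P (a', b', c') ∧ φ m (a', b', c') = (a, b, c) ∧ a * b * c = a' * b' * c' * m ^ 2) :
    HasManyTriples P := by
  obtain ⟨κ, hκ, Y₀, hQ⟩ := hQ
  obtain ⟨R, hR⟩ := exists_nat_gt (8 / κ)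
  have hR0 : (0 : ℝ) < R := lt_trans (by positivity) hR
  have hR0' : 0 < R := by exact_mod_cast hR0
  refine ⟨κ / (2 * R), by positivity, max Y₀ (max R 3), fun Y hY => ?_⟩
  have hY0 : Y₀ ≤ Y := (le_max_left _ _).trans hY
  have hYR : R ≤ Y := ((le_max_left _ _).trans (le_max_right _ _)).trans hY
  have hY3 : 3 ≤ Y := ((le_max_right _ _).trans (le_max_right _ _)).trans hY
  have hlog : 1 ≤ Real.log Y := by
    rw [Real.le_log_iff_exp_le (by positivity)]
    have : (3 : ℝ) ≤ Y := by exact_mod_cast hY3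
    linarith [Real.exp_one_lt_d9]
  have hsub : {t ∈ triples Y | Q t} ⊆
      (Icc 1 Y).biUnion fun m => ({t ∈ triples (Y / m ^ 2) | P t}).image (φ m) := by
    rintro ⟨a, b, c⟩ ht
    rw [mem_filter, mem_triples] at ht
    obtain ⟨⟨ha, hb, hc, hle⟩, hq⟩ := ht
    obtain ⟨m, a', b', c', hp, hφ, he⟩ := h a b c ha hb hc hq
    have hpos : 0 < a' * b' * c' * m ^ 2 := he ▸ Nat.mul_pos (Nat.mul_pos ha hb) hc
    have hm2 : 0 < m ^ 2 := Nat.pos_of_mul_pos_left hpos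
    have habc : 0 < a' * b' * c' := Nat.pos_of_mul_pos_right hpos
    have hm : 0 < m := Nat.pos_of_ne_zero fun h => by simp [h] at hm2
    have hmY : m ≤ Y := by
      have h1 : m ≤ m ^ 2 := Nat.le_self_pow two_ne_zero m
      have h2 : m ^ 2 ≤ a' * b' * c' * m ^ 2 := Nat.le_mul_of_pos_left _ habc
      omega
    refine mem_biUnion.2 ⟨m, mem_Icc.2 ⟨hm, hmY⟩, mem_image.2 ⟨_, mem_filter.2 ⟨?_, hp⟩, hφ⟩⟩
    have hab := Nat.pos_of_mul_pos_right habc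
    exact mem_triples.2 ⟨Nat.pos_of_mul_pos_right hab, Nat.pos_of_mul_pos_left hab,
      Nat.pos_of_mul_pos_left habc, (Nat.le_div_iff_mul_le hm2).2 (he ▸ hle)⟩
  have hcard : #{t ∈ triples Y | Q t} ≤
      ∑ m ∈ Icc 1 Y, #{t ∈ triples (Y / m ^ 2) | P t} :=
    (card_le_card hsub).trans (card_biUnion_le.trans (sum_le_sum fun _ _ => card_image_le))
  have hsplit : Icc 1 Y = Icc 1 R ∪ Ioc R Y := by
    ext m
    simp only [mem_union, mem_Icc, mem_Ioc]
    omega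
  have hdisj : Disjoint (Icc 1 R) (Ioc R Y) := by
    rw [disjoint_left]
    intro m
    simp only [mem_Icc, mem_Ioc]
    omega
  rw [hsplit, sum_union hdisj] at hcard
  have hsmall : ∑ m ∈ Icc 1 R, #{t ∈ triples (Y / m ^ 2) | P t} ≤
      R * #{t ∈ triples Y | P t} := by
    have : ∀ m ∈ Icc 1 R, #{t ∈ triples (Y / m ^ 2) | P t} ≤ #{t ∈ triples Y | P t} := by
      intro m _
      refine card_le_card (filter_subset_filter _ ?_)
      rintro ⟨a, b, c⟩ ht
      rw [mem_triples] at ht ⊢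
      exact ⟨ht.1, ht.2.1, ht.2.2.1, ht.2.2.2.trans (Nat.div_le_self _ _)⟩
    refine (sum_le_card_nsmul _ _ _ this).trans (le_of_eq ?_)
    rw [Nat.card_Icc, Nat.add_sub_cancel, smul_eq_mul]
  have hlarge : ((∑ m ∈ Ioc R Y, #{t ∈ triples (Y / m ^ 2) | P t} : ℕ) : ℝ) ≤
      Y * (2 * Real.log Y) ^ 2 * (R : ℝ)⁻¹ := by
    push_cast
    calc ∑ m ∈ Ioc R Y, (#{t ∈ triples (Y / m ^ 2) | P t} : ℝ)
        ≤ ∑ m ∈ Ioc R Y, Y * (2 * Real.log Y) ^ 2 * ((m : ℝ) ^ 2)⁻¹ := by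
          refine sum_le_sum fun m hm => ?_
          refine (Nat.cast_le.2 (card_le_card (filter_subset _ _))).trans
            ((card_triples_le _).trans ?_)
          have h1 : ((Y / m ^ 2 : ℕ) : ℝ) ≤ Y * ((m : ℝ) ^ 2)⁻¹ := by
            rw [← div_eq_mul_inv]
            exact_mod_cast (Nat.cast_div_le (α := ℝ) (m := Y) (n := m ^ 2))
          have h2 : Real.log ((Y / m ^ 2 : ℕ) : ℝ) ≤ Real.log Y := by
            rcases Nat.eq_zero_or_pos (Y / m ^ 2) with h0 | h0
            · rw [h0]
              simpa using (zero_le_one.trans hlog)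
            · exact Real.log_le_log (by exact_mod_cast h0)
                (by exact_mod_cast Nat.div_le_self _ _)
          have h3 : 0 ≤ Real.log ((Y / m ^ 2 : ℕ) : ℝ) := Real.log_natCast_nonneg _
          have h4 : (1 + Real.log ((Y / m ^ 2 : ℕ) : ℝ)) ^ 2 ≤ (2 * Real.log Y) ^ 2 :=
            pow_le_pow_left₀ (by linarith) (by linarith) 2
          refine (mul_le_mul h1 h4 (by positivity) (by positivity)).trans (le_of_eq ?_)
          ring
      _ = Y * (2 * Real.log Y) ^ 2 * ∑ m ∈ Ioc R Y, ((m : ℝ) ^ 2)⁻¹ := by rw [mul_sum]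
      _ ≤ _ := by
          refine mul_le_mul_of_nonneg_left ?_ (by positivity)
          refine (sum_Ioc_inv_sq_le_sub hR0'.ne' hYR).trans ?_
          have : (0 : ℝ) ≤ (Y : ℝ)⁻¹ := by positivity
          linarith
  have hfin : κ * (Y * Real.log Y ^ 2) ≤
      R * #{t ∈ triples Y | P t} + Y * (2 * Real.log Y) ^ 2 * (R : ℝ)⁻¹ := by
    have h1 : (#{t ∈ triples Y | Q t} : ℝ) ≤
      ((∑ m ∈ Icc 1 R, #{t ∈ triples (Y / m ^ 2) | P t} : ℕ) : ℝ) +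
      ((∑ m ∈ Ioc R Y, #{t ∈ triples (Y / m ^ 2) | P t} : ℕ) : ℝ) := by exact_mod_cast hcard
    have h2 : ((∑ m ∈ Icc 1 R, #{t ∈ triples (Y / m ^ 2) | P t} : ℕ) : ℝ) ≤
      R * #{t ∈ triples Y | P t} := by exact_mod_cast hsmall
    linarith [hQ Y hY0]
  have hRinv : (R : ℝ)⁻¹ ≤ κ / 8 := by
    rw [inv_le_comm₀ hR0 (by positivity), inv_div]
    exact hR.le
  have hZ : 0 ≤ (Y : ℝ) * Real.log Y ^ 2 := by positivity
  have h5 := mul_le_mul_of_nonneg_left hRinv hZ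
  have h6 : κ / 2 * (Y * Real.log Y ^ 2) ≤ R * #{t ∈ triples Y | P t} := by linarith
  have h7 : κ / (2 * R) * (Y * Real.log Y ^ 2) = κ / 2 * (Y * Real.log Y ^ 2) / R := by
    field_simp
  rw [h7, div_le_iff₀ hR0]
  linarith

theorem hasManyTriples_isGoodTriple :
    HasManyTriples fun t => IsGoodTriple t.1 t.2.1 t.2.2 := by
  have dvd : ∀ {n m : ℕ}, 0 < n → ∃ g n' m', 0 < g ∧ n = g * n' ∧ m = g * m' ∧
      n'.Coprime m' := by
    intro n m hn
    have hg := Nat.gcd_pos_of_pos_left m hn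
    obtain ⟨n', m', hc, h1, h2⟩ := Nat.exists_coprime n m
    exact ⟨n.gcd m, n', m', hg, by rw [mul_comm]; exact h1, by rw [mul_comm]; exact h2, hc⟩
  have s1 : HasManyTriples fun t => Squarefree t.1 := by
    refine hasManyTriples_true.of_sq_mul (fun m t => (m ^ 2 * t.1, t.2)) ?_
    intro a b c ha hb hc _
    obtain ⟨x, y, rfl, sx⟩ := Nat.sq_mul_squarefree a
    exact ⟨y, x, b, c, sx, rfl, by ring⟩
  have s2 : HasManyTriples fun t => Squarefree t.1 ∧ Squarefree t.2.1 := by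
    refine s1.of_sq_mul (fun m t => (t.1, m ^ 2 * t.2.1, t.2.2)) ?_
    intro a b c ha hb hc h
    obtain ⟨x, y, rfl, sx⟩ := Nat.sq_mul_squarefree b
    exact ⟨y, a, x, c, ⟨h, sx⟩, rfl, by ring⟩
  have s3 : HasManyTriples fun t => Squarefree t.1 ∧ Squarefree t.2.1 ∧ Squarefree t.2.2 := by
    refine s2.of_sq_mul (fun m t => (t.1, t.2.1, m ^ 2 * t.2.2)) ?_
    intro a b c ha hb hc h
    obtain ⟨x, y, rfl, sx⟩ := Nat.sq_mul_squarefree c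
    exact ⟨y, a, b, x, ⟨h.1, h.2, sx⟩, rfl, by ring⟩
  have s4 : HasManyTriples fun t => (Squarefree t.1 ∧ Squarefree t.2.1 ∧ Squarefree t.2.2) ∧
      t.1.Coprime t.2.1 := by
    refine s3.of_sq_mul (fun m t => (m * t.1, m * t.2.1, t.2.2)) ?_
    intro a b c ha hb hc h
    obtain ⟨g, a', b', hg, rfl, rfl, cop⟩ := dvd (n := a) (m := b) ha
    exact ⟨g, a', b', c, ⟨⟨h.1.of_mul_right, h.2.1.of_mul_right, h.2.2⟩, cop⟩, rfl, by ring⟩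
  have s5 : HasManyTriples fun t => (Squarefree t.1 ∧ Squarefree t.2.1 ∧ Squarefree t.2.2) ∧
      t.1.Coprime t.2.1 ∧ t.1.Coprime t.2.2 := by
    refine s4.of_sq_mul (fun m t => (m * t.1, t.2.1, m * t.2.2)) ?_
    intro a b c ha hb hc h
    obtain ⟨g, a', c', hg, rfl, rfl, cop⟩ := dvd (n := a) (m := c) ha
    exact ⟨g, a', b, c', ⟨⟨h.1.1.of_mul_right, h.1.2.1, h.1.2.2.of_mul_right⟩,
      h.2.coprime_mul_left, cop⟩, rfl, by ring⟩
  refine s5.of_sq_mul (fun m t => (t.1, m * t.2.1, m * t.2.2)) ?_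
  intro a b c ha hb hc h
  obtain ⟨g, b', c', hg, rfl, rfl, cop⟩ := dvd (n := b) (m := c) hb
  exact ⟨g, a, b', c', ⟨h.1.1, h.1.2.1.of_mul_right, h.1.2.2.of_mul_right,
    h.2.1.coprime_mul_left_right, h.2.2.coprime_mul_left_right, cop⟩, rfl, by ring⟩

end TripleCounting

section Sieve

open Finset

lemma two_mul_card_quadraticChar_eq_neg_one {p : ℕ} [Fact p.Prime] (hp : p ≠ 2) {e : ZMod p}
    (he : e ≠ 0) :
    2 * (#{t : ZMod p × ZMod p | quadraticChar (ZMod p) (e * t.1 * t.2) = -1} : ℤ) =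
      ((p : ℤ) - 1) ^ 2 := by
  have hchar : ringChar (ZMod p) ≠ 2 := by rwa [ZMod.ringChar_zmod_n]
  have hs : ∑ x : ZMod p, quadraticChar (ZMod p) x ^ 2 = (p : ℤ) - 1 := by
    have h1 : ∀ x : ZMod p, quadraticChar (ZMod p) x ^ 2 = 1 - if x = 0 then 1 else 0 := by
      intro x
      by_cases hx : x = 0
      · simp [hx]
      · rw [quadraticChar_sq_one hx, if_neg hx, sub_zero]
    simp only [h1, sum_sub_distrib, sum_ite_eq', mem_univ, if_true, sum_const, card_univ,
      ZMod.card, nsmul_eq_mul, mul_one]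
  have h2 : ∀ x : ZMod p, 2 * (if quadraticChar (ZMod p) x = -1 then (1 : ℤ) else 0) =
      quadraticChar (ZMod p) x ^ 2 - quadraticChar (ZMod p) x := by
    intro x
    by_cases hx : x = 0
    · simp [hx]
    · rcases quadraticChar_dichotomy hx with h | h <;> rw [h] <;> norm_num
  rw [card_filter]
  push_cast
  rw [mul_sum]
  simp only [h2]
  simp only [map_mul, Fintype.sum_prod_type, sum_sub_distrib, mul_pow,
    quadraticChar_sq_one he, one_mul]
  have h3 : ∑ x : ZMod p, ∑ y : ZMod p,
      quadraticChar (ZMod p) x ^ 2 * quadraticChar (ZMod p) y ^ 2 = ((p : ℤ) - 1) ^ 2 := by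
    rw [← sum_mul_sum, hs, sq]
  have h4 : ∑ x : ZMod p, ∑ y : ZMod p,
      quadraticChar (ZMod p) e * quadraticChar (ZMod p) x * quadraticChar (ZMod p) y = 0 := by
    simp only [← mul_sum, quadraticChar_sum_zero hchar, mul_zero, sum_const_zero]
  rw [h3, h4, sub_zero]

lemma card_unobstructed_residues_le {p : ℕ} [Fact p.Prime] (hp : p ≠ 2) {e : ZMod p}
    (he : e ≠ 0) :
    (#{t : ZMod p × ZMod p × ZMod p |
      ¬ (t.1 = 0 ∧ quadraticChar (ZMod p) (e * t.2.1 * t.2.2) = -1)} : ℝ) ≤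
      (p : ℝ) ^ 3 * (1 - 1 / (8 * p)) := by
  have h1 := two_mul_card_quadraticChar_eq_neg_one hp he
  have h2 : #{t : ZMod p × ZMod p | quadraticChar (ZMod p) (e * t.1 * t.2) = -1} ≤
      #{t : ZMod p × ZMod p × ZMod p |
        t.1 = 0 ∧ quadraticChar (ZMod p) (e * t.2.1 * t.2.2) = -1} := by
    refine card_le_card_of_injOn (fun t => (0, t)) ?_ ?_
    · intro t ht
      simpa using ht
    · intro t _ t' _ h
      simpa using h
  have h3 := card_filter_add_card_filter_not (s := (univ : Finset (ZMod p × ZMod p × ZMod p)))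
    (fun t => t.1 = 0 ∧ quadraticChar (ZMod p) (e * t.2.1 * t.2.2) = -1)
  rw [card_univ, Fintype.card_prod, Fintype.card_prod, ZMod.card] at h3
  have hp2 : (2 : ℝ) ≤ p := by exact_mod_cast (Fact.out : p.Prime).two_le
  have h1' : 2 * (#{t : ZMod p × ZMod p | quadraticChar (ZMod p) (e * t.1 * t.2) = -1} : ℝ) =
      ((p : ℝ) - 1) ^ 2 := by exact_mod_cast h1
  have h2' : (#{t : ZMod p × ZMod p | quadraticChar (ZMod p) (e * t.1 * t.2) = -1} : ℝ) ≤
      #{t : ZMod p × ZMod p × ZMod p |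
        t.1 = 0 ∧ quadraticChar (ZMod p) (e * t.2.1 * t.2.2) = -1} := by exact_mod_cast h2
  have h3' : (#{t : ZMod p × ZMod p × ZMod p |
        t.1 = 0 ∧ quadraticChar (ZMod p) (e * t.2.1 * t.2.2) = -1} : ℝ) +
      #{t : ZMod p × ZMod p × ZMod p |
        ¬ (t.1 = 0 ∧ quadraticChar (ZMod p) (e * t.2.1 * t.2.2) = -1)} = p * (p * p) := by
    exact_mod_cast h3
  have h4 : ((p : ℝ) / 2) ^ 2 ≤ ((p : ℝ) - 1) ^ 2 :=
    pow_le_pow_left₀ (by linarith) (by linarith) 2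
  have h5 : (p : ℝ) ^ 3 * (1 - 1 / (8 * p)) = p * (p * p) - p ^ 2 / 8 := by
    field_simp
  rw [h5]
  linarith

variable {ι : Type*} [Fintype ι] (p : ι → ℕ) [∀ i, Fact (p i).Prime]

lemma modEq_prod_of_cast_eq (inj : Function.Injective p) {a b : ℕ}
    (h : ∀ i, (a : ZMod (p i)) = b) : a ≡ b [MOD ∏ i, p i] := by
  rw [Nat.modEq_iff_dvd]
  push_cast
  refine prod_dvd_of_coprime ?_ ?_
  · intro i _ j _ hij
    rw [Function.onFun, Nat.isCoprime_iff_coprime]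
    exact (Nat.coprime_primes Fact.out Fact.out).2 fun h => hij (inj h)
  · intro i _
    rw [← Nat.modEq_iff_dvd]
    exact (ZMod.natCast_eq_natCast_iff _ _ _).1 (h i)

lemma card_isUnobstructed_of_le (inj : Function.Injective p) (h2 : ∀ i, p i ≠ 2)
    (h3 : 3 ≤ ∏ i, p i) {e : ℤ} (Y : ℕ) :
    #{t ∈ triples Y | IsUnobstructed e t ∧ ∏ i, p i ≤ t.1 ∧ ∏ i, p i ≤ t.2.1 ∧
      ∏ i, p i ≤ t.2.2} ≤ #(triples (Y / (∏ i, p i) ^ 3)) *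
      ∏ i, #{t : ZMod (p i) × ZMod (p i) × ZMod (p i) |
        ¬ (t.1 = 0 ∧ quadraticChar (ZMod (p i)) ((e : ZMod (p i)) * t.2.1 * t.2.2) = -1)} := by
  generalize hP : ∏ i, p i = P at *
  have P0 : 0 < P := by omega
  rw [← Fintype.card_piFinset]
  refine card_le_mul_card_image_of_maps_to
    (f := fun (t : ℕ × ℕ × ℕ) i => ((t.1 : ZMod (p i)), (t.2.1 : ZMod (p i)),
      (t.2.2 : ZMod (p i)))) ?_ _ ?_
  · rintro ⟨a, b, c⟩ ht
    rw [mem_filter] at ht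
    obtain ⟨-, hu, ha, hb, hc⟩ := ht
    simp only at ha hb hc
    refine Fintype.mem_piFinset.2 fun i => mem_filter.2 ⟨mem_univ _, ?_⟩
    rintro ⟨k1, k2⟩
    exact hu (Nat.lt_of_lt_of_le h3 ha) (Nat.lt_of_lt_of_le h3 hb) (Nat.lt_of_lt_of_le h3 hc)
      (p i) (h2 i) k1 k2
  · intro r _
    refine card_le_card_of_injOn (fun t => (t.1 / P, t.2.1 / P, t.2.2 / P)) ?_ ?_
    · rintro ⟨a, b, c⟩ ht
      rw [coe_filter, Set.mem_ofPred_eq, mem_filter, mem_triples] at ht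
      obtain ⟨⟨⟨-, -, -, hle⟩, -, ha, hb, hc⟩, -⟩ := ht
      refine mem_triples.2 ⟨Nat.div_pos ha P0, Nat.div_pos hb P0, Nat.div_pos hc P0, ?_⟩
      rw [Nat.le_div_iff_mul_le (by positivity)]
      calc a / P * (b / P) * (c / P) * P ^ 3 = (a / P * P) * (b / P * P) * (c / P * P) := by ring
        _ ≤ a * b * c := Nat.mul_le_mul (Nat.mul_le_mul (Nat.div_mul_le_self _ _)
            (Nat.div_mul_le_self _ _)) (Nat.div_mul_le_self _ _)
        _ ≤ Y := hle
    · rintro ⟨a, b, c⟩ ht ⟨a', b', c'⟩ ht' h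
      rw [coe_filter, Set.mem_ofPred_eq] at ht ht'
      have hr := ht.2.trans ht'.2.symm
      simp only [Prod.mk.injEq] at h ⊢
      have key : ∀ {x y : ℕ}, x / P = y / P → (∀ i, (x : ZMod (p i)) = y) → x = y := by
        intro x y hd hm
        have hm' : x % P = y % P := by
          have := modEq_prod_of_cast_eq p inj hm
          rwa [hP] at this
        rw [← Nat.div_add_mod x P, ← Nat.div_add_mod y P, hd, hm']
      exact ⟨key h.1 fun i => congrArg Prod.fst (congrFun hr i),
        key h.2.1 fun i => congrArg (fun z => z.2.1) (congrFun hr i),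
        key h.2.2 fun i => congrArg (fun z => z.2.2) (congrFun hr i)⟩

theorem card_isUnobstructed_le (inj : Function.Injective p) (h2 : ∀ i, p i ≠ 2)
    (h3 : 3 ≤ ∏ i, p i) {e : ℤ} (he : e = 1 ∨ e = -1) (Y : ℕ) :
    (#{t ∈ triples Y | IsUnobstructed e t} : ℝ) ≤
      (∏ i, (1 - 1 / (8 * (p i : ℝ)))) * (Y * (1 + Real.log Y) ^ 2) +
        3 * (∏ i, p i : ℕ) * Y * (1 + Real.log Y) := by
  have hsub : {t ∈ triples Y | IsUnobstructed e t} ⊆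
      {t ∈ triples Y | IsUnobstructed e t ∧ ∏ i, p i ≤ t.1 ∧ ∏ i, p i ≤ t.2.1 ∧
        ∏ i, p i ≤ t.2.2} ∪
      {t ∈ triples Y | t.1 < ∏ i, p i ∨ t.2.1 < ∏ i, p i ∨ t.2.2 < ∏ i, p i} := by
    intro t ht
    rw [mem_filter] at ht
    rw [mem_union, mem_filter, mem_filter, ← not_le, ← not_le, ← not_le]
    tauto
  have k1 := (card_le_card hsub).trans (card_union_le _ _)
  have k2 := k1.trans (Nat.add_le_add_right (card_isUnobstructed_of_le p inj h2 h3 Y) _)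
  have k3 := (Nat.cast_le (α := ℝ)).2 k2
  refine k3.trans ?_
  rw [Nat.cast_add]
  refine add_le_add ?_ (card_triples_exists_lt_le Y _)
  have P0 : (0 : ℝ) < ((∏ i, p i : ℕ) : ℝ) := by
    exact_mod_cast (show 0 < ∏ i, p i by omega)
  have e0 : ∀ i, (e : ZMod (p i)) ≠ 0 := by
    intro i
    rcases he with rfl | rfl <;> simp
  have hprod : ((∏ i, #{t : ZMod (p i) × ZMod (p i) × ZMod (p i) |
        ¬ (t.1 = 0 ∧ quadraticChar (ZMod (p i)) ((e : ZMod (p i)) * t.2.1 * t.2.2) = -1)} : ℕ) :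
        ℝ) ≤ ((∏ i, p i : ℕ) : ℝ) ^ 3 * ∏ i, (1 - 1 / (8 * (p i : ℝ))) := by
    push_cast
    rw [← prod_pow, ← prod_mul_distrib]
    exact prod_le_prod (fun _ _ => Nat.cast_nonneg _)
      fun i _ => card_unobstructed_residues_le (h2 i) (e0 i)
  have hfac : ∀ i, (0 : ℝ) ≤ 1 - 1 / (8 * (p i : ℝ)) := by
    intro i
    have : (1 : ℝ) ≤ p i := by exact_mod_cast (Fact.out : (p i).Prime).one_le
    rw [sub_nonneg, div_le_one (by positivity)]
    linarith
  have hcard : (#(triples (Y / (∏ i, p i) ^ 3)) : ℝ) ≤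
      Y / ((∏ i, p i : ℕ) : ℝ) ^ 3 * (1 + Real.log Y) ^ 2 := by
    refine (card_triples_le _).trans ?_
    have h1 : ((Y / (∏ i, p i) ^ 3 : ℕ) : ℝ) ≤ Y / ((∏ i, p i : ℕ) : ℝ) ^ 3 := by
      exact_mod_cast (Nat.cast_div_le (α := ℝ) (m := Y) (n := (∏ i, p i) ^ 3))
    have hY := Real.log_natCast_nonneg Y
    have h2 : Real.log ((Y / (∏ i, p i) ^ 3 : ℕ) : ℝ) ≤ Real.log Y := by
      rcases Nat.eq_zero_or_pos (Y / (∏ i, p i) ^ 3) with h0 | h0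
      · rw [h0]
        simpa using hY
      · exact Real.log_le_log (by exact_mod_cast h0) (by exact_mod_cast Nat.div_le_self _ _)
    have h3 := Real.log_natCast_nonneg (Y / (∏ i, p i) ^ 3)
    exact mul_le_mul h1 (pow_le_pow_left₀ (by linarith) (by linarith) 2) (by positivity)
      (by positivity)
  rw [Nat.cast_mul]
  refine (mul_le_mul hcard hprod (Nat.cast_nonneg _) (by positivity)).trans (le_of_eq ?_)
  field_simp

end Sieve

section Conclusion

open Finset

lemma exists_prod_lt {δ : ℝ} (hδ : 0 < δ) : ∃ S : Finset Nat.Primes,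
    (∀ p : S, (p : ℕ) ≠ 2) ∧ 3 ≤ ∏ p : S, (p : ℕ) ∧
      ∏ p : S, (1 - 1 / (8 * ((p : ℕ) : ℝ))) ≤ δ := by
  obtain ⟨B, hB⟩ : ∃ B : ℝ, B = max 0 (-(8 * Real.log δ)) := ⟨_, rfl⟩
  have hB0 : 0 ≤ B := hB ▸ le_max_left _ _
  have hBδ : -(8 * Real.log δ) ≤ B := hB ▸ le_max_right _ _
  obtain ⟨u, hu⟩ : ∃ u : Finset Nat.Primes, B + 1 / 2 < ∑ p ∈ u, 1 / ((p : ℕ) : ℝ) := by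
    by_contra! hcon
    exact Nat.Primes.not_summable_one_div (summable_of_sum_le (fun _ => by positivity) hcon)
  obtain ⟨q₂, hq₂⟩ : ∃ q : Nat.Primes, (q : ℕ) = 2 := ⟨⟨2, Nat.prime_two⟩, rfl⟩
  obtain ⟨S, hS⟩ : ∃ S, S = u.erase q₂ := ⟨_, rfl⟩
  have hsum : B < ∑ p ∈ S, 1 / ((p : ℕ) : ℝ) := by
    by_cases h2 : q₂ ∈ u
    · rw [← add_sum_erase _ _ h2, ← hS, hq₂, Nat.cast_ofNat] at hu
      linarith
    · rw [erase_eq_of_notMem h2] at hS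
      rw [hS]
      linarith
  have hne2 : ∀ p : S, (p : ℕ) ≠ 2 := by
    rintro ⟨p, hp⟩ h
    rw [hS, mem_erase] at hp
    exact hp.1 (Subtype.ext (h.trans hq₂.symm))
  refine ⟨S, hne2, ?_, ?_⟩
  · obtain ⟨q, hq⟩ : S.Nonempty := by
      rw [nonempty_iff_ne_empty]
      rintro rfl
      rw [sum_empty] at hsum
      linarith
    have h1 : ((⟨q, hq⟩ : S) : ℕ) ∣ ∏ p : S, (p : ℕ) := dvd_prod_of_mem _ (mem_univ _)
    have h2 : 0 < ∏ p : S, (p : ℕ) := prod_pos fun p _ => p.1.2.pos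
    have h3 := Nat.le_of_dvd h2 h1
    have h4 := hne2 ⟨q, hq⟩
    have h5 := q.2.two_le
    simp only at h3 h4
    change 2 ≤ (q : ℕ) at h5
    omega
  · calc ∏ p : S, (1 - 1 / (8 * ((p : ℕ) : ℝ)))
        ≤ ∏ p : S, Real.exp (-(1 / (8 * ((p : ℕ) : ℝ)))) := by
          refine prod_le_prod (fun p _ => ?_) fun p _ => Real.one_sub_le_exp_neg _
          have : (1 : ℝ) ≤ (p : ℕ) := by exact_mod_cast p.1.2.one_le
          rw [sub_nonneg, div_le_one (by positivity)]
          linarith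
      _ = Real.exp (-(1 / 8 * ∑ p ∈ S, 1 / ((p : ℕ) : ℝ))) := by
          rw [← Real.exp_sum, mul_sum, ← sum_neg_distrib, ← sum_coe_sort S]
          congr 1
          refine sum_congr rfl fun p _ => ?_
          rw [one_div_mul_one_div]
      _ ≤ Real.exp (Real.log δ) := Real.exp_le_exp.2 (by linarith)
      _ = δ := Real.exp_log hδ

theorem exists_card_isUnobstructed_le {δ : ℝ} (hδ : 0 < δ) : ∃ C > (0 : ℝ), ∀ Y : ℕ, ∀ e : ℤ,
    (e = 1 ∨ e = -1) → (#{t ∈ triples Y | IsUnobstructed e t} : ℝ) ≤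
      δ * (Y * (1 + Real.log Y) ^ 2) + C * (Y * (1 + Real.log Y)) := by
  obtain ⟨S, h2, h3, hS⟩ := exists_prod_lt hδ
  have : ∀ p : S, Fact (p : ℕ).Prime := fun p => ⟨p.1.2⟩
  have hP : (0 : ℝ) < ((∏ p : S, (p : ℕ) : ℕ) : ℝ) := by
    exact_mod_cast (show 0 < ∏ p : S, (p : ℕ) by omega)
  refine ⟨3 * ((∏ p : S, (p : ℕ) : ℕ) : ℝ), by positivity, fun Y e he => ?_⟩
  refine (card_isUnobstructed_le (fun p : S => (p : ℕ))
    (fun p q h => Subtype.ext (Subtype.ext h)) h2 h3 he Y).trans ?_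
  have hY := Real.log_natCast_nonneg Y
  refine add_le_add (mul_le_mul_of_nonneg_right hS (by positivity)) (le_of_eq (by ring))

/-- The number of biquadratic fields failing the Hasse norm principle is eventually smaller than
any fixed proportion of the number of all biquadratic fields. -/
theorem eventually_failCount_le {ε : ℝ} (hε : 0 < ε) :
    ∀ᶠ X : ℝ in Filter.atTop, (biquadHNPFailCount X : ℝ) ≤ ε * biquadCount X := by
  obtain ⟨κ, hκ, Y₀, hgood⟩ := hasManyTriples_isGoodTriple
  obtain ⟨δ, hδ⟩ : ∃ δ, δ = ε * κ / (64 * 18432) := ⟨_, rfl⟩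
  have hδ0 : 0 < δ := by rw [hδ]; positivity
  obtain ⟨C, hC, hfail⟩ := exists_card_isUnobstructed_le hδ0
  obtain ⟨N, hN⟩ : ∃ N : ℕ, N = max Y₀ (max 512
    (max ⌈Real.exp (6144 * 64 * C / (ε * κ))⌉₊ ⌈Real.exp (6 / κ)⌉₊)) := ⟨_, rfl⟩
  filter_upwards [Filter.eventually_ge_atTop ((16 * ((N : ℝ) + 1)) ^ 2)] with X hX
  obtain ⟨x, hx⟩ : ∃ x, x = √X := ⟨_, rfl⟩
  have hXpos : 0 ≤ X := le_trans (by positivity) hX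
  have hx0 : 0 ≤ x := hx ▸ Real.sqrt_nonneg _
  have hxX : x ^ 2 = X := hx ▸ Real.sq_sqrt hXpos
  have hxN : 16 * ((N : ℝ) + 1) ≤ x := hx ▸ Real.le_sqrt_of_sq_le hX
  obtain ⟨Z, hZ⟩ : ∃ Z, Z = ⌊x / 16⌋₊ := ⟨_, rfl⟩
  have hZle : (Z : ℝ) ≤ x / 16 := hZ ▸ Nat.floor_le (by positivity)
  have hZlt : x / 16 < Z + 1 := hZ ▸ Nat.lt_floor_add_one _
  have hNZ : N ≤ Z := by
    rw [hZ]
    exact Nat.le_floor (by linarith)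
  have hY₀ : Y₀ ≤ Z := (hN ▸ le_max_left _ _).trans hNZ
  have h512 : 512 ≤ Z := (hN ▸ (le_max_left _ _).trans (le_max_right _ _)).trans hNZ
  have hl1 : ⌈Real.exp (6144 * 64 * C / (ε * κ))⌉₊ ≤ Z :=
    (hN ▸ ((le_max_left _ _).trans (le_max_right _ _)).trans (le_max_right _ _)).trans hNZ
  have hl2 : ⌈Real.exp (6 / κ)⌉₊ ≤ Z :=
    (hN ▸ ((le_max_right _ _).trans (le_max_right _ _)).trans (le_max_right _ _)).trans hNZ
  have hZ512 : (512 : ℝ) ≤ Z := by exact_mod_cast h512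
  have hZ0 : (0 : ℝ) < Z := by linarith
  obtain ⟨L, hL⟩ : ∃ L, L = Real.log Z := ⟨_, rfl⟩
  have hL1 : 6144 * 64 * C / (ε * κ) ≤ L := by
    rw [hL, Real.le_log_iff_exp_le hZ0]
    exact (Nat.le_ceil _).trans (by exact_mod_cast hl1)
  have hL2 : 6 / κ ≤ L := by
    rw [hL, Real.le_log_iff_exp_le hZ0]
    exact (Nat.le_ceil _).trans (by exact_mod_cast hl2)
  have hL3 : 1 ≤ L := by
    rw [hL, Real.le_log_iff_exp_le hZ0]
    linarith [Real.exp_one_lt_d9]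
  have hLsq : L ≤ L ^ 2 := by
    rw [sq]; exact le_mul_of_one_le_left (by linarith) hL3
  -- the lower bound for the number of fields
  have hlow : κ * (Z * L ^ 2) ≤ 32 * biquadCount X := by
    have h1 := hgood Z hY₀
    have h2 := card_goodTriples_le (X := X) (Z := Z) (by
      rw [← hxX]
      have := pow_le_pow_left₀ hZ0.le hZle 2
      linarith)
    have h2' : (#{t ∈ triples Z | IsGoodTriple t.1 t.2.1 t.2.2} : ℝ) ≤
        16 * biquadCount X + 3 * Z := by exact_mod_cast h2
    rw [← hL] at h1
    have h3 : 6 ≤ κ * L ^ 2 := by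
      rw [div_le_iff₀ hκ] at hL2
      have := mul_le_mul_of_nonneg_left hLsq hκ.le
      linarith
    have h4 := mul_le_mul_of_nonneg_left h3 hZ0.le
    linarith
  -- the upper bound for the number of failures
  obtain ⟨Y, hY⟩ : ∃ Y, Y = ⌊16 * x⌋₊ := ⟨_, rfl⟩
  have hYle : (Y : ℝ) ≤ 512 * Z := by
    have h1 : (Y : ℝ) ≤ 16 * x := hY ▸ Nat.floor_le (by positivity)
    linarith
  have hYlog : 1 + Real.log Y ≤ 3 * L := by
    have h1 : Real.log Y ≤ 2 * L := by
      rcases Nat.eq_zero_or_pos Y with h0 | h0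
      · rw [h0]
        simp
        linarith
      · have h2 : (Y : ℝ) ≤ Z ^ 2 := by
          rw [sq]
          exact hYle.trans (mul_le_mul_of_nonneg_right hZ512 hZ0.le)
        have h3 := Real.log_le_log (by exact_mod_cast h0) h2
        rw [Real.log_pow, ← hL] at h3
        exact_mod_cast h3
    linarith
  have hYlog0 : 0 ≤ 1 + Real.log Y := by
    have := Real.log_natCast_nonneg Y
    linarith
  have hup : ∀ e : ℤ, (e = 1 ∨ e = -1) → (#{t ∈ triples Y | IsUnobstructed e t} : ℝ) ≤
      δ * (512 * Z * (3 * L) ^ 2) + C * (512 * Z * (3 * L)) := by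
    intro e he
    refine (hfail Y e he).trans (add_le_add ?_ ?_)
    · refine mul_le_mul_of_nonneg_left ?_ hδ0.le
      exact mul_le_mul hYle (pow_le_pow_left₀ hYlog0 hYlog 2) (by positivity) (by positivity)
    · refine mul_le_mul_of_nonneg_left ?_ hC.le
      exact mul_le_mul hYle hYlog hYlog0 (by positivity)
  have htot : (biquadHNPFailCount X : ℝ) ≤ 2 * (#{t ∈ triples Y | IsUnobstructed 1 t} +
      #{t ∈ triples Y | IsUnobstructed (-1) t}) := by
    rw [hY, hx]
    exact_mod_cast biquadHNPFailCount_le X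
  have u1 := hup 1 (Or.inl rfl)
  have u2 := hup (-1) (Or.inr rfl)
  have h6 : 6144 * C * L ≤ ε * κ / 64 * L ^ 2 := by
    rw [div_le_iff₀ (by positivity)] at hL1
    have := mul_le_mul_of_nonneg_right hL1 (show 0 ≤ L / 64 by linarith)
    linarith
  have h7 := mul_le_mul_of_nonneg_left h6 hZ0.le
  have h8 : δ * 18432 = ε * κ / 64 := by
    rw [hδ]; ring
  have h9 : 4 * (δ * (512 * Z * (3 * L) ^ 2)) = ε * κ / 64 * (Z * L ^ 2) := by
    rw [← h8]; ring
  have h10 := mul_le_mul_of_nonneg_left hlow hε.le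
  linarith

end Conclusion

/-- `S̃(X)/S(X) → 0` as `X → ∞`: 0% of biquadratic extensions of `ℚ`,
ordered by discriminant, fail the Hasse norm principle. -/
theorem stmt_19 :
    Filter.Tendsto (fun X : ℝ => (biquadHNPFailCount X : ℝ) / (biquadCount X : ℝ))
      Filter.atTop (nhds 0) := by
  rw [Metric.tendsto_nhds]
  intro ε hε
  filter_upwards [eventually_failCount_le (half_pos hε)] with X hX
  rw [Real.dist_eq, sub_zero, abs_of_nonneg (by positivity)]
  refine (div_le_of_le_mul₀ (Nat.cast_nonneg _) (half_pos hε).le hX).trans_lt (half_lt_self hε)
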